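/- arXiv:2508.07861 — 2 statements merged into one kernel-verified Lean document; each statement's English description precedes it below -/
import Mathlib

section
/- Let n ≥ 2. For every K > 0 there exist constants C > 0 and N ∈ ℕ (depending only on n and K) such that: for every harmonic function u on the closed unit ball B(0,1) ⊂ ℝⁿ (i.e. Δu = 0 on B(0,1)) with ℋ^{n-1}(Z(u) ∩ B(0,1)) ≤ K, one has sup_{B(0,1/2)} |u| ≤ C · Σ_{|α|=0}^{N} |D^α u(0)|. -/
open MeasureTheory Metric

noncomputable section

/-- Partial derivative in the `i`-th coordinate direction. -/
def pd {n : ℕ} (i : Fin n) (u : EuclideanSpace ℝ (Fin n) → ℝ) :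
    EuclideanSpace ℝ (Fin n) → ℝ :=
  fun x => fderiv ℝ u x (EuclideanSpace.single i 1)

/-- Iterated partial derivative `D^α u` for a multi-index `α : Fin n → ℕ`. -/
def mderiv {n : ℕ} (α : Fin n → ℕ) (u : EuclideanSpace ℝ (Fin n) → ℝ) :
    EuclideanSpace ℝ (Fin n) → ℝ :=
  (List.finRange n).foldr (fun i v => (pd i)^[α i] v) u

/-- `Σ_{|α| ≤ N} |D^α u x|`, the sum over all multi-indices of order at most `N`. -/
def derivSum {n : ℕ} (N : ℕ) (u : EuclideanSpace ℝ (Fin n) → ℝ)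
    (x : EuclideanSpace ℝ (Fin n)) : ℝ :=
  ∑ α ∈ Finset.univ.filter (fun α : Fin n → Fin (N + 1) => (∑ i, (α i : ℕ)) ≤ N),
    |mderiv (fun i => (α i : ℕ)) u x|

/-- `sup_{B(c,r)} |u|` over the closed ball `B(c,r)`. -/
def supBall {n : ℕ} (u : EuclideanSpace ℝ (Fin n) → ℝ) (c : EuclideanSpace ℝ (Fin n))
    (r : ℝ) : ℝ :=
  ⨆ x : closedBall c r, |u x|

section Calculus

open Filter Topology
open scoped ContDiff

variable {n : ℕ}

local notation "𝔼" => EuclideanSpace ℝ (Fin n)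

/-- Derivative in the direction `z`. -/
def dirDeriv (z : EuclideanSpace ℝ (Fin n)) (u : EuclideanSpace ℝ (Fin n) → ℝ) :
    EuclideanSpace ℝ (Fin n) → ℝ :=
  fun x => fderiv ℝ u x z

lemma pd_eq_dirDeriv (i : Fin n) (u : 𝔼 → ℝ) :
    pd i u = dirDeriv (EuclideanSpace.single i 1) u := rfl

lemma contDiff_dirDeriv {u : 𝔼 → ℝ} (hu : ContDiff ℝ ∞ u) (z : 𝔼) :
    ContDiff ℝ ∞ (dirDeriv z u) := by
  have h : ContDiff ℝ ∞ (fderiv ℝ u) := hu.fderiv_right (by simp)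
  exact h.clm_apply contDiff_const

lemma contDiff_pd {u : 𝔼 → ℝ} (hu : ContDiff ℝ ∞ u) (i : Fin n) : ContDiff ℝ ∞ (pd i u) :=
  contDiff_dirDeriv hu _

lemma dirDeriv_comm {u : 𝔼 → ℝ} (hu : ContDiff ℝ ∞ u) (y z : 𝔼) :
    dirDeriv z (dirDeriv y u) = dirDeriv y (dirDeriv z u) := by
  have h : ContDiff ℝ ∞ (fderiv ℝ u) := hu.fderiv_right (by simp)
  have key : ∀ (a b x : 𝔼), dirDeriv a (dirDeriv b u) x = fderiv ℝ (fderiv ℝ u) x a b := by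
    intro a b x
    have hd : HasFDerivAt (fderiv ℝ u) (fderiv ℝ (fderiv ℝ u) x) x :=
      (h.differentiable (by simp) x).hasFDerivAt
    have := (hd.clm_apply (hasFDerivAt_const b x)).fderiv
    change fderiv ℝ (fun y => fderiv ℝ u y b) x a = _
    rw [this]
    simp
  funext x
  rw [key, key]
  have hs : IsSymmSndFDerivAt ℝ u x := hu.contDiffAt.isSymmSndFDerivAt
    (by simpa using WithTop.coe_le_coe.2 (le_top (a := (2 : ℕ∞))))
  exact hs.eq z y

/-- A globally smooth function which is harmonic in the open ball `B(c, R)`. -/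
structure HarmonicIn (u : EuclideanSpace ℝ (Fin n) → ℝ) (c : EuclideanSpace ℝ (Fin n))
    (R : ℝ) : Prop where
  smooth : ContDiff ℝ ∞ u
  lap : ∀ x ∈ ball c R, ∑ i, pd i (pd i u) x = 0

lemma HarmonicIn.mono {u : 𝔼 → ℝ} {c c' : 𝔼} {R R' : ℝ} (hu : HarmonicIn u c R)
    (h : ball c' R' ⊆ ball c R) : HarmonicIn u c' R' :=
  ⟨hu.smooth, fun x hx => hu.lap x (h hx)⟩

lemma HarmonicIn.dirDeriv {u : 𝔼 → ℝ} {c : 𝔼} {R : ℝ} (hu : HarmonicIn u c R) (z : 𝔼) :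
    HarmonicIn (dirDeriv z u) c R := by
  refine ⟨contDiff_dirDeriv hu.smooth z, fun x hx => ?_⟩
  have h1 : ∀ i, pd i (pd i (_root_.dirDeriv z u)) = _root_.dirDeriv z (pd i (pd i u)) := by
    intro i
    simp only [pd_eq_dirDeriv]
    rw [dirDeriv_comm hu.smooth z, dirDeriv_comm (contDiff_dirDeriv hu.smooth _) z]
  simp only [h1, _root_.dirDeriv]
  have h2 : ∀ i ∈ Finset.univ, DifferentiableAt ℝ (pd i (pd i u)) x := fun i _ =>
    ((contDiff_pd (contDiff_pd hu.smooth i) i).differentiable (by simp)) x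
  have h3 := fderiv_fun_sum h2
  have h4 : (fun y => ∑ i, pd i (pd i u) y) =ᶠ[𝓝 x] fun _ => (0 : ℝ) := by
    filter_upwards [isOpen_ball.mem_nhds hx] with y hy using hu.lap y hy
  rw [h4.fderiv_eq] at h3
  have := congrArg (fun L => L z) h3
  simpa using this.symm

lemma HarmonicIn.neg {u : 𝔼 → ℝ} {c : 𝔼} {R : ℝ} (hu : HarmonicIn u c R) :
    HarmonicIn (fun x => -u x) c R := by
  refine ⟨hu.smooth.neg, fun x hx => ?_⟩
  have h1 : ∀ i (v : 𝔼 → ℝ), pd i (fun x => - v x) = fun x => - pd i v x := by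
    intro i v; funext y; simp [pd]
  simp only [h1, Finset.sum_neg_distrib, hu.lap x hx, neg_zero]

lemma HarmonicIn.add_const {u : 𝔼 → ℝ} {c : 𝔼} {R : ℝ} (hu : HarmonicIn u c R) (m : ℝ) :
    HarmonicIn (fun x => u x + m) c R := by
  refine ⟨hu.smooth.add contDiff_const, fun x hx => ?_⟩
  have h1 : ∀ i, pd i (fun x => u x + m) = pd i u := by
    intro i; funext y; simp [pd]
  simp only [h1, hu.lap x hx]

lemma HarmonicIn.continuous {u : 𝔼 → ℝ} {c : 𝔼} {R : ℝ} (hu : HarmonicIn u c R) :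
    Continuous u := hu.smooth.continuous

lemma HarmonicIn.differentiable {u : 𝔼 → ℝ} {c : 𝔼} {R : ℝ} (hu : HarmonicIn u c R) :
    Differentiable ℝ u := hu.smooth.differentiable (by simp)

lemma dirDeriv_comp_affine {u : 𝔼 → ℝ} (hu : Differentiable ℝ u) (x z : 𝔼) (s : ℝ) :
    dirDeriv z (fun y => u (x + s • y)) = fun y => s * dirDeriv z u (x + s • y) := by
  funext y
  have h : HasFDerivAt (fun y : 𝔼 => x + s • y) (s • ContinuousLinearMap.id ℝ 𝔼) y :=
    ((hasFDerivAt_id y).const_smul s).const_add x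
  have := ((hu (x + s • y)).hasFDerivAt.comp y h).fderiv
  simp only [dirDeriv]
  rw [show (fun y => u (x + s • y)) = u ∘ fun y => x + s • y from rfl, this]
  simp

lemma HarmonicIn.comp_affine {u : 𝔼 → ℝ} {c x : 𝔼} {R s : ℝ} (hu : HarmonicIn u c R)
    {c' : 𝔼} {ρ : ℝ} (h : ∀ y ∈ ball c' ρ, x + s • y ∈ ball c R) :
    HarmonicIn (fun y => u (x + s • y)) c' ρ := by
  refine ⟨hu.smooth.comp (by fun_prop), fun y hy => ?_⟩
  have h1 : ∀ i, pd i (pd i (fun y => u (x + s • y)))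
      = fun y => s * (s * pd i (pd i u) (x + s • y)) := by
    intro i
    simp only [pd_eq_dirDeriv]
    rw [dirDeriv_comp_affine hu.differentiable]
    have h2 := (contDiff_dirDeriv hu.smooth (EuclideanSpace.single i 1)).differentiable (by simp)
    have h3 : _root_.dirDeriv (EuclideanSpace.single i 1)
        (fun y => s * _root_.dirDeriv (EuclideanSpace.single i 1) u (x + s • y))
        = fun y => s * _root_.dirDeriv (EuclideanSpace.single i 1)
          (fun y => _root_.dirDeriv (EuclideanSpace.single i 1) u (x + s • y)) y := by
      funext w
      simp only [_root_.dirDeriv]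
      rw [fderiv_const_mul]
      · simp
      · exact (h2.comp (by fun_prop)) w
    rw [h3, dirDeriv_comp_affine h2]
  simp only [h1]
  rw [← Finset.mul_sum, ← Finset.mul_sum, hu.lap _ (h y hy)]
  simp

end Calculus

section Weight

open Filter Topology
open scoped ContDiff

variable {n : ℕ}

local notation "𝔼" => EuclideanSpace ℝ (Fin n)

/-- The radial weight `(r² - |z|²)₊`. -/
def weight (r : ℝ) (z : EuclideanSpace ℝ (Fin n)) : ℝ := max 0 (r ^ 2 - ‖z‖ ^ 2)

lemma continuous_weight (r : ℝ) : Continuous (weight (n := n) r) := by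
  unfold weight; fun_prop

lemma weight_nonneg (r : ℝ) (z : 𝔼) : 0 ≤ weight r z := le_max_left _ _

lemma weight_eq_zero {r : ℝ} (hr : 0 ≤ r) {z : 𝔼} (hz : r ≤ ‖z‖) : weight r z = 0 :=
  max_eq_left (by nlinarith)

lemma hasCompactSupport_weight {r : ℝ} (hr : 0 ≤ r) : HasCompactSupport (weight (n := n) r) := by
  refine HasCompactSupport.intro (isCompact_closedBall 0 r) fun x hx => ?_
  refine weight_eq_zero hr ?_
  simp at hx
  exact hx.le

lemma integrable_mul_weight {f : 𝔼 → ℝ} (hf : Continuous f) {r : ℝ} (hr : 0 ≤ r) :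
    Integrable (fun z => f z * weight r z) :=
  (hf.mul (continuous_weight r)).integrable_of_hasCompactSupport
    ((hasCompactSupport_weight hr).mul_left)

/-- Total mass of the unit weight. -/
def weightMass (n : ℕ) : ℝ := ∫ z : EuclideanSpace ℝ (Fin n), weight 1 z

lemma weightMass_pos : 0 < weightMass n := by
  have hi : Integrable (weight (n := n) 1) :=
    (continuous_weight 1).integrable_of_hasCompactSupport (hasCompactSupport_weight zero_le_one)
  refine (integral_pos_iff_support_of_nonneg (weight_nonneg 1) hi).2 ?_
  refine ((continuous_weight 1).isOpen_support).measure_pos volume ⟨0, ?_⟩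
  simp [weight]

lemma hasDerivAt_sq_max_zero (s : ℝ) :
    HasDerivAt (fun s : ℝ => (max 0 s) ^ 2) (2 * max 0 s) s := by
  rcases lt_trichotomy s 0 with h | h | h
  · rw [max_eq_left h.le]
    refine (hasDerivAt_const s (0 : ℝ)).congr_of_eventuallyEq ?_ |>.congr_deriv (by simp)
    filter_upwards [gt_mem_nhds h] with y hy
    simp [max_eq_left hy.le]
  · subst h
    rw [hasDerivAt_iff_isLittleO_nhds_zero]
    refine Asymptotics.IsBigO.trans_isLittleO (g := fun h : ℝ => h ^ 2) ?_ ?_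
    · refine Asymptotics.IsBigO.of_bound 1 (Eventually.of_forall fun x => ?_)
      simp only [zero_add, max_self, mul_zero, smul_eq_mul, Real.norm_eq_abs, one_mul]
      rw [zero_pow two_ne_zero, sub_zero, sub_zero, abs_of_nonneg (sq_nonneg _),
        abs_of_nonneg (sq_nonneg _)]
      rcases le_total x 0 with hx | hx
      · rw [max_eq_left hx]; nlinarith
      · rw [max_eq_right hx]
    · exact Asymptotics.isLittleO_pow_id (by norm_num)
  · rw [max_eq_right h.le]
    have : HasDerivAt (fun s : ℝ => s ^ 2) (2 * s) s := by simpa using hasDerivAt_pow 2 s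
    refine this.congr_of_eventuallyEq ?_
    filter_upwards [lt_mem_nhds h] with y hy
    simp [max_eq_right hy.le]

lemma hasFDerivAt_weight_sq (z : 𝔼) :
    HasFDerivAt (fun z : 𝔼 => weight 1 z ^ 2)
      ((2 * weight 1 z) • -((2 : ℕ) • (innerSL ℝ z : 𝔼 →L[ℝ] ℝ))) z := by
  have h1 : HasFDerivAt (fun z : 𝔼 => (1 : ℝ) ^ 2 - ‖z‖ ^ 2)
      (-((2 : ℕ) • (innerSL ℝ z : 𝔼 →L[ℝ] ℝ))) z := by
    have := (hasStrictFDerivAt_norm_sq z).hasFDerivAt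
    exact this.const_sub _
  exact (hasDerivAt_sq_max_zero _).comp_hasFDerivAt z h1

lemma dirDeriv_eq_sum (U : 𝔼 → ℝ) (y z : 𝔼) :
    dirDeriv y U z = ∑ i, y i * pd i U z := by
  have hy : y = ∑ i, y i • EuclideanSpace.single i (1 : ℝ) := by
    have := (EuclideanSpace.basisFun (Fin n) ℝ).sum_repr y
    simpa using this.symm
  unfold dirDeriv
  conv_lhs => rw [hy]
  simp only [map_sum, map_smul, smul_eq_mul]
  rfl

lemma pd_weight_sq (i : Fin n) (z : 𝔼) :
    fderiv ℝ (fun z : 𝔼 => weight 1 z ^ 2) z (EuclideanSpace.single i 1)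
      = -4 * weight 1 z * z i := by
  rw [(hasFDerivAt_weight_sq z).fderiv]
  simp [EuclideanSpace.inner_single_right]
  ring

lemma harmonicIn_const (a : ℝ) (c : 𝔼) (R : ℝ) : HarmonicIn (fun _ : 𝔼 => a) c R := by
  have h : ∀ (i : Fin n) (b : ℝ), pd i (fun _ : 𝔼 => b) = fun _ => 0 := by
    intro i b; funext y; simp [pd]
  exact ⟨contDiff_const, fun y _ => by simp [h]⟩

/-- Green's identity for the radial weight. -/
lemma green_weight {U V : 𝔼 → ℝ} (hU : HarmonicIn U 0 1) (hV : HarmonicIn V 0 1) :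
    ∫ z, (V z * dirDeriv z U z - U z * dirDeriv z V z) * weight 1 z = 0 := by
  set F : Fin n → 𝔼 → ℝ := fun i z => V z * pd i U z - U z * pd i V z with hF
  have hFs : ∀ i, ContDiff ℝ ∞ (F i) := fun i =>
    (hV.smooth.mul (contDiff_pd hU.smooth i)).sub (hU.smooth.mul (contDiff_pd hV.smooth i))
  have hFd : ∀ i, Differentiable ℝ (F i) := fun i => (hFs i).differentiable (by simp)
  have hcs : HasCompactSupport (fun z : 𝔼 => weight 1 z ^ 2) := by
    have := (hasCompactSupport_weight (n := n) zero_le_one).mul_left (f := weight 1)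
    have h2 : (fun z : 𝔼 => weight 1 z ^ 2) = weight 1 * weight 1 := by
      funext z; simp [pow_two]
    rw [h2]; exact this
  have hcont : Continuous (fun z : 𝔼 => weight 1 z ^ 2) := (continuous_weight 1).pow 2
  have hparts : ∀ i, ∫ z, F i z * (-4 * weight 1 z * z i)
      = -∫ z, pd i (F i) z * weight 1 z ^ 2 := by
    intro i
    have := integral_mul_fderiv_eq_neg_fderiv_mul_of_integrable (μ := (volume : Measure 𝔼))
      (f := F i) (g := fun z : 𝔼 => weight 1 z ^ 2) (v := EuclideanSpace.single i 1)
      ?_ ?_ ?_ (fun z _ => (hFd i) z) (fun z _ => (hasFDerivAt_weight_sq z).differentiableAt)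
    · simpa only [pd_weight_sq, pd] using this
    · exact ((contDiff_pd (hFs i) i).continuous.mul hcont).integrable_of_hasCompactSupport
        hcs.mul_left
    · simp only [pd_weight_sq]
      have : Continuous fun z : 𝔼 => F i z * (-4 * z i) :=
        (hFs i).continuous.mul (by fun_prop)
      refine (integrable_mul_weight this zero_le_one).congr (Eventually.of_forall fun z => ?_)
      ring
    · exact ((hFs i).continuous.mul hcont).integrable_of_hasCompactSupport hcs.mul_left
  have hint1 : ∀ i ∈ Finset.univ, Integrable fun z => F i z * (-4 * weight 1 z * z i) := by
    intro i _
    have : Continuous fun z : 𝔼 => F i z * (-4 * z i) :=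
      (hFs i).continuous.mul (by fun_prop)
    refine (integrable_mul_weight this zero_le_one).congr (Eventually.of_forall fun z => ?_)
    ring
  have hint2 : ∀ i ∈ Finset.univ, Integrable fun z => pd i (F i) z * weight 1 z ^ 2 := fun i _ =>
    ((contDiff_pd (hFs i) i).continuous.mul hcont).integrable_of_hasCompactSupport hcs.mul_left
  have hpd : ∀ i z, pd i (F i) z = V z * pd i (pd i U) z - U z * pd i (pd i V) z := by
    intro i z
    have hUd := (hU.differentiable z).hasFDerivAt
    have hVd := (hV.differentiable z).hasFDerivAt
    have hUd' := ((contDiff_pd hU.smooth i).differentiable (by simp) z).hasFDerivAt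
    have hVd' := ((contDiff_pd hV.smooth i).differentiable (by simp) z).hasFDerivAt
    have := ((hVd.mul hUd').sub (hUd.mul hVd')).fderiv
    have h2 : pd i (F i) z = fderiv ℝ (V * pd i U - U * pd i V) z
      (EuclideanSpace.single i 1) := rfl
    rw [h2, this]
    simp [pd]
    ring
  have hzero : ∀ z, (∑ i, pd i (F i) z) * weight 1 z ^ 2 = 0 := by
    intro z
    by_cases hz : z ∈ ball (0 : 𝔼) 1
    · simp only [hpd, Finset.sum_sub_distrib, ← Finset.mul_sum, hU.lap z hz, hV.lap z hz]
      simp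
    · rw [weight_eq_zero zero_le_one (by simpa using hz)]; simp
  have hsum : ∑ i, ∫ z, F i z * (-4 * weight 1 z * z i) = 0 := by
    simp only [hparts, Finset.sum_neg_distrib]
    rw [← integral_finsetSum _ hint2]
    simp only [← Finset.sum_mul, hzero, integral_zero, neg_zero]
  rw [← integral_finsetSum _ hint1] at hsum
  have : ∀ z, ∑ i, F i z * (-4 * weight 1 z * z i)
      = -4 * ((V z * dirDeriv z U z - U z * dirDeriv z V z) * weight 1 z) := by
    intro z
    rw [dirDeriv_eq_sum, dirDeriv_eq_sum, Finset.mul_sum, Finset.mul_sum,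
      ← Finset.sum_sub_distrib, Finset.sum_mul, Finset.mul_sum]
    refine Finset.sum_congr rfl fun i _ => ?_
    simp only [hF]; ring
  simp only [this, integral_const_mul] at hsum
  linarith

lemma green_weight_scaled {u v : 𝔼 → ℝ} {x : 𝔼} {R a b : ℝ} (hu : HarmonicIn u x R)
    (hv : HarmonicIn v x R) (ha : 0 ≤ a) (hb : 0 ≤ b) (haR : a ≤ R) (hbR : b ≤ R) :
    ∫ z, (v (x + b • z) * (a * dirDeriv z u (x + a • z))
      - u (x + a • z) * (b * dirDeriv z v (x + b • z))) * weight 1 z = 0 := by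
  have key : ∀ {w : 𝔼 → ℝ} {s : ℝ}, HarmonicIn w x R → 0 ≤ s → s ≤ R →
      HarmonicIn (fun z => w (x + s • z)) 0 1 := by
    intro w s hw hs hsR
    by_cases hs0 : s = 0
    · subst hs0
      have : (fun z : 𝔼 => w (x + (0 : ℝ) • z)) = fun _ => w x := by simp
      rw [this]
      exact harmonicIn_const _ _ _
    · refine hw.comp_affine fun y hy => ?_
      simp only [mem_ball, dist_self_add_left, norm_smul, Real.norm_eq_abs, abs_of_nonneg hs]
      have hy1 : ‖y‖ < 1 := by simpa using hy
      have : 0 < s := lt_of_le_of_ne hs (Ne.symm hs0)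
      nlinarith
  have := green_weight (key hu ha haR) (key hv hb hbR)
  simpa only [dirDeriv_comp_affine hu.differentiable, dirDeriv_comp_affine hv.differentiable]
    using this

lemma hasDerivAt_integral_weight {f f' : ℝ → 𝔼 → ℝ}
    (hd : ∀ s z, HasDerivAt (fun s => f s z) (f' s z) s)
    (hf : Continuous (Function.uncurry f)) (hf' : Continuous (Function.uncurry f')) (s : ℝ) :
    HasDerivAt (fun s => ∫ z, f s z * weight 1 z) (∫ z, f' s z * weight 1 z) s := by
  have hK : IsCompact (closedBall s 1 ×ˢ closedBall (0 : 𝔼) 1) :=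
    (isCompact_closedBall _ _).prod (isCompact_closedBall _ _)
  obtain ⟨C, hC⟩ := hK.exists_bound_of_continuousOn hf'.continuousOn
  refine (hasDerivAt_integral_of_dominated_loc_of_deriv_le (μ := volume)
    (F := fun s z => f s z * weight 1 z) (F' := fun s z => f' s z * weight 1 z)
    (bound := fun z => C * weight 1 z) (ball_mem_nhds s one_pos) ?_ ?_ ?_ ?_ ?_ ?_).2
  · refine Eventually.of_forall fun t => ?_
    exact ((hf.comp (by fun_prop : Continuous fun z : 𝔼 => (t, z))).mul
      (continuous_weight 1)).aestronglyMeasurable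
  · exact integrable_mul_weight (hf.comp (by fun_prop : Continuous fun z : 𝔼 => (s, z)))
      zero_le_one
  · exact ((hf'.comp (by fun_prop : Continuous fun z : 𝔼 => (s, z))).mul
      (continuous_weight 1)).aestronglyMeasurable
  · refine Eventually.of_forall fun z t ht => ?_
    by_cases hz : ‖z‖ ≤ 1
    · have := hC (t, z) ⟨ball_subset_closedBall ht, by simpa using hz⟩
      rw [norm_mul, Real.norm_of_nonneg (weight_nonneg 1 z)]
      exact mul_le_mul_of_nonneg_right this (weight_nonneg 1 z)
    · rw [weight_eq_zero zero_le_one (not_le.1 hz).le]; simp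
  · exact integrable_mul_weight continuous_const zero_le_one
  · exact Eventually.of_forall fun z t _ => (hd t z).mul_const _

lemma hasDerivAt_comp_ray {u : 𝔼 → ℝ} (hu : ContDiff ℝ ∞ u) (x z : 𝔼) {φ : ℝ → ℝ} {φ' s : ℝ}
    (hφ : HasDerivAt φ φ' s) :
    HasDerivAt (fun s => u (x + φ s • z)) (φ' * dirDeriv z u (x + φ s • z)) s := by
  have h1 : HasDerivAt (fun s => x + φ s • z) (φ' • z) s := (hφ.smul_const z).const_add x
  have h2 := ((hu.differentiable (by simp)) (x + φ s • z)).hasFDerivAt.comp_hasDerivAt s h1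
  refine HasDerivAt.congr_deriv h2 ?_
  simp [dirDeriv]

lemma continuous_dirDeriv_uncurry {u : 𝔼 → ℝ} (hu : ContDiff ℝ ∞ u) {X : Type*}
    [TopologicalSpace X] {f g : X → 𝔼} (hf : Continuous f) (hg : Continuous g) :
    Continuous fun p => dirDeriv (f p) u (g p) := by
  have h : ContDiff ℝ ∞ (fderiv ℝ u) := hu.fderiv_right (by simp)
  exact (h.continuous.comp hg).clm_apply hf

lemma mean_value_unit {u : 𝔼 → ℝ} {x : 𝔼} {R : ℝ} (hu : HarmonicIn u x R) (hR : 0 ≤ R) :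
    ∫ z, u (x + R • z) * weight 1 z = u x * weightMass n := by
  have hder : ∀ s : ℝ, HasDerivAt (fun s : ℝ => ∫ z, u (x + s • z) * weight 1 z)
      (∫ z, (dirDeriv z u (x + s • z)) * weight 1 z) s := by
    intro s
    refine hasDerivAt_integral_weight (f := fun s z => u (x + s • z))
      (f' := fun s z => dirDeriv z u (x + s • z)) ?_ ?_ ?_ s
    · intro s z
      simpa using hasDerivAt_comp_ray hu.smooth x z (hasDerivAt_id s)
    · have := hu.continuous
      unfold Function.uncurry; fun_prop
    · exact continuous_dirDeriv_uncurry hu.smooth (by fun_prop) (by fun_prop)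
  have hzero : ∀ s ∈ Set.Ico 0 R, ∫ z, (dirDeriv z u (x + s • z)) * weight 1 z = 0 := by
    intro s hs
    rcases hs.1.eq_or_lt with h0 | h0
    · subst h0
      have h1 := integral_neg_eq_self
        (fun z : 𝔼 => dirDeriv z u (x + (0 : ℝ) • z) * weight 1 z) volume
      have h2 : ∀ z : 𝔼, dirDeriv (-z) u (x + (0 : ℝ) • -z) * weight 1 (-z)
          = -(dirDeriv z u (x + (0 : ℝ) • z) * weight 1 z) := by
        intro z; simp [dirDeriv, weight]
      simp only [h2, integral_neg] at h1
      linarith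
    · have h1 : HarmonicIn (fun _ : 𝔼 => (1 : ℝ)) x R :=
        harmonicIn_const _ _ _
      have := green_weight_scaled hu h1 hs.1 hs.1 hs.2.le hs.2.le
      have h2 : ∀ z y : 𝔼, dirDeriv z (fun _ : 𝔼 => (1 : ℝ)) y = 0 := by
        intro z y; simp [dirDeriv]
      simp only [h2, mul_zero, sub_zero, one_mul, mul_assoc, integral_const_mul] at this
      exact (mul_eq_zero.1 this).resolve_left h0.ne'
  have := constant_of_has_deriv_right_zero (a := 0) (b := R)
    (fun s _ => (hder s).continuousAt.continuousWithinAt)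
    (fun s hs => by simpa [hzero s hs] using (hder s).hasDerivWithinAt) R ⟨hR, le_rfl⟩
  rw [this]
  simp [integral_const_mul, weightMass]

lemma sq_integral_mul_weight_le {f g : 𝔼 → ℝ} (hf : Continuous f) (hg : Continuous g) :
    (∫ z, f z * g z * weight 1 z) ^ 2
      ≤ (∫ z, f z ^ 2 * weight 1 z) * ∫ z, g z ^ 2 * weight 1 z := by
  have h : ∀ t : ℝ, 0 ≤ (∫ z, g z ^ 2 * weight 1 z) * (t * t)
      + (-2 * ∫ z, f z * g z * weight 1 z) * t + ∫ z, f z ^ 2 * weight 1 z := by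
    intro t
    have h1 : 0 ≤ ∫ z, (f z - t * g z) ^ 2 * weight 1 z :=
      integral_nonneg fun z => mul_nonneg (sq_nonneg _) (weight_nonneg _ _)
    have h2 : ∀ z, (f z - t * g z) ^ 2 * weight 1 z = (t * t) * (g z ^ 2 * weight 1 z)
        + (-2 * t) * (f z * g z * weight 1 z) + f z ^ 2 * weight 1 z := by intro z; ring
    have i1 : Integrable fun z => (t * t) * (g z ^ 2 * weight 1 z) :=
      (integrable_mul_weight (hg.pow 2) zero_le_one).const_mul (t * t)
    have i2 : Integrable fun z => (-2 * t) * (f z * g z * weight 1 z) :=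
      (integrable_mul_weight (hf.mul hg) zero_le_one).const_mul (-2 * t)
    have i3 : Integrable fun z => f z ^ 2 * weight 1 z :=
      integrable_mul_weight (hf.pow 2) zero_le_one
    simp only [h2] at h1
    rw [integral_add (f := fun z => t * t * (g z ^ 2 * weight 1 z)
      + -2 * t * (f z * g z * weight 1 z)) (i1.add i2) i3, integral_add i1 i2, integral_const_mul,
      integral_const_mul] at h1
    linarith
  have := discrim_le_zero h
  unfold discrim at this
  nlinarith

lemma sq_integral_sq_le {u : 𝔼 → ℝ} {x : 𝔼} {R t σ : ℝ} (hu : HarmonicIn u x R) (hσ : 0 ≤ σ)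
    (hR : Real.exp (t + σ) ≤ R) :
    (∫ z, u (x + Real.exp t • z) ^ 2 * weight 1 z) ^ 2
      ≤ (∫ z, u (x + Real.exp (t + σ) • z) ^ 2 * weight 1 z)
        * ∫ z, u (x + Real.exp (t - σ) • z) ^ 2 * weight 1 z := by
  have hc := hu.continuous
  have hder : ∀ s : ℝ, HasDerivAt
      (fun s : ℝ => ∫ z, u (x + Real.exp (t + s) • z) * u (x + Real.exp (t - s) • z) * weight 1 z)
      (∫ z, (Real.exp (t + s) * dirDeriv z u (x + Real.exp (t + s) • z)
          * u (x + Real.exp (t - s) • z)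
        + u (x + Real.exp (t + s) • z)
          * (-Real.exp (t - s) * dirDeriv z u (x + Real.exp (t - s) • z))) * weight 1 z) s := by
    intro s
    refine hasDerivAt_integral_weight
      (f := fun s z => u (x + Real.exp (t + s) • z) * u (x + Real.exp (t - s) • z))
      (f' := fun s z => Real.exp (t + s) * dirDeriv z u (x + Real.exp (t + s) • z)
          * u (x + Real.exp (t - s) • z)
        + u (x + Real.exp (t + s) • z)
          * (-Real.exp (t - s) * dirDeriv z u (x + Real.exp (t - s) • z))) ?_ ?_ ?_ s
    · intro s z
      have e1 : HasDerivAt (fun s => Real.exp (t + s)) (Real.exp (t + s)) s := by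
        simpa using ((hasDerivAt_id s).const_add t).exp
      have e2 : HasDerivAt (fun s => Real.exp (t - s)) (-Real.exp (t - s)) s := by
        simpa using ((hasDerivAt_id s).const_sub t).exp
      exact (hasDerivAt_comp_ray hu.smooth x z e1).mul (hasDerivAt_comp_ray hu.smooth x z e2)
    · unfold Function.uncurry; fun_prop
    · have d1 : Continuous fun p : ℝ × 𝔼 => dirDeriv p.2 u (x + Real.exp (t + p.1) • p.2) :=
        continuous_dirDeriv_uncurry hu.smooth (by fun_prop) (by fun_prop)
      have d2 : Continuous fun p : ℝ × 𝔼 => dirDeriv p.2 u (x + Real.exp (t - p.1) • p.2) :=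
        continuous_dirDeriv_uncurry hu.smooth (by fun_prop) (by fun_prop)
      unfold Function.uncurry; fun_prop
  have hconst := constant_of_has_deriv_right_zero (a := 0) (b := σ)
    (fun s _ => (hder s).continuousAt.continuousWithinAt)
    (fun s hs => by
      have hz := green_weight_scaled hu hu (Real.exp_pos (t + s)).le (Real.exp_pos (t - s)).le
        ((Real.exp_le_exp.2 (by linarith [hs.2])).trans hR)
        ((Real.exp_le_exp.2 (by linarith [hs.1])).trans hR)
      refine (hder s).hasDerivWithinAt.congr_deriv (Eq.trans ?_ hz)
      congr 1; funext z; ring) σ ⟨hσ, le_rfl⟩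
  have e : ∫ z, u (x + Real.exp t • z) ^ 2 * weight 1 z
      = ∫ z, u (x + Real.exp (t + σ) • z) * u (x + Real.exp (t - σ) • z) * weight 1 z := by
    rw [hconst]; simp [pow_two]
  rw [e]
  exact sq_integral_mul_weight_le (by fun_prop) (by fun_prop)

end Weight

section Estimates

open Filter Topology
open scoped ContDiff

variable {n : ℕ}

local notation "𝔼" => EuclideanSpace ℝ (Fin n)

lemma weight_smul (r : ℝ) (z : 𝔼) : weight r (r • z) = r ^ 2 * weight 1 z := by
  unfold weight
  rw [mul_max_of_nonneg _ _ (sq_nonneg r), norm_smul, mul_pow, Real.norm_eq_abs, sq_abs]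
  congr 1 <;> ring

lemma integral_mul_weight_eq (f : 𝔼 → ℝ) (x : 𝔼) {r : ℝ} (hr : 0 < r) :
    ∫ z, f z * weight r (z - x) = r ^ (n + 2) * ∫ z, f (x + r • z) * weight 1 z := by
  have h1 : ∫ z, f z * weight r (z - x) = ∫ z, f (x + z) * weight r z := by
    rw [← integral_add_left_eq_self (fun z => f z * weight r (z - x)) x]
    simp
  have h2 := Measure.integral_comp_smul (μ := (volume : Measure 𝔼))
    (fun z => f (x + z) * weight r z) r
  simp only [weight_smul, finrank_euclideanSpace_fin, smul_eq_mul] at h2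
  rw [h1]
  have h3 : ∀ z, f (x + r • z) * (r ^ 2 * weight 1 z) = r ^ 2 * (f (x + r • z) * weight 1 z) := by
    intro z; ring
  simp only [h3, integral_const_mul] at h2
  rw [abs_of_pos (by positivity)] at h2
  rw [pow_add, mul_assoc, h2]
  field_simp

lemma weight_sub_le {r s : ℝ} (hr : 0 ≤ r) (hs : 0 ≤ s) {x y : 𝔼} (h : dist x y ≤ s) (z : 𝔼) :
    weight r (z - y) ≤ weight (r + s) (z - x) := by
  rcases le_total r ‖z - y‖ with h1 | h1
  · rw [weight_eq_zero hr h1]; exact weight_nonneg _ _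
  · refine max_le (weight_nonneg _ _) (le_trans ?_ (le_max_right _ _))
    have h2 : ‖z - x‖ ≤ ‖z - y‖ + s := by
      rw [← dist_eq_norm, ← dist_eq_norm]
      linarith [dist_triangle z y x, dist_comm x y]
    nlinarith [norm_nonneg (z - x), norm_nonneg (z - y)]

lemma integrable_mul_weight_sub {f : 𝔼 → ℝ} (hf : Continuous f) {r : ℝ} (hr : 0 ≤ r) (x : 𝔼) :
    Integrable (fun z => f z * weight r (z - x)) := by
  have h : Continuous fun z => f (z + x) := by fun_prop
  have := (integrable_mul_weight h hr).comp_sub_right x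
  simpa using this

/-- The square of `u` averaged (without normalisation) against the weight of radius `r`
centred at `x`. -/
def sqMass (u : EuclideanSpace ℝ (Fin n) → ℝ) (x : EuclideanSpace ℝ (Fin n)) (r : ℝ) : ℝ :=
  ∫ z, u z ^ 2 * weight r (z - x)

lemma sqMass_eq (u : 𝔼 → ℝ) (x : 𝔼) {r : ℝ} (hr : 0 < r) :
    sqMass u x r = r ^ (n + 2) * ∫ z, u (x + r • z) ^ 2 * weight 1 z :=
  integral_mul_weight_eq (fun z => u z ^ 2) x hr

lemma sqMass_nonneg (u : 𝔼 → ℝ) (x : 𝔼) (r : ℝ) : 0 ≤ sqMass u x r :=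
  integral_nonneg fun _ => mul_nonneg (sq_nonneg _) (weight_nonneg _ _)

lemma sqMass_mono {u : 𝔼 → ℝ} (hu : Continuous u) {x y : 𝔼} {r R : ℝ} (hr : 0 ≤ r)
    (h : r + dist x y ≤ R) : sqMass u y r ≤ sqMass u x R := by
  have hd := dist_nonneg (x := x) (y := y)
  refine integral_mono (integrable_mul_weight_sub (hu.pow 2) hr y)
    (integrable_mul_weight_sub (hu.pow 2) (by linarith) x) fun z => ?_
  refine mul_le_mul_of_nonneg_left ?_ (sq_nonneg _)
  have := weight_sub_le hr (s := R - r) (by linarith) (x := x) (y := y) (by linarith) z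
  simpa using this

lemma weightMass_mul_eq (x : 𝔼) {r : ℝ} (hr : 0 < r) (a : ℝ) :
    ∫ z, a * weight r (z - x) = a * (weightMass n * r ^ (n + 2)) := by
  have := integral_mul_weight_eq (fun _ => a) x hr
  rw [this, integral_const_mul, weightMass]; ring

lemma sqMass_le {u : 𝔼 → ℝ} (hu : Continuous u) {x : 𝔼} {r S : ℝ} (hr : 0 < r)
    (hS : ∀ z ∈ ball x r, |u z| ≤ S) : sqMass u x r ≤ S ^ 2 * (weightMass n * r ^ (n + 2)) := by
  rw [← weightMass_mul_eq x hr]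
  refine integral_mono (integrable_mul_weight_sub (hu.pow 2) hr.le x)
    (integrable_mul_weight_sub continuous_const hr.le x) fun z => ?_
  by_cases hz : z ∈ ball x r
  · refine mul_le_mul_of_nonneg_right ?_ (weight_nonneg _ _)
    exact sq_le_sq' (by linarith [abs_le.1 (hS z hz)]) (abs_le.1 (hS z hz)).2
  · simp only
    rw [weight_eq_zero hr.le (by simpa [dist_eq_norm] using hz)]; simp

lemma HarmonicIn.mean_value {u : 𝔼 → ℝ} {x : 𝔼} {r : ℝ} (hu : HarmonicIn u x r) (hr : 0 < r) :
    ∫ z, u z * weight r (z - x) = u x * (weightMass n * r ^ (n + 2)) := by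
  rw [integral_mul_weight_eq u x hr, mean_value_unit hu hr.le]; ring

lemma HarmonicIn.sq_le_sqMass {u : 𝔼 → ℝ} {x : 𝔼} {r : ℝ} (hu : HarmonicIn u x r) (hr : 0 < r) :
    u x ^ 2 * (weightMass n * r ^ (n + 2)) ≤ sqMass u x r := by
  have hc := hu.continuous
  have h1 := mean_value_unit hu hr.le
  have h2 := sq_integral_mul_weight_le (f := fun z => u (x + r • z)) (g := fun _ => (1 : ℝ))
    (by fun_prop) continuous_const
  simp only [mul_one, h1, one_pow, one_mul] at h2
  change _ ≤ _ * weightMass n at h2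
  have hW := weightMass_pos (n := n)
  rw [sqMass_eq u x hr]
  have h3 : u x ^ 2 * weightMass n ≤ ∫ z, u (x + r • z) ^ 2 * weight 1 z := by
    refine le_of_mul_le_mul_right ?_ hW
    nlinarith
  have : 0 < r ^ (n + 2) := by positivity
  nlinarith

lemma HarmonicIn.harnack {u : 𝔼 → ℝ} {x y : 𝔼} {ρ s : ℝ} (hu : HarmonicIn u x (ρ + s))
    (hρ : 0 < ρ) (hs : 0 ≤ s) (hxy : dist x y ≤ s) (hpos : ∀ z ∈ ball x (ρ + s), 0 ≤ u z) :
    u y ≤ ((ρ + s) / ρ) ^ (n + 2) * u x := by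
  have h1 := (hu.mono (ball_subset_ball' (by linarith [dist_comm x y]) :
    ball y ρ ⊆ ball x (ρ + s))).mean_value hρ
  have h2 := hu.mean_value (by linarith)
  have h3 : ∫ z, u z * weight ρ (z - y) ≤ ∫ z, u z * weight (ρ + s) (z - x) := by
    refine integral_mono (integrable_mul_weight_sub hu.continuous hρ.le y)
      (integrable_mul_weight_sub hu.continuous (by linarith) x) fun z => ?_
    by_cases hz : z ∈ ball x (ρ + s)
    · exact mul_le_mul_of_nonneg_left (weight_sub_le hρ.le hs hxy z) (hpos z hz)
    · have e1 : weight (ρ + s) (z - x) = 0 :=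
        weight_eq_zero (by linarith) (by simpa [dist_eq_norm] using hz)
      have e2 := weight_sub_le hρ.le hs hxy z
      have e3 := weight_nonneg ρ (z - y)
      have e4 : weight ρ (z - y) = 0 := by linarith
      simp [e1, e4]
  rw [h1, h2] at h3
  have hW := weightMass_pos (n := n)
  rw [div_pow, div_mul_eq_mul_div, le_div_iff₀ (by positivity)]
  refine le_of_mul_le_mul_right ?_ hW
  linarith

lemma one_add_pow_le {t : ℝ} (h0 : 0 ≤ t) (h1 : t ≤ 1) (p : ℕ) :
    (1 + t) ^ p ≤ 1 + (2 ^ p - 1) * t := by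
  induction p with
  | zero => simp
  | succ k ih =>
    have h2 : (1 : ℝ) ≤ 2 ^ k := one_le_pow₀ (by norm_num)
    rw [pow_succ]
    have : (1 + t) ^ k * (1 + t) ≤ (1 + (2 ^ k - 1) * t) * (1 + t) :=
      mul_le_mul_of_nonneg_right ih (by linarith)
    have h3 : (2 ^ k - 1) * (t * t) ≤ (2 ^ k - 1) * t :=
      mul_le_mul_of_nonneg_left (by nlinarith) (by linarith)
    rw [pow_succ]
    nlinarith

lemma HarmonicIn.sub_le {u : 𝔼 → ℝ} {x y : 𝔼} {ρ s S : ℝ} (hu : HarmonicIn u x (ρ + s))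
    (hρ : 0 < ρ) (hs : 0 ≤ s) (hsρ : s ≤ ρ) (hxy : dist x y ≤ s)
    (hS : ∀ z ∈ ball x (ρ + s), |u z| ≤ S) : u y - u x ≤ 2 ^ (n + 3) * S * (s / ρ) := by
  have h := (hu.add_const S).harnack hρ hs hxy fun z hz => by linarith [abs_le.1 (hS z hz)]
  have hx := abs_le.1 (hS x (mem_ball_self (by linarith)))
  have ht : 0 ≤ s / ρ := by positivity
  have h2 := one_add_pow_le ht (div_le_one_of_le₀ hsρ hρ.le) (n + 2)
  rw [add_div, div_self hρ.ne'] at h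
  have h3 : (1 + s / ρ) ^ (n + 2) * (u x + S) ≤ (1 + (2 ^ (n + 2) - 1) * (s / ρ)) * (u x + S) :=
    mul_le_mul_of_nonneg_right h2 (by linarith)
  have h4 : (2 ^ (n + 2) - 1) * (s / ρ) * (u x + S) ≤ (2 ^ (n + 2)) * (s / ρ) * (2 * S) := by
    have : (1 : ℝ) ≤ 2 ^ (n + 2) := one_le_pow₀ (by norm_num)
    apply mul_le_mul (mul_le_mul_of_nonneg_right (by linarith) ht) (by linarith) (by linarith)
    positivity
  have h5 : (2 : ℝ) ^ (n + 3) = 2 ^ (n + 2) * 2 := pow_succ _ _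
  rw [h5]
  nlinarith

lemma HarmonicIn.abs_sub_le {u : 𝔼 → ℝ} {x y : 𝔼} {ρ s S : ℝ} (hu : HarmonicIn u x (ρ + s))
    (hρ : 0 < ρ) (hs : 0 ≤ s) (hsρ : s ≤ ρ) (hxy : dist x y ≤ s)
    (hS : ∀ z ∈ ball x (ρ + s), |u z| ≤ S) : |u y - u x| ≤ 2 ^ (n + 3) * S * (s / ρ) := by
  have h1 := hu.sub_le hρ hs hsρ hxy hS
  have h2 := hu.neg.sub_le hρ hs hsρ hxy (S := S) (by simpa using hS)
  exact abs_le.2 ⟨by linarith, h1⟩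

lemma HarmonicIn.abs_dirDeriv_le {u : 𝔼 → ℝ} {x : 𝔼} {R S : ℝ} (hu : HarmonicIn u x R)
    (hR : 0 < R) (hS : ∀ z ∈ ball x R, |u z| ≤ S) (z : 𝔼) :
    |_root_.dirDeriv z u x| ≤ 2 ^ (n + 4) * ‖z‖ / R * S := by
  have hS0 : 0 ≤ S := (abs_nonneg _).trans (hS x (mem_ball_self hR))
  have hd := (hu.differentiable x).hasFDerivAt
  have := hd.le_of_lip' (C := 2 ^ (n + 4) / R * S) (by positivity) ?_
  · have h2 := (fderiv ℝ u x).le_of_opNorm_le this z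
    rw [Real.norm_eq_abs] at h2
    refine h2.trans (le_of_eq ?_)
    ring
  · filter_upwards [ball_mem_nhds x (half_pos hR)] with y hy
    have hy' : dist x y ≤ R / 2 := by rw [dist_comm]; exact (mem_ball.1 hy).le
    have hsub : ball x (R / 2 + dist x y) ⊆ ball x R := ball_subset_ball (by linarith)
    have h3 := (hu.mono hsub).abs_sub_le (half_pos hR) dist_nonneg hy' le_rfl
      (fun z hz => hS z (hsub hz))
    rw [Real.norm_eq_abs, ← dist_eq_norm, dist_comm y x]
    refine h3.trans (le_of_eq ?_)
    rw [show n + 4 = n + 3 + 1 from rfl, pow_succ (2 : ℝ) (n + 3)]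
    generalize (2 : ℝ) ^ (n + 3) = A
    field_simp

/-- Iterated directional derivatives along a list of directions. -/
def iterDir (l : List (EuclideanSpace ℝ (Fin n))) (u : EuclideanSpace ℝ (Fin n) → ℝ) :
    EuclideanSpace ℝ (Fin n) → ℝ :=
  l.foldr dirDeriv u

lemma HarmonicIn.iterDir {u : 𝔼 → ℝ} {x : 𝔼} {R : ℝ} (hu : HarmonicIn u x R) (l : List 𝔼) :
    HarmonicIn (iterDir l u) x R := by
  induction l with
  | nil => exact hu
  | cons z l ih => exact ih.dirDeriv z

lemma HarmonicIn.abs_iterDir_le {u : 𝔼 → ℝ} {x : 𝔼} {R S b h : ℝ} (hu : HarmonicIn u x R)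
    (hh : 0 < h) (hS : ∀ z ∈ closedBall x R, |u z| ≤ S) (l : List 𝔼) (hl : ∀ z ∈ l, ‖z‖ ≤ b)
    {y : 𝔼} (hy : dist y x + l.length * h ≤ R) :
    |_root_.iterDir l u y| ≤ (2 ^ (n + 4) * b / h) ^ l.length * S := by
  induction l generalizing y with
  | nil =>
    simp only [_root_.iterDir, List.foldr_nil, List.length_nil, pow_zero, one_mul]
    exact hS y (by simpa using hy)
  | cons z l ih =>
    simp only [List.length_cons, Nat.cast_add, Nat.cast_one] at hy
    have hb : ‖z‖ ≤ b := hl z (by simp)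
    have h1 : HarmonicIn (_root_.iterDir l u) y h := by
      refine (hu.iterDir l).mono (ball_subset_ball' ?_)
      have : 0 ≤ (l.length : ℝ) * h := by positivity
      linarith
    have h2 : ∀ w ∈ ball y h, |_root_.iterDir l u w| ≤ (2 ^ (n + 4) * b / h) ^ l.length * S := by
      intro w hw
      refine ih (fun z hz => hl z (by simp [hz])) ?_
      linarith [dist_triangle w y x, mem_ball.1 hw]
    refine (h1.abs_dirDeriv_le hh h2 z).trans ?_
    have h3 : 0 ≤ (2 ^ (n + 4) * b / h) ^ l.length * S :=
      (abs_nonneg _).trans (h2 y (mem_ball_self hh))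
    rw [List.length_cons, pow_succ' (2 ^ (n + 4) * b / h), mul_assoc]
    refine mul_le_mul_of_nonneg_right ?_ h3
    gcongr

end Estimates
section LogConvexity

open Filter Topology

variable {n : ℕ}

local notation "𝔼" => EuclideanSpace ℝ (Fin n)

lemma convexOn_of_midpoint {f : ℝ → ℝ} (hf : Continuous f) {T : ℝ}
    (hmid : ∀ t σ, 0 ≤ σ → t + σ ≤ T → 2 * f t ≤ f (t + σ) + f (t - σ)) :
    ConvexOn ℝ (Set.Iic T) f := by
  refine LinearOrder.convexOn_of_lt (convex_Iic T) fun a ha b hb hab p q hp hq hpq => ?_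
  simp only [smul_eq_mul]
  set k := (f b - f a) / (b - a) with hk
  set g : ℝ → ℝ := fun s => f s - f a - k * (s - a) with hg
  have hgc : Continuous g := by fun_prop
  have hba : 0 < b - a := sub_pos.2 hab
  have hga : g a = 0 := by simp [hg]
  have hgb : g b = 0 := by simp only [hg, hk]; field_simp; ring
  have hgm : ∀ t σ, 0 ≤ σ → t + σ ≤ T → 2 * g t ≤ g (t + σ) + g (t - σ) := by
    intro t σ h1 h2
    have := hmid t σ h1 h2
    simp only [hg]; linarith
  suffices h : ∀ s ∈ Set.Icc a b, g s ≤ 0 by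
    have hp1 : p = 1 - q := by linarith
    have hle1 : a ≤ p * a + q * b := by subst hp1; nlinarith
    have hle2 : p * a + q * b ≤ b := by subst hp1; nlinarith
    have h1 := h (p * a + q * b) ⟨hle1, hle2⟩
    have e : p * a + q * b - a = q * (b - a) := by
      have : p = 1 - q := by linarith
      subst this; ring
    simp only [hg, e] at h1
    have e2 : k * (q * (b - a)) = q * (f b - f a) := by rw [hk]; field_simp
    have : p = 1 - q := by linarith
    rw [e2] at h1
    subst this
    linarith
  obtain ⟨m, hm, hmax⟩ := isCompact_Icc.exists_isMaxOn (Set.nonempty_Icc.2 hab.le)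
    hgc.continuousOn
  by_contra hcon
  push Not at hcon
  obtain ⟨s, hs, hs0⟩ := hcon
  have hM : 0 < g m := hs0.trans_le (hmax hs)
  have hK : IsCompact (Set.Icc a b ∩ g ⁻¹' {g m}) :=
    isCompact_Icc.inter_right (isClosed_singleton.preimage hgc)
  obtain ⟨x, hx⟩ := hK.exists_isLeast ⟨m, hm, rfl⟩
  have hxm : g x = g m := hx.1.2
  have hxa : a < x := lt_of_le_of_ne hx.1.1.1 (by rintro rfl; linarith)
  have hxb : x < b := lt_of_le_of_ne hx.1.1.2 (by rintro rfl; linarith)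
  set σ := min (x - a) (b - x)
  have hσ : 0 < σ := lt_min (by linarith) (by linarith)
  have h1 : σ ≤ x - a := min_le_left _ _
  have h2 : σ ≤ b - x := min_le_right _ _
  have hb' : b ≤ T := hb
  have h3 := hgm x σ hσ.le (by linarith)
  have h4 : g (x + σ) ≤ g m := hmax ⟨by linarith, by linarith⟩
  have h5 : g (x - σ) ≤ g m := hmax ⟨by linarith, by linarith⟩
  have h6 : g (x - σ) = g m := by linarith
  have := hx.2 ⟨⟨by linarith, by linarith⟩, h6⟩
  linarith

lemma continuous_sqMass_exp {u : 𝔼 → ℝ} (hu : Continuous u) (x : 𝔼) :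
    Continuous fun t => sqMass u x (Real.exp t) := by
  have h : ∀ t, sqMass u x (Real.exp t)
      = Real.exp t ^ (n + 2) * ∫ z, u (x + Real.exp t • z) ^ 2 * weight 1 z :=
    fun t => sqMass_eq u x (Real.exp_pos t)
  simp only [h]
  refine Continuous.mul (by fun_prop) ?_
  rw [← continuousOn_univ]
  refine continuousOn_integral_of_compact_support (isCompact_closedBall (0 : 𝔼) 1) ?_ ?_
  · have := continuous_weight (n := n) 1
    unfold Function.uncurry
    fun_prop
  · intro t z _ hz
    rw [weight_eq_zero zero_le_one (by simpa using (not_le.1 fun h => hz (by simpa using h)).le)]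
    simp

/-- Truncated logarithm of `sqMass` in logarithmic scale. -/
def logMass (u : EuclideanSpace ℝ (Fin n) → ℝ) (x : EuclideanSpace ℝ (Fin n)) (c t : ℝ) : ℝ :=
  Real.log (max (sqMass u x (Real.exp t)) c)

lemma HarmonicIn.sqMass_midpoint {u : 𝔼 → ℝ} {x : 𝔼} {R t σ : ℝ} (hu : HarmonicIn u x R)
    (hσ : 0 ≤ σ) (hR : Real.exp (t + σ) ≤ R) :
    sqMass u x (Real.exp t) ^ 2
      ≤ sqMass u x (Real.exp (t + σ)) * sqMass u x (Real.exp (t - σ)) := by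
  have h := sq_integral_sq_le hu hσ hR
  simp only [sqMass_eq u x (Real.exp_pos _)]
  have e : Real.exp (t + σ) ^ (n + 2) * Real.exp (t - σ) ^ (n + 2)
      = (Real.exp t ^ (n + 2)) ^ 2 := by
    rw [← mul_pow, ← Real.exp_add, ← pow_mul, mul_comm (n + 2) 2, pow_mul, ← Real.exp_nat_mul _ 2]
    congr 2; push_cast; ring
  rw [mul_pow, ← e]
  have hp : 0 ≤ Real.exp (t + σ) ^ (n + 2) * Real.exp (t - σ) ^ (n + 2) := by positivity
  nlinarith [mul_le_mul_of_nonneg_left h hp]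

lemma HarmonicIn.convexOn_logMass {u : 𝔼 → ℝ} {x : 𝔼} {R c : ℝ} (hu : HarmonicIn u x R)
    (hc : 0 < c) (hR : 0 < R) : ConvexOn ℝ (Set.Iic (Real.log R)) (logMass u x c) := by
  have hpos : ∀ t, 0 < max (sqMass u x (Real.exp t)) c := fun t => lt_max_of_lt_right hc
  refine convexOn_of_midpoint ?_ fun t σ hσ ht => ?_
  · exact ((continuous_sqMass_exp hu.continuous x).max continuous_const).log
      fun t => (hpos t).ne'
  · have hR' : Real.exp (t + σ) ≤ R := by
      rw [← Real.exp_log hR]; exact Real.exp_le_exp.2 ht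
    have h := hu.sqMass_midpoint hσ hR'
    unfold logMass
    rw [← Real.log_mul (hpos _).ne' (hpos _).ne']
    have : (2 : ℝ) * Real.log (max (sqMass u x (Real.exp t)) c)
        = Real.log (max (sqMass u x (Real.exp t)) c ^ 2) := by rw [Real.log_pow]; norm_num
    rw [this]
    refine Real.log_le_log (pow_pos (hpos _) 2) ?_
    set A := sqMass u x (Real.exp (t + σ))
    set B := sqMass u x (Real.exp (t - σ))
    have hA : 0 ≤ A := sqMass_nonneg _ _ _
    have hB : 0 ≤ B := sqMass_nonneg _ _ _
    rcases le_total (sqMass u x (Real.exp t)) c with h1 | h1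
    · rw [max_eq_right h1, pow_two]
      exact mul_le_mul (le_max_right _ _) (le_max_right _ _) hc.le
        (hc.le.trans (le_max_right _ _))
    · rw [max_eq_left h1]
      exact h.trans (mul_le_mul (le_max_left _ _) (le_max_left _ _) hB
        (hA.trans (le_max_left _ _)))

lemma logMass_mono {u : 𝔼 → ℝ} (hu : Continuous u) (x : 𝔼) {c : ℝ} (hc : 0 < c) :
    Monotone (logMass u x c) := fun s t hst => by
  refine Real.log_le_log (lt_max_of_lt_right hc) (max_le_max_right _ ?_)
  exact sqMass_mono hu (Real.exp_pos s).le (by simpa using hst)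

end LogConvexity

section NodalLowerBound

open Filter Topology

variable {n : ℕ}

local notation "𝔼" => EuclideanSpace ℝ (Fin n)

lemma hausdorffMeasure_ge_of_segments_succ {m : ℕ} {a b : EuclideanSpace ℝ (Fin (m + 1))} {ρ : ℝ}
    (hρ : 0 < ρ) (hab : a ≠ b) {Z : Set (EuclideanSpace ℝ (Fin (m + 1)))}
    (h : ∀ v : EuclideanSpace ℝ (Fin (m + 1)), ‖v‖ < ρ → ∃ t : ℝ, a + v + t • (b - a) ∈ Z) :
    ENNReal.ofReal ((ρ / (m + 1)) ^ m) ≤ μH[(m : ℝ)] Z := by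
  obtain ⟨i, hi⟩ : ∃ i, ∀ j, |(b - a) j| ≤ |(b - a) i| :=
    Finite.exists_max fun j => |(b - a) j|
  have hi0 : (b - a) i ≠ 0 := by
    intro h0
    refine hab (sub_eq_zero.1 ?_).symm
    ext j
    have := hi j
    rw [h0, abs_zero] at this
    simpa using abs_nonpos_iff.1 this
  set c : Fin m → ℝ := fun k => (b - a) (i.succAbove k) / (b - a) i with hc
  have hc1 : ∀ k, |c k| ≤ 1 := fun k => by
    rw [hc, abs_div]; exact div_le_one_of_le₀ (hi _) (abs_nonneg _)
  set φ : EuclideanSpace ℝ (Fin (m + 1)) → Fin m → ℝ :=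
    fun x k => x (i.succAbove k) - c k * x i with hφ
  have hlip : LipschitzWith 2 φ := by
    refine LipschitzWith.of_dist_le_mul fun x y => ?_
    refine (dist_pi_le_iff (by positivity)).2 fun k => ?_
    have h1 : ∀ j, |x j - y j| ≤ dist x y := fun j => by
      rw [dist_eq_norm]; exact PiLp.norm_apply_le (x - y) j
    have h2 : |c k * (x i - y i)| ≤ dist x y := by
      rw [abs_mul]
      exact (mul_le_of_le_one_left (abs_nonneg _) (hc1 k)).trans (h1 i)
    rw [Real.dist_eq]
    have e : φ x k - φ y k = (x (i.succAbove k) - y (i.succAbove k)) - c k * (x i - y i) := by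
      simp only [hφ]; ring
    rw [e]
    refine (abs_sub _ _).trans ?_
    have := h1 (i.succAbove k)
    push_cast
    linarith
  have hsub : ball (φ a) (ρ / (m + 1)) ⊆ φ '' Z := by
    intro y hy
    set v : EuclideanSpace ℝ (Fin (m + 1)) :=
      WithLp.toLp 2 (i.insertNth (0 : ℝ) fun k => y k - φ a k) with hv
    have hvi : v i = 0 := by simp [hv]
    have hvk : ∀ k, v (i.succAbove k) = y k - φ a k := fun k => by simp [hv]
    have hvn : ‖v‖ < ρ := by
      have hd := mem_ball.1 hy
      have hj : ∀ j, ‖v j‖ ≤ dist y (φ a) := by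
        intro j
        rcases Fin.eq_self_or_eq_succAbove i j with rfl | ⟨k, rfl⟩
        · rw [hvi]; simp
        · rw [hvk, ← dist_eq_norm]; exact dist_le_pi_dist y (φ a) k
      have hsq : ‖v‖ ^ 2 ≤ (m + 1) * dist y (φ a) ^ 2 := by
        rw [EuclideanSpace.norm_sq_eq]
        calc ∑ j, ‖v j‖ ^ 2 ≤ ∑ _j : Fin (m + 1), dist y (φ a) ^ 2 :=
              Finset.sum_le_sum fun j _ => pow_le_pow_left₀ (norm_nonneg _) (hj j) 2
          _ = _ := by simp
      rw [lt_div_iff₀ (by positivity)] at hd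
      have hm : (0 : ℝ) ≤ m := Nat.cast_nonneg m
      have hd0 := dist_nonneg (x := y) (y := φ a)
      refine lt_of_pow_lt_pow_left₀ 2 hρ.le ?_
      have : (dist y (φ a) * (m + 1)) ^ 2 < ρ ^ 2 := pow_lt_pow_left₀ hd (by positivity) two_ne_zero
      nlinarith [sq_nonneg (dist y (φ a)), mul_nonneg hm (sq_nonneg (dist y (φ a)))]
    obtain ⟨t, ht⟩ := h v hvn
    refine ⟨_, ht, ?_⟩
    funext k
    have e : c k * (b - a) i = (b - a) (i.succAbove k) := by rw [hc]; field_simp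
    have e2 := hvk k
    simp only [hφ, PiLp.add_apply, PiLp.smul_apply, smul_eq_mul, hvi] at e e2 ⊢
    rw [e2, ← e]; ring
  have h1 := hlip.hausdorffMeasure_image_le (d := (m : ℝ)) (Nat.cast_nonneg m) Z
  have h2 : μH[(m : ℝ)] (ball (φ a) (ρ / (m + 1))) = ENNReal.ofReal ((2 * (ρ / (m + 1))) ^ m) := by
    have := hausdorffMeasure_pi_real (ι := Fin m)
    rw [Fintype.card_fin] at this
    rw [this, Real.volume_pi_ball _ (by positivity), Fintype.card_fin]
  have h3 := (measure_mono hsub).trans h1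
  rw [h2, mul_pow, ENNReal.ofReal_mul (by positivity)] at h3
  have e4 : ENNReal.ofReal ((2 : ℝ) ^ m) = 2 ^ m := by
    rw [ENNReal.ofReal_pow (by norm_num)]; norm_num
  rw [e4] at h3
  have e5 : (((2 : NNReal) : ENNReal)) ^ (m : ℝ) = 2 ^ m := by
    rw [ENNReal.rpow_natCast]; norm_num
  rw [e5] at h3
  exact (ENNReal.mul_le_mul_iff_right (by simp) (by simp)).1 h3

lemma hausdorffMeasure_ge_of_segments (hn : 1 ≤ n) {a b : 𝔼} {ρ : ℝ}
    (hρ : 0 < ρ) (hab : a ≠ b) {Z : Set 𝔼}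
    (h : ∀ v : 𝔼, ‖v‖ < ρ → ∃ t : ℝ, a + v + t • (b - a) ∈ Z) :
    ENNReal.ofReal ((ρ / n) ^ (n - 1)) ≤ μH[(n : ℝ) - 1] Z := by
  obtain ⟨m, rfl⟩ : ∃ m, n = m + 1 := ⟨n - 1, by omega⟩
  have := hausdorffMeasure_ge_of_segments_succ hρ hab h
  simpa using this

lemma exp_neg_one_lt : Real.exp (-1) < 37 / 100 := by
  rw [Real.exp_neg, inv_lt_comm₀ (Real.exp_pos _) (by norm_num)]
  have := Real.exp_one_gt_d9
  norm_num at this ⊢; linarith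

lemma exp_neg_half_gt : 3 / 5 < Real.exp (-(1 / 2)) := by
  refine lt_of_pow_lt_pow_left₀ 2 (Real.exp_pos _).le ?_
  rw [← Real.exp_nat_mul]
  norm_num
  rw [Real.exp_neg, lt_inv_comm₀ (by norm_num) (Real.exp_pos _)]
  have := Real.exp_one_lt_d9
  norm_num at this ⊢; linarith

lemma exp_neg_half_lt : Real.exp (-(1 / 2)) < 1 := Real.exp_lt_one_iff.2 (by norm_num)

lemma exists_zero_on_segment {u : 𝔼 → ℝ} (hu : Continuous u) {x y : 𝔼} (hx : 0 ≤ u x)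
    (hy : u y ≤ 0) : ∃ t ∈ Set.Icc (0 : ℝ) 1, u (x + t • (y - x)) = 0 := by
  have hc : ContinuousOn (fun t : ℝ => u (x + t • (y - x))) (Set.Icc 0 1) := by
    apply Continuous.continuousOn; fun_prop
  have := intermediate_value_Icc' (zero_le_one' ℝ) hc
  have h0 : (0 : ℝ) ∈ Set.Icc (u (x + (1 : ℝ) • (y - x))) (u (x + (0 : ℝ) • (y - x))) := by
    simpa using ⟨hy, hx⟩
  exact this h0

lemma HarmonicIn.exists_opposite_balls {u : 𝔼 → ℝ} {A δ S : ℝ} {a : 𝔼} (hA : 0 ≤ A)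
    (hu : HarmonicIn u 0 1)
    (h0 : u 0 = 0)
    (hgr : sqMass u 0 (Real.exp (-(1 / 2))) ≤ Real.exp A * sqMass u 0 (Real.exp (-1)))
    (ha : a ∈ closedBall (0 : 𝔼) (Real.exp (-1)))
    (hS : ∀ x ∈ closedBall (0 : 𝔼) (Real.exp (-1)), |u x| ≤ S) (haS : u a = S) (hSpos : 0 < S)
    (hδ : 0 < δ) (hδ' : δ ≤ 1 / 20)
    (hδ2 : 2 ^ (n + 3) * (Real.exp A * 20 ^ (n + 2)) * (20 * δ) < (6 ^ (n + 2))⁻¹) :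
    ∃ b ∈ closedBall (0 : 𝔼) (9 / 20), (∀ y ∈ closedBall a δ, 0 < u y) ∧
      ∀ y ∈ closedBall b δ, u y < 0 := by
  have hR0 := exp_neg_one_lt
  have hR1 := exp_neg_half_gt
  have hR1' := exp_neg_half_lt
  have hW := weightMass_pos (n := n)
  have hna : ‖a‖ ≤ 37 / 100 := by
    have : ‖a‖ ≤ Real.exp (-1) := by simpa using ha
    linarith
  set C1 := Real.exp A * 20 ^ (n + 2) with hC1
  have hC1' : 1 ≤ C1 := one_le_mul_of_one_le_of_one_le (Real.one_le_exp hA)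
    (one_le_pow₀ (by norm_num))
  have hC1S : 0 < C1 * S := by positivity
  have hsup : ∀ x ∈ ball (0 : 𝔼) (11 / 20), |u x| ≤ C1 * S := by
    intro x hx
    have hx' : ‖x‖ < 11 / 20 := by simpa using hx
    have h1 : HarmonicIn u x (1 / 20) := hu.mono (ball_subset_ball' (by
      rw [dist_zero_right]; linarith))
    have h2 := h1.sq_le_sqMass (by norm_num)
    have h3 : sqMass u x (1 / 20) ≤ sqMass u 0 (Real.exp (-(1 / 2))) :=
      sqMass_mono hu.continuous (by norm_num) (by rw [dist_zero_left]; linarith)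
    have h4 : sqMass u 0 (Real.exp (-1)) ≤ S ^ 2 * (weightMass n * 1) := by
      refine (sqMass_le hu.continuous (Real.exp_pos _)
        fun z hz => hS z (ball_subset_closedBall hz)).trans ?_
      gcongr
      exact pow_le_one₀ (Real.exp_pos _).le (by linarith)
    have h5 : u x ^ 2 * (weightMass n * (1 / 20) ^ (n + 2))
        ≤ Real.exp A * (S ^ 2 * weightMass n) := by
      rw [mul_one] at h4
      exact h2.trans (h3.trans (hgr.trans (mul_le_mul_of_nonneg_left h4 (Real.exp_pos _).le)))
    have h6 : u x ^ 2 ≤ C1 * S ^ 2 := by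
      refine le_of_mul_le_mul_right ?_ (by positivity : 0 < weightMass n * (1 / 20 : ℝ) ^ (n + 2))
      refine h5.trans (le_of_eq ?_)
      rw [hC1, one_div, inv_pow]
      field_simp
    refine abs_le_of_sq_le_sq ?_ hC1S.le
    nlinarith [sq_nonneg S]
  obtain ⟨b, hb, hbmin⟩ := (isCompact_closedBall (0 : 𝔼) (9 / 20)).exists_isMinOn
    ⟨0, mem_closedBall_self (by norm_num)⟩ hu.continuous.continuousOn
  have hm0 : u b ≤ 0 := by rw [← h0]; exact hbmin (mem_closedBall_self (by norm_num))
  have hbS : S ≤ 6 ^ (n + 2) * (-u b) := by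
    have h1 : HarmonicIn (fun x => u x + -u b) 0 (2 / 25 + 37 / 100) :=
      (hu.mono (ball_subset_ball (by norm_num))).add_const _
    have h2 := h1.harnack (y := a) (by norm_num) (by norm_num) (by rwa [dist_zero_left])
      (fun z hz => by
        have hz' : ‖z‖ < 9 / 20 := by
          have : ‖z‖ < 2 / 25 + 37 / 100 := by simpa using hz
          linarith
        have := hbmin (show z ∈ closedBall (0 : 𝔼) (9 / 20) by simpa using hz'.le)
        simp only [Set.mem_ofPred_eq] at this
        linarith)
    simp only [h0, haS, zero_add] at h2
    have h3 : ((2 / 25 + 37 / 100) / (2 / 25) : ℝ) ^ (n + 2) ≤ 6 ^ (n + 2) :=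
      pow_le_pow_left₀ (by norm_num) (by norm_num) _
    nlinarith
  have h6 : (0 : ℝ) < 6 ^ (n + 2) := by positivity
  have hosc : ∀ x ∈ closedBall (0 : 𝔼) (9 / 20), ∀ y ∈ closedBall x δ,
      |u y - u x| < (6 ^ (n + 2))⁻¹ * S := by
    intro x hx y hy
    have hx' : ‖x‖ ≤ 9 / 20 := by simpa using hx
    have h1 : ball x (1 / 20 + δ) ⊆ ball (0 : 𝔼) (11 / 20) :=
      ball_subset_ball' (by rw [dist_zero_right]; linarith)
    have h2 := (hu.mono (h1.trans (ball_subset_ball (by norm_num)))).abs_sub_le (y := y)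
      (by norm_num) hδ.le hδ' (by rw [dist_comm]; exact hy) (fun z hz => hsup z (h1 hz))
    refine h2.trans_lt ?_
    have := mul_lt_mul_of_pos_right hδ2 hSpos
    refine lt_of_eq_of_lt ?_ this
    ring
  have h61 : (6 ^ (n + 2) : ℝ)⁻¹ * S ≤ S :=
    mul_le_of_le_one_left hSpos.le (inv_le_one_of_one_le₀ (one_le_pow₀ (by norm_num)))
  refine ⟨b, hb, fun y hy => ?_, fun y hy => ?_⟩
  · have := abs_lt.1 (hosc a (by simpa using hna.trans (by norm_num)) y hy)
    linarith
  · have := abs_lt.1 (hosc b hb y hy)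
    have h7 : (6 ^ (n + 2) : ℝ)⁻¹ * S ≤ -u b := by
      rw [inv_mul_le_iff₀ h6]; exact hbS
    linarith

/-- A harmonic function vanishing at the centre with bounded growth has a large nodal set. -/
lemma exists_nodal_lower_bound_of_growth (hn : 1 ≤ n) {A : ℝ} (hA : 0 ≤ A) : ∃ c : ℝ, 0 < c ∧
    ∀ u : 𝔼 → ℝ, HarmonicIn u 0 1 → u 0 = 0 →
      sqMass u 0 (Real.exp (-(1 / 2))) ≤ Real.exp A * sqMass u 0 (Real.exp (-1)) →
      ENNReal.ofReal c ≤ μH[(n : ℝ) - 1] ({x | u x = 0} ∩ ball 0 1) := by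
  set B : ℝ := 2 ^ (n + 3) * (Real.exp A * 20 ^ (n + 2)) * 20 * 6 ^ (n + 2) with hB
  have hBpos : 0 < B := by positivity
  set δ : ℝ := min (1 / 20) ((2 * B)⁻¹) with hδ
  have hδpos : 0 < δ := lt_min (by norm_num) (by positivity)
  have hδ1 : δ ≤ 1 / 20 := min_le_left _ _
  have hδ2 : 2 ^ (n + 3) * (Real.exp A * 20 ^ (n + 2)) * (20 * δ) < (6 ^ (n + 2))⁻¹ := by
    have h6 : (0 : ℝ) < 6 ^ (n + 2) := by positivity
    rw [lt_inv_comm₀ (by positivity) h6, lt_inv_comm₀ h6 (by positivity)]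
    rw [← one_div, lt_div_iff₀ h6]
    have h1 : B * δ ≤ B * (2 * B)⁻¹ := mul_le_mul_of_nonneg_left (min_le_right _ _) hBpos.le
    have h2 : B * (2 * B)⁻¹ = 1 / 2 := by field_simp
    rw [hB] at h1
    rw [h2] at h1
    nlinarith
  have hn' : (0 : ℝ) < n := by exact_mod_cast hn
  have hR0 := exp_neg_one_lt
  refine ⟨(δ / n) ^ (n - 1), by positivity, fun u hu h0 hgr => ?_⟩
  obtain ⟨a, ha, hamax⟩ := (isCompact_closedBall (0 : 𝔼) (Real.exp (-1))).exists_isMaxOn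
    ⟨0, by simp [(Real.exp_pos _).le]⟩ (hu.continuous.abs.continuousOn)
  have hS : ∀ x ∈ closedBall (0 : 𝔼) (Real.exp (-1)), |u x| ≤ |u a| := fun x hx => hamax hx
  have hna : ‖a‖ ≤ 37 / 100 := by
    have : ‖a‖ ≤ Real.exp (-1) := by simpa using ha
    linarith
  have conclude : ∀ v : 𝔼 → ℝ, HarmonicIn v 0 1 → {x | v x = 0} = {x | u x = 0} →
      (∃ b ∈ closedBall (0 : 𝔼) (9 / 20), (∀ y ∈ closedBall a δ, 0 < v y) ∧
      ∀ y ∈ closedBall b δ, v y < 0) →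
      ENNReal.ofReal ((δ / n) ^ (n - 1)) ≤ μH[(n : ℝ) - 1] ({x | u x = 0} ∩ ball 0 1) := by
    rintro v hv hvu ⟨b, hb, hpos, hneg⟩
    have hnb : ‖b‖ ≤ 9 / 20 := by simpa using hb
    rw [← hvu]
    refine hausdorffMeasure_ge_of_segments hn hδpos (a := a) (b := b) ?_ fun w hw => ?_
    · rintro rfl
      have := hpos a (mem_closedBall_self hδpos.le)
      have := hneg a (mem_closedBall_self hδpos.le)
      linarith
    · have p1 := hpos (a + w) (by simpa using hw.le)
      have p2 := hneg (b + w) (by simpa using hw.le)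
      obtain ⟨t, ht, hz⟩ := exists_zero_on_segment hv.continuous p1.le p2.le
      rw [show b + w - (a + w) = b - a by abel] at hz
      refine ⟨t, hz, ?_⟩
      have e : a + w + t • (b - a) = (1 - t) • a + t • b + w := by module
      rw [mem_ball_zero_iff, e]
      have n1 : ‖(1 - t) • a‖ ≤ (1 - t) * (9 / 20) := by
        rw [norm_smul, Real.norm_of_nonneg (by linarith [ht.2])]
        exact mul_le_mul_of_nonneg_left (by linarith) (by linarith [ht.2])
      have n2 : ‖t • b‖ ≤ t * (9 / 20) := by
        rw [norm_smul, Real.norm_of_nonneg ht.1]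
        exact mul_le_mul_of_nonneg_left hnb ht.1
      calc ‖(1 - t) • a + t • b + w‖ ≤ ‖(1 - t) • a‖ + ‖t • b‖ + ‖w‖ := norm_add₃_le
        _ < 1 := by linarith
  rcases (abs_nonneg (u a)).eq_or_lt with hz | hz
  · set e : 𝔼 := EuclideanSpace.single ⟨0, hn⟩ 1
    refine hausdorffMeasure_ge_of_segments hn hδpos (a := 0) (b := e) ?_ fun w hw => ?_
    · intro he
      have : ‖e‖ = 1 := by simp [e]
      rw [← he] at this
      simp at this
    · have hR : (1 / 20 : ℝ) < Real.exp (-1) := by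
        rw [Real.exp_neg, lt_inv_comm₀ (by norm_num) (Real.exp_pos _)]
        have := Real.exp_one_lt_d9
        norm_num at this ⊢; linarith
      refine ⟨0, ?_, ?_⟩
      · have := hS (0 + w + (0 : ℝ) • (e - 0)) (by simp; linarith)
        rw [← hz] at this
        exact abs_nonpos_iff.1 this
      · simp; linarith
  · rcases le_total 0 (u a) with hs | hs
    · exact conclude u hu rfl (hu.exists_opposite_balls hA h0 hgr ha hS (abs_of_nonneg hs).symm
        hz hδpos hδ1 hδ2)
    · refine conclude _ hu.neg (by simp) (hu.neg.exists_opposite_balls hA (by simp [h0]) ?_ ha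
        (by simpa using hS) (abs_of_nonpos hs).symm hz hδpos hδ1 hδ2)
      simpa [sqMass] using hgr

end NodalLowerBound

section Remez

open Filter Topology
open scoped ContDiff

lemma factorial_card_le_prod (S : Finset ℕ) (h : ∀ k ∈ S, 0 < k) :
    S.card.factorial ≤ ∏ k ∈ S, k := by
  induction S using Finset.induction_on_max with
  | empty => simp
  | insert a S hmax ih =>
    have ha : a ∉ S := fun h => lt_irrefl _ (hmax a h)
    have hS : S ⊆ Finset.Ico 1 a := fun k hk =>
      Finset.mem_Ico.2 ⟨h k (Finset.mem_insert_of_mem hk), hmax k hk⟩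
    have hcard := Finset.card_le_card hS
    rw [Nat.card_Ico] at hcard
    have ha0 := h a (Finset.mem_insert_self _ _)
    rw [Finset.card_insert_of_notMem ha, Finset.prod_insert ha, Nat.factorial_succ]
    exact Nat.mul_le_mul (by omega) (ih fun k hk => h k (Finset.mem_insert_of_mem hk))

lemma factorial_le_prod_abs_sub (T : Finset ℕ) (j : ℕ) (hj : j ∉ T) :
    (T.card.factorial : ℝ) ≤ 2 ^ T.card * ∏ i ∈ T, |(i : ℝ) - j| := by
  set A := T.filter (· < j) with hA
  set B := T.filter (fun i => ¬ i < j) with hB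
  have hprod := Finset.prod_filter_mul_prod_filter_not T (· < j) (fun i : ℕ => |(i : ℝ) - j|)
  have hcard := Finset.card_filter_add_card_filter_not (s := T) (p := (· < j))
  have h1 : (A.card.factorial : ℝ) ≤ ∏ i ∈ A, |(i : ℝ) - j| := by
    have hinj : Set.InjOn (fun i => j - i) (A : Set ℕ) := by
      intro x hx y hy hxy
      have hx' := (Finset.mem_filter.1 hx).2
      have hy' := (Finset.mem_filter.1 hy).2
      simp only at hxy hx' hy'
      omega
    have := factorial_card_le_prod (A.image fun i => j - i) (by
      intro k hk
      obtain ⟨i, hi, rfl⟩ := Finset.mem_image.1 hk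
      have := (Finset.mem_filter.1 hi).2
      omega)
    rw [Finset.card_image_of_injOn hinj, Finset.prod_image hinj] at this
    have h2 : (A.card.factorial : ℝ) ≤ ((∏ i ∈ A, (j - i) : ℕ) : ℝ) := by exact_mod_cast this
    refine h2.trans (le_of_eq ?_)
    rw [Nat.cast_prod]
    refine Finset.prod_congr rfl fun i hi => ?_
    have := (Finset.mem_filter.1 hi).2
    have h3 : (i : ℝ) < j := by exact_mod_cast this
    rw [Nat.cast_sub this.le, abs_sub_comm, abs_of_pos (by linarith)]
  have h2 : (B.card.factorial : ℝ) ≤ ∏ i ∈ B, |(i : ℝ) - j| := by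
    have hgt : ∀ i ∈ B, j < i := fun i hi => by
      have h3 := Finset.mem_filter.1 hi
      have : i ≠ j := by rintro rfl; exact hj h3.1
      omega
    have hinj : Set.InjOn (fun i => i - j) (B : Set ℕ) := by
      intro x hx y hy hxy
      have hx' := hgt x hx
      have hy' := hgt y hy
      simp only at hxy
      omega
    have := factorial_card_le_prod (B.image fun i => i - j) (by
      intro k hk
      obtain ⟨i, hi, rfl⟩ := Finset.mem_image.1 hk
      have := hgt i hi
      omega)
    rw [Finset.card_image_of_injOn hinj, Finset.prod_image hinj] at this
    have h2 : (B.card.factorial : ℝ) ≤ ((∏ i ∈ B, (i - j) : ℕ) : ℝ) := by exact_mod_cast this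
    refine h2.trans (le_of_eq ?_)
    rw [Nat.cast_prod]
    refine Finset.prod_congr rfl fun i hi => ?_
    have := hgt i hi
    have h3 : (j : ℝ) < i := by exact_mod_cast this
    rw [Nat.cast_sub this.le, abs_of_pos (by linarith)]
  rw [← hprod]
  have h3 := Nat.add_choose_mul_factorial_mul_factorial A.card B.card
  have h4 := Nat.choose_le_two_pow (A.card + B.card) B.card
  rw [hcard] at h3 h4
  have h5 : (T.card.factorial : ℝ) ≤ 2 ^ T.card * (A.card.factorial * B.card.factorial) := by
    rw [← h3]; push_cast
    rw [mul_assoc]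
    refine mul_le_mul_of_nonneg_right ?_ (by positivity)
    exact_mod_cast h4
  refine h5.trans (mul_le_mul_of_nonneg_left ?_ (by positivity))
  exact mul_le_mul h1 h2 (by positivity) (by positivity)

/-- Sample points in `[1/2, 1)`. -/
def samplePt (q j : ℕ) : ℝ := 1 / 2 + j / (4 * q)

lemma samplePt_ge (q j : ℕ) : 1 / 2 ≤ samplePt q j := by
  unfold samplePt
  have : (0 : ℝ) ≤ j / (4 * q) := by positivity
  linarith

lemma samplePt_lt {q j : ℕ} (hj : j < 2 * q) : samplePt q j < 1 := by
  unfold samplePt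
  have hq : (0 : ℝ) < q := by
    have : 0 < q := by omega
    exact_mod_cast this
  have h : (j : ℝ) < 2 * q := by exact_mod_cast hj
  have : (j : ℝ) / (4 * q) < 1 / 2 := by rw [div_lt_iff₀ (by positivity)]; linarith
  linarith

lemma pow_div_factorial_le_three_pow (q : ℕ) : (q : ℝ) ^ q / q.factorial ≤ 3 ^ q := by
  refine (Real.pow_div_factorial_le_exp q (Nat.cast_nonneg q) q).trans ?_
  rw [← Real.exp_one_pow]
  exact pow_le_pow_left₀ (Real.exp_pos _).le (by linarith [Real.exp_one_lt_d9]) _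

lemma abs_eval_zero_le_of_samples {P : Polynomial ℝ} {m : ℕ} {η : ℝ}
    (hP : P.degree < ((m + 1 : ℕ) : WithBot ℕ))
    {T : Finset ℕ} (hT : T ⊆ Finset.range (2 * (m + 1))) (hcard : T.card = m + 1)
    (hη : ∀ j ∈ T, |P.eval (samplePt (m + 1) j)| ≤ η) :
    |P.eval 0| ≤ 48 ^ (m + 1) * η := by
  set q : ℝ := ((m + 1 : ℕ) : ℝ) with hq
  have hq0 : 0 < q := by rw [hq]; positivity
  have hdiff : ∀ i j, samplePt (m + 1) i - samplePt (m + 1) j = ((i : ℝ) - j) / (4 * q) := by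
    intro i j; simp only [samplePt, ← hq]; ring
  have hinj : Set.InjOn (samplePt (m + 1)) (T : Set ℕ) := by
    intro i _ j _ hij
    have := hdiff i j
    rw [hij, sub_self, eq_comm, div_eq_zero_iff] at this
    have h2 : (i : ℝ) - j = 0 := this.resolve_right (by positivity)
    exact_mod_cast sub_eq_zero.1 h2
  have hη0 : 0 ≤ η := by
    obtain ⟨j, hj⟩ : T.Nonempty := Finset.card_pos.1 (by omega)
    exact (abs_nonneg _).trans (hη j hj)
  have hint := Lagrange.eq_interpolate (s := T) (v := samplePt (m + 1)) (f := P) hinj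
    (by rw [hcard]; exact hP)
  have hbasis : ∀ j ∈ T, |(Lagrange.basis T (samplePt (m + 1)) j).eval 0|
      ≤ (8 * q) ^ m / m.factorial := by
    intro j hj
    have hce : (T.erase j).card = m := by rw [Finset.card_erase_of_mem hj, hcard]; rfl
    have h1 := factorial_le_prod_abs_sub (T.erase j) j (Finset.notMem_erase j T)
    rw [hce] at h1
    set D := ∏ i ∈ T.erase j, |(i : ℝ) - j| with hD
    have hDpos : 0 < D := by
      refine Finset.prod_pos fun i hi => abs_pos.2 (sub_ne_zero.2 ?_)
      exact_mod_cast (Finset.mem_erase.1 hi).1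
    have h2 : |(Lagrange.basis T (samplePt (m + 1)) j).eval 0| ≤ (4 * q) ^ m / D := by
      have hpow : (4 * q) ^ m = ∏ _i ∈ T.erase j, 4 * q := by rw [Finset.prod_const, hce]
      rw [Lagrange.basis, Polynomial.eval_prod, Finset.abs_prod, hpow, hD,
        ← Finset.prod_div_distrib]
      refine Finset.prod_le_prod (fun _ _ => abs_nonneg _) fun i hi => ?_
      have hi2 := samplePt_lt (Finset.mem_range.1 (hT (Finset.mem_erase.1 hi).2))
      have hi1 := samplePt_ge (m + 1) i
      have hne : 0 < |(i : ℝ) - j| := abs_pos.2 (sub_ne_zero.2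
        (by exact_mod_cast (Finset.mem_erase.1 hi).1))
      simp only [Lagrange.basisDivisor, Polynomial.eval_mul, Polynomial.eval_C,
        Polynomial.eval_sub, Polynomial.eval_X, zero_sub, abs_mul, abs_neg, abs_inv]
      rw [hdiff, abs_div, abs_of_pos (by positivity : (0 : ℝ) < 4 * q),
        abs_of_pos (by linarith : 0 < samplePt (m + 1) i), inv_div, abs_sub_comm]
      exact mul_le_of_le_one_right (by positivity) hi2.le
    refine h2.trans ?_
    rw [div_le_div_iff₀ hDpos (by positivity)]
    have : (8 * q) ^ m = (4 * q) ^ m * 2 ^ m := by rw [← mul_pow]; ring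
    rw [this, mul_assoc]
    exact mul_le_mul_of_nonneg_left h1 (by positivity)
  rw [hint, Lagrange.interpolate_apply, Polynomial.eval_finsetSum]
  refine (Finset.abs_sum_le_sum_abs _ _).trans ?_
  have hsum : ∑ j ∈ T, |(Polynomial.C (P.eval (samplePt (m + 1) j))
      * Lagrange.basis T (samplePt (m + 1)) j).eval 0|
      ≤ ∑ _j ∈ T, η * ((8 * q) ^ m / m.factorial) := by
    refine Finset.sum_le_sum fun j hj => ?_
    rw [Polynomial.eval_mul, Polynomial.eval_C, abs_mul]
    exact mul_le_mul (hη j hj) (hbasis j hj) (abs_nonneg _) hη0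
  refine hsum.trans ?_
  rw [Finset.sum_const, hcard, nsmul_eq_mul, ← hq]
  have h3 := pow_div_factorial_le_three_pow (m + 1)
  rw [← hq] at h3
  have h4 : q * ((8 * q) ^ m / m.factorial) ≤ 48 ^ (m + 1) := by
    have e : q * ((8 * q) ^ m / m.factorial)
        = 8 ^ m * q * (q ^ (m + 1) / (m + 1).factorial) := by
      rw [Nat.factorial_succ]; push_cast [hq]; field_simp
      rw [mul_pow, pow_succ]; ring
    have h5 : q ≤ 2 ^ (m + 1) := by
      rw [hq]; exact_mod_cast (Nat.lt_two_pow_self (n := m + 1)).le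
    rw [e]
    calc 8 ^ m * q * (q ^ (m + 1) / (m + 1).factorial)
        ≤ 8 ^ (m + 1) * 2 ^ (m + 1) * 3 ^ (m + 1) := by
          gcongr
          · norm_num
          · omega
      _ = 48 ^ (m + 1) := by rw [← mul_pow, ← mul_pow]; norm_num
  calc q * (η * ((8 * q) ^ m / m.factorial)) = q * ((8 * q) ^ m / m.factorial) * η := by ring
    _ ≤ _ := mul_le_mul_of_nonneg_right h4 hη0

lemma exists_taylor_polynomial {f : ℝ → ℝ} (hf : ContDiff ℝ ∞ f) {m : ℕ} {C : ℝ}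
    (hC : ∀ y ∈ Set.Icc (0 : ℝ) 1, |iteratedDeriv (m + 1) f y| ≤ C) :
    ∃ P : Polynomial ℝ, P.degree < ((m + 1 : ℕ) : WithBot ℕ) ∧ P.eval 0 = f 0 ∧
      ∀ x ∈ Set.Icc (0 : ℝ) 1, |f x - P.eval x| ≤ C / m.factorial := by
  set P : Polynomial ℝ := ∑ k : Fin (m + 1),
    Polynomial.C (((k : ℕ).factorial : ℝ)⁻¹ * iteratedDerivWithin k f (Set.Icc 0 1) 0)
      * Polynomial.X ^ (k : ℕ) with hPdef
  have hP : ∀ x, P.eval x = taylorWithinEval f m (Set.Icc 0 1) 0 x := by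
    intro x
    rw [taylor_within_apply, hPdef, Polynomial.eval_finsetSum, ← Fin.sum_univ_eq_sum_range
      (fun k => (((k : ℕ).factorial : ℝ)⁻¹ * (x - 0) ^ k) •
        iteratedDerivWithin k f (Set.Icc 0 1) 0)]
    refine Finset.sum_congr rfl fun k _ => ?_
    simp; ring
  refine ⟨P, Polynomial.degree_sum_fin_lt _, ?_, fun x hx => ?_⟩
  · rw [hP, taylorWithinEval_self]
  · rw [hP]
    have hC' : ∀ y ∈ Set.Icc (0 : ℝ) 1, ‖iteratedDerivWithin (m + 1) f (Set.Icc 0 1) y‖ ≤ C := by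
      intro y hy
      rw [iteratedDerivWithin_eq_iteratedDeriv (uniqueDiffOn_Icc zero_lt_one)
        (hf.contDiffAt.of_le (by exact_mod_cast le_top)) hy]
      exact hC y hy
    have hC0 : 0 ≤ C := (norm_nonneg _).trans (hC' 0 (by simp))
    have := taylor_mean_remainder_bound (n := m) zero_le_one
      (hf.of_le (by exact_mod_cast le_top)).contDiffOn hx hC'
    rw [Real.norm_eq_abs] at this
    refine this.trans ?_
    rw [sub_zero]
    gcongr
    exact mul_le_of_le_one_right hC0 (pow_le_one₀ hx.1 hx.2)

variable {n : ℕ}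

local notation "𝔼" => EuclideanSpace ℝ (Fin n)

lemma contDiff_iterDir {u : 𝔼 → ℝ} (hu : ContDiff ℝ ∞ u) (l : List 𝔼) :
    ContDiff ℝ ∞ (iterDir l u) := by
  induction l with
  | nil => exact hu
  | cons z l ih => exact contDiff_dirDeriv ih z

lemma iteratedDeriv_ray {u : 𝔼 → ℝ} (hu : ContDiff ℝ ∞ u) (x z : 𝔼) (k : ℕ) :
    iteratedDeriv k (fun t : ℝ => u (x + t • z))
      = fun t => iterDir (List.replicate k z) u (x + t • z) := by
  induction k with
  | zero => simp [iterDir]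
  | succ k ih =>
    rw [iteratedDeriv_succ, ih]
    funext t
    have := hasDerivAt_comp_ray (contDiff_iterDir hu (List.replicate k z)) x z (hasDerivAt_id t)
    simpa [List.replicate_succ, iterDir] using this.deriv

/-- The ratio of the radii in the propagation-of-largeness estimate. -/
def remezRatio (n : ℕ) : ℝ := (6912 * 2 ^ (n + 4))⁻¹

lemma remezRatio_pos (n : ℕ) : 0 < remezRatio n := by unfold remezRatio; positivity

lemma remezRatio_le (n : ℕ) : remezRatio n ≤ 1 / 2 := by
  unfold remezRatio
  rw [one_div]
  refine inv_anti₀ (by norm_num) ?_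
  have : (1 : ℝ) ≤ 2 ^ (n + 4) := one_le_pow₀ (by norm_num)
  linarith

lemma HarmonicIn.card_bad_lt {u : 𝔼 → ℝ} {x z : 𝔼} {ρ : ℝ} {m : ℕ} (hρ : 0 < ρ)
    (hu : HarmonicIn u x ρ) (hx : u x ≠ 0)
    (hS : ∀ y ∈ closedBall x ρ, |u y| ≤ 3 ^ (m + 1) * |u x|) (hz : ‖z‖ ≤ remezRatio n * ρ) :
    ((Finset.range (2 * (m + 1))).filter fun j =>
      |u (x + samplePt (m + 1) j • z)| < (200 ^ (m + 1))⁻¹ * |u x|).card < m + 1 := by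
  by_contra hcon
  obtain ⟨T, hTs, hTc⟩ := Finset.exists_subset_card_eq (not_lt.1 hcon)
  set q : ℝ := ((m + 1 : ℕ) : ℝ) with hq
  have hq0 : 0 < q := by rw [hq]; positivity
  set f : ℝ → ℝ := fun t => u (x + t • z) with hf
  have hfs : ContDiff ℝ ∞ f := hu.smooth.comp (by fun_prop)
  have hrr := remezRatio_pos n
  have hder : ∀ y ∈ Set.Icc (0 : ℝ) 1, |iteratedDeriv (m + 1) f y|
      ≤ (q / 3456) ^ (m + 1) * (3 ^ (m + 1) * |u x|) := by
    intro t ht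
    rw [hf, iteratedDeriv_ray hu.smooth]
    have h1 := hu.abs_iterDir_le (h := ρ / (2 * q)) (b := remezRatio n * ρ) (by positivity) hS
      (List.replicate (m + 1) z) (by
        intro w hw; rw [List.eq_of_mem_replicate hw]; exact hz) (y := x + t • z) (by
        rw [List.length_replicate, dist_self_add_left, ← hq, norm_smul, Real.norm_of_nonneg ht.1]
        have h2 : q * (ρ / (2 * q)) = ρ / 2 := by field_simp
        have h3 : t * ‖z‖ ≤ 1 * (1 / 2 * ρ) := mul_le_mul ht.2
          (hz.trans (mul_le_mul_of_nonneg_right (remezRatio_le n) hρ.le)) (norm_nonneg _)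
          zero_le_one
        rw [h2]; linarith)
    rw [List.length_replicate] at h1
    refine h1.trans (le_of_eq ?_)
    congr 2
    unfold remezRatio
    field_simp
    norm_num
  obtain ⟨P, hPd, hP0, hPr⟩ := exists_taylor_polynomial hfs hder
  have hux : 0 < |u x| := abs_pos.2 hx
  have hrem : (q / 3456) ^ (m + 1) * (3 ^ (m + 1) * |u x|) / m.factorial
      ≤ (192 ^ (m + 1))⁻¹ * |u x| := by
    have h3 := pow_div_factorial_le_three_pow (m + 1)
    rw [← hq] at h3
    have h5 : q ≤ 2 ^ (m + 1) := by
      rw [hq]; exact_mod_cast (Nat.lt_two_pow_self (n := m + 1)).le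
    have e : (q / 3456) ^ (m + 1) * (3 ^ (m + 1) * |u x|) / m.factorial
        = (3456 ^ (m + 1))⁻¹ * 3 ^ (m + 1) * (q * (q ^ (m + 1) / (m + 1).factorial)) * |u x| := by
      rw [Nat.factorial_succ]; push_cast [hq]; rw [div_pow]; field_simp
    rw [e]
    refine mul_le_mul_of_nonneg_right ?_ hux.le
    calc ((3456 : ℝ) ^ (m + 1))⁻¹ * 3 ^ (m + 1) * (q * (q ^ (m + 1) / (m + 1).factorial))
        ≤ (3456 ^ (m + 1))⁻¹ * 3 ^ (m + 1) * (2 ^ (m + 1) * 3 ^ (m + 1)) := by gcongr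
      _ = (192 ^ (m + 1))⁻¹ := by
          rw [← inv_pow, ← inv_pow, ← mul_pow, ← mul_pow, ← mul_pow]; norm_num
  have hPη : ∀ j ∈ T, |P.eval (samplePt (m + 1) j)|
      ≤ (192 ^ (m + 1))⁻¹ * |u x| + (192 ^ (m + 1))⁻¹ * |u x| := by
    intro j hj
    have hjm := Finset.mem_filter.1 (hTs hj)
    have hj1 := samplePt_lt (Finset.mem_range.1 hjm.1)
    have hj2 := samplePt_ge (m + 1) j
    have h1 := (hPr _ ⟨by linarith, hj1.le⟩).trans hrem
    have h2 : |f (samplePt (m + 1) j)| ≤ (192 ^ (m + 1))⁻¹ * |u x| := by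
      refine hjm.2.le.trans (mul_le_mul_of_nonneg_right ?_ hux.le)
      exact inv_anti₀ (by positivity) (pow_le_pow_left₀ (by norm_num) (by norm_num) _)
    have h3 := abs_sub_abs_le_abs_sub (P.eval (samplePt (m + 1) j)) (f (samplePt (m + 1) j))
    rw [abs_sub_comm] at h3
    linarith
  have hfin := abs_eval_zero_le_of_samples hPd (hTs.trans (Finset.filter_subset _ _)) hTc hPη
  rw [hP0, show f 0 = u x by simp [hf]] at hfin
  have h4 : (48 : ℝ) ^ (m + 1) * (192 ^ (m + 1))⁻¹ ≤ 1 / 4 := by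
    rw [← inv_pow, ← mul_pow, pow_succ]
    norm_num
    exact pow_le_one₀ (by norm_num) (by norm_num)
  nlinarith

/-- Propagation of largeness: a harmonic function whose size on a ball is controlled by its value
at the centre is not too small on a definite portion of a smaller ball. -/
lemma HarmonicIn.volume_ball_le {u : 𝔼 → ℝ} {x : 𝔼} {ρ : ℝ} {m : ℕ} (hρ : 0 < ρ)
    (hu : HarmonicIn u x ρ) (hx : u x ≠ 0)
    (hS : ∀ y ∈ closedBall x ρ, |u y| ≤ 3 ^ (m + 1) * |u x|) :
    volume (ball x (remezRatio n * ρ)) ≤ 2 ^ (n + 1) *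
      volume {y ∈ ball x (remezRatio n * ρ) | (200 ^ (m + 1))⁻¹ * |u x| ≤ |u y|} := by
  set κ := remezRatio n * ρ
  have hκ : 0 < κ := mul_pos (remezRatio_pos n) hρ
  set G := {y ∈ ball x κ | (200 ^ (m + 1))⁻¹ * |u x| ≤ |u y|} with hG
  have hGm : MeasurableSet G :=
    measurableSet_ball.inter (measurableSet_le measurable_const hu.continuous.abs.measurable)
  set s : Finset ℕ := Finset.range (2 * (m + 1))
  set Gj : ℕ → Set 𝔼 := fun j => {z | x + samplePt (m + 1) j • z ∈ G} with hGj
  have hGjm : ∀ j, MeasurableSet (Gj j) := fun j =>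
    (by fun_prop : Measurable fun z : 𝔼 => x + samplePt (m + 1) j • z) hGm
  have hvol : ∀ j, volume (Gj j) ≤ 2 ^ n * volume G := by
    intro j
    have hpos : 0 < samplePt (m + 1) j := by linarith [samplePt_ge (m + 1) j]
    have h1 : Gj j = (fun z => samplePt (m + 1) j • z) ⁻¹' ((fun y => x + y) ⁻¹' G) := rfl
    rw [h1, Measure.addHaar_preimage_smul _ hpos.ne', measure_preimage_add,
      finrank_euclideanSpace_fin]
    gcongr
    rw [← ENNReal.ofReal_ofNat, ← ENNReal.ofReal_pow (by norm_num)]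
    refine ENNReal.ofReal_le_ofReal ?_
    rw [abs_of_pos (by positivity), ← inv_pow]
    refine pow_le_pow_left₀ (by positivity) ?_ _
    rw [inv_le_comm₀ hpos (by norm_num)]
    norm_num
    linarith [samplePt_ge (m + 1) j]
  have hcount : ∀ z ∈ ball (0 : 𝔼) κ,
      ((m + 1 : ℕ) : ENNReal) ≤ ∑ j ∈ s, (Gj j).indicator 1 z := by
    intro z hz
    have hz' : ‖z‖ < κ := by simpa using hz
    have hb : (s.filter fun j =>
        |u (x + samplePt (m + 1) j • z)| < (200 ^ (m + 1))⁻¹ * |u x|).card < m + 1 :=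
      hu.card_bad_lt hρ hx hS hz'.le
    have hc := Finset.card_filter_add_card_filter_not (s := s) (p := fun j =>
      |u (x + samplePt (m + 1) j • z)| < (200 ^ (m + 1))⁻¹ * |u x|)
    have hsc : s.card = 2 * (m + 1) := Finset.card_range _
    have hge : m + 1 ≤ (s.filter fun j =>
      ¬ |u (x + samplePt (m + 1) j • z)| < (200 ^ (m + 1))⁻¹ * |u x|).card := by omega
    calc ((m + 1 : ℕ) : ENNReal) ≤ ((s.filter fun j =>
        ¬ |u (x + samplePt (m + 1) j • z)| < (200 ^ (m + 1))⁻¹ * |u x|).card : ENNReal) := by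
          exact_mod_cast hge
      _ = ∑ j ∈ s.filter fun j =>
        ¬ |u (x + samplePt (m + 1) j • z)| < (200 ^ (m + 1))⁻¹ * |u x|, (1 : ENNReal) := by simp
      _ ≤ ∑ j ∈ s.filter fun j =>
        ¬ |u (x + samplePt (m + 1) j • z)| < (200 ^ (m + 1))⁻¹ * |u x|,
          (Gj j).indicator 1 z := by
          refine Finset.sum_le_sum fun j hj => ?_
          have hj' := Finset.mem_filter.1 hj
          have hmem : z ∈ Gj j := by
            refine ⟨?_, not_lt.1 hj'.2⟩
            have h1 := samplePt_lt (Finset.mem_range.1 hj'.1)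
            have h2 := samplePt_ge (m + 1) j
            rw [mem_ball, dist_self_add_left, norm_smul, Real.norm_of_nonneg (by linarith)]
            nlinarith [norm_nonneg z]
          rw [Set.indicator_of_mem hmem]; simp
      _ ≤ _ := Finset.sum_le_sum_of_subset (Finset.filter_subset _ _)
  have hint : ((m + 1 : ℕ) : ENNReal) * volume (ball (0 : 𝔼) κ)
      ≤ ∑ j ∈ s, volume (Gj j) := by
    calc ((m + 1 : ℕ) : ENNReal) * volume (ball (0 : 𝔼) κ)
        = ∫⁻ z in ball (0 : 𝔼) κ, ((m + 1 : ℕ) : ENNReal) := by rw [setLIntegral_const]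
      _ ≤ ∫⁻ z in ball (0 : 𝔼) κ, ∑ j ∈ s, (Gj j).indicator 1 z :=
          setLIntegral_mono' measurableSet_ball hcount
      _ ≤ ∫⁻ z, ∑ j ∈ s, (Gj j).indicator 1 z := setLIntegral_le_lintegral _ _
      _ = ∑ j ∈ s, volume (Gj j) := by
          rw [lintegral_finsetSum' _ fun j _ =>
            (measurable_one.indicator (hGjm j)).aemeasurable]
          simp [lintegral_indicator_one (hGjm _)]
  have h2 : ∑ j ∈ s, volume (Gj j) ≤ (2 * (m + 1) : ℕ) * (2 ^ n * volume G) := by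
    refine (Finset.sum_le_sum fun j _ => hvol j).trans (le_of_eq ?_)
    simp [s]
  have h3 := hint.trans h2
  have h4 : ((2 * (m + 1) : ℕ) : ENNReal) * (2 ^ n * volume G)
      = ((m + 1 : ℕ) : ENNReal) * (2 ^ (n + 1) * volume G) := by
    rw [pow_succ]; push_cast; ring
  rw [h4] at h3
  have h5 := (ENNReal.mul_le_mul_iff_right (by simp) (ENNReal.natCast_ne_top _)).1 h3
  rwa [Measure.addHaar_ball_center] at h5 ⊢

end Remez

section LocalOscillation

open Filter Topology
open scoped ContDiff

lemma convexOn_Iic_le_chord {f : ℝ → ℝ} {T s t τ : ℝ} (hf : ConvexOn ℝ (Set.Iic T) f)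
    (hst : s < τ) (hτ : τ ≤ T) (h1 : s ≤ t) (h2 : t ≤ τ) :
    f t ≤ f s + (t - s) / (τ - s) * (f τ - f s) := by
  have hd : 0 < τ - s := by linarith
  have hθ0 : 0 ≤ (t - s) / (τ - s) := div_nonneg (by linarith) hd.le
  have hθ1 : (t - s) / (τ - s) ≤ 1 := (div_le_one hd).2 (by linarith)
  have h := hf.2 (show s ∈ Set.Iic T from hst.le.trans hτ) (show τ ∈ Set.Iic T from hτ)
    (sub_nonneg.2 hθ1) hθ0 (by ring)
  simp only [smul_eq_mul] at h
  have e : (1 - (t - s) / (τ - s)) * s + (t - s) / (τ - s) * τ = t := by field_simp; ring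
  rw [e] at h
  linarith

variable {n : ℕ}

local notation "𝔼" => EuclideanSpace ℝ (Fin n)

lemma le_logMass (u : 𝔼 → ℝ) (x : 𝔼) {b : ℝ} (hb : 0 < b) (t : ℝ) :
    Real.log b ≤ logMass u x b t :=
  Real.log_le_log hb (le_max_right _ _)

lemma logMass_le_of_le {u : 𝔼 → ℝ} {x y : 𝔼} {b s t A : ℝ} (hb : 0 < b) (hA : 0 ≤ A)
    (h : sqMass u x (Real.exp s) ≤ Real.exp A * sqMass u y (Real.exp t)) :
    logMass u x b s ≤ logMass u y b t + A := by
  have hpos : 0 < max (sqMass u y (Real.exp t)) b := lt_max_of_lt_right hb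
  unfold logMass
  rw [← Real.log_exp A, ← Real.log_mul hpos.ne' (Real.exp_pos A).ne']
  refine Real.log_le_log (lt_max_of_lt_right hb) (max_le ?_ ?_)
  · refine h.trans ?_
    rw [mul_comm]
    exact mul_le_mul_of_nonneg_right (le_max_left _ _) (Real.exp_pos A).le
  · calc b = b * 1 := (mul_one b).symm
      _ ≤ _ := mul_le_mul (le_max_right _ _) (Real.one_le_exp hA) zero_le_one hpos.le

lemma logMass_le_log {u : 𝔼 → ℝ} {x : 𝔼} {b B t : ℝ} (hb : 0 < b) (hbB : b ≤ B)
    (h : sqMass u x (Real.exp t) ≤ B) : logMass u x b t ≤ Real.log B :=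
  Real.log_le_log (lt_max_of_lt_right hb) (max_le h hbB)

/-- In a general position, `logMass` at a small scale varies slowly with the centre. -/
lemma HarmonicIn.logMass_shift_le {u : 𝔼 → ℝ} {x y : 𝔼} {r δ h b A : ℝ} (hr : 0 < r)
    (hrδ : r < δ) (hb : 0 < b) (hu : HarmonicIn u x δ) (h0 : 0 ≤ h) (hh : r + h ≤ δ)
    (hxy : dist x y ≤ h) (hA : logMass u x b (Real.log δ) ≤ Real.log b + A) :
    logMass u y b (Real.log r) ≤ logMass u x b (Real.log r)
      + h / r / Real.log (δ / r) * A := by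
  have hδ : 0 < δ := hr.trans hrδ
  have hlog : 0 < Real.log (δ / r) := Real.log_pos ((one_lt_div hr).2 hrδ)
  have hlog' : Real.log δ - Real.log r = Real.log (δ / r) := (Real.log_div hδ.ne' hr.ne').symm
  have hrh : 0 < r + h := by linarith
  have h1 : logMass u y b (Real.log r) ≤ logMass u x b (Real.log (r + h)) := by
    have := logMass_le_of_le (u := u) (x := y) (y := x) (b := b) (s := Real.log r)
      (t := Real.log (r + h)) (A := 0) hb le_rfl (by
        rw [Real.exp_log hr, Real.exp_log hrh, Real.exp_zero, one_mul]
        exact sqMass_mono hu.continuous hr.le (by linarith))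
    simpa using this
  have hconv := hu.convexOn_logMass hb hδ
  have h2 := convexOn_Iic_le_chord hconv (s := Real.log r) (t := Real.log (r + h))
    (τ := Real.log δ) (by linarith) le_rfl (Real.log_le_log hr (by linarith))
    (Real.log_le_log hrh hh)
  rw [hlog'] at h2
  have h3 : Real.log (r + h) - Real.log r ≤ h / r := by
    rw [← Real.log_div hrh.ne' hr.ne']
    have := Real.log_le_sub_one_of_pos (div_pos hrh hr)
    rw [add_div, div_self hr.ne'] at this ⊢
    linarith
  have h4 := le_logMass u x hb (Real.log r)
  have h5 := le_logMass u x hb (Real.log δ)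
  have hA0 : 0 ≤ A := by linarith
  refine h1.trans (h2.trans (add_le_add le_rfl ?_))
  refine mul_le_mul (div_le_div_of_nonneg_right h3 hlog.le) (by linarith) ?_ (by positivity)
  exact sub_nonneg.2 (logMass_mono hu.continuous x hb (Real.log_le_log hr hrδ.le))

/-- Away from the nodal set, `sqMass` at a small scale varies very slowly with the centre. -/
lemma HarmonicIn.sqMass_shift_le {u : 𝔼 → ℝ} {x y : 𝔼} {r d h : ℝ} (hr : 0 < r)
    (hrd : 2 * r ≤ d) (hu : HarmonicIn u x d) (hne : ∀ z ∈ ball x d, u z ≠ 0) (h0 : 0 ≤ h)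
    (hh : 4 * h ≤ d) (hxy : dist x y ≤ h) :
    sqMass u y r ≤ Real.exp (8 * (n + 2) * h / d) * sqMass u x r := by
  have hd : 0 < d := by linarith
  have hsign : (∀ z ∈ ball x d, 0 ≤ u z) ∨ (∀ z ∈ ball x d, 0 ≤ -u z) := by
    have hpc : IsPreconnected (ball x d) := (convex_ball x d).isPreconnected
    by_contra hcon
    push Not at hcon
    obtain ⟨⟨a, ha, ha0⟩, c, hc, hc0⟩ := hcon
    obtain ⟨z, hz, hz0⟩ := hpc.intermediate_value ha hc hu.continuous.continuousOn
      (show (0 : ℝ) ∈ Set.Icc (u a) (u c) from ⟨ha0.le, by linarith⟩)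
    exact hne z hz hz0
  have key : ∀ {v : 𝔼 → ℝ}, HarmonicIn v x d → (∀ z ∈ ball x d, 0 ≤ v z) →
      ∀ ζ : 𝔼, ‖ζ‖ < 1 → v (y + r • ζ) ≤ Real.exp (4 * (n + 2) * h / d) * v (x + r • ζ) := by
    intro v hv hpos ζ hζ
    have hsub : ball (x + r • ζ) (d / 2 - h + h) ⊆ ball x d := by
      refine ball_subset_ball' ?_
      rw [dist_self_add_left, norm_smul, Real.norm_of_nonneg hr.le]
      nlinarith
    have h1 := (hv.mono hsub).harnack (y := y + r • ζ) (by linarith) h0 (by simpa using hxy)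
      fun z hz => hpos z (hsub hz)
    refine h1.trans (mul_le_mul_of_nonneg_right ?_ (hpos _ ?_))
    · have h2 : (d / 2 - h + h) / (d / 2 - h) ≤ 4 * h / d + 1 := by
        rw [div_add_one hd.ne', div_le_div_iff₀ (by linarith) hd]
        nlinarith
      have h3 := h2.trans (Real.add_one_le_exp _)
      have h4 := pow_le_pow_left₀ (by
        refine div_nonneg ?_ ?_ <;> linarith) h3 (n + 2)
      refine h4.trans (le_of_eq ?_)
      rw [← Real.exp_nat_mul]
      congr 1; push_cast; ring
    · exact hsub (mem_ball_self (by linarith))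
  have hsq : ∀ ζ : 𝔼, ‖ζ‖ < 1 →
      u (y + r • ζ) ^ 2 ≤ Real.exp (8 * (n + 2) * h / d) * u (x + r • ζ) ^ 2 := by
    intro ζ hζ
    have e : Real.exp (8 * (n + 2) * h / d) = Real.exp (4 * (n + 2) * h / d) ^ 2 := by
      rw [← Real.exp_nat_mul]; congr 1; push_cast; ring
    have hmem : y + r • ζ ∈ ball x d := by
      rw [mem_ball]
      have h1 : dist (y + r • ζ) y = r * ‖ζ‖ := by
        rw [dist_self_add_left, norm_smul, Real.norm_of_nonneg hr.le]
      have h2 := dist_triangle (y + r • ζ) y x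
      rw [dist_comm y x] at h2
      nlinarith
    rw [e, ← mul_pow]
    rcases hsign with hs | hs
    · exact pow_le_pow_left₀ (hs _ hmem) (key hu hs ζ hζ) 2
    · have h1 := pow_le_pow_left₀ (hs _ hmem) (key hu.neg hs ζ hζ) 2
      simpa only [mul_neg, neg_sq] using h1
  rw [sqMass_eq u y hr, sqMass_eq u x hr, mul_left_comm]
  refine mul_le_mul_of_nonneg_left ?_ (by positivity)
  rw [← integral_const_mul]
  have hc := hu.continuous
  refine integral_mono (integrable_mul_weight (by fun_prop) zero_le_one)
    ((integrable_mul_weight (by fun_prop) zero_le_one).const_mul _) fun ζ => ?_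
  simp only
  rcases lt_or_ge ‖ζ‖ 1 with hζ | hζ
  · rw [← mul_assoc]
    exact mul_le_mul_of_nonneg_right (hsq ζ hζ) (weight_nonneg _ _)
  · rw [weight_eq_zero zero_le_one hζ]; simp

/-- Points at distance less than `s` from the nodal set, away from the unit sphere. -/
def nodalNhd (u : EuclideanSpace ℝ (Fin n) → ℝ) (s : ℝ) : Set (EuclideanSpace ℝ (Fin n)) :=
  {x | ‖x‖ < 1 - 2 * s ∧ ∃ y, u y = 0 ∧ dist x y < s}

lemma measurableSet_nodalNhd (u : 𝔼 → ℝ) (s : ℝ) : MeasurableSet (nodalNhd u s) := by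
  have : nodalNhd u s = ball 0 (1 - 2 * s) ∩ ⋃ y ∈ {y | u y = 0}, ball y s := by
    ext x; simp [nodalNhd]
  rw [this]
  exact (isOpen_ball.inter (isOpen_biUnion fun _ _ => isOpen_ball)).measurableSet

/-- Pointwise bound for the rate of change of `logMass` at scale `r = s * 2⁻ᴵ`, in terms of the
distance to the nodal set. -/
def oscRate (u : EuclideanSpace ℝ (Fin n) → ℝ) (r L : ℝ) (I : ℕ)
    (x : EuclideanSpace ℝ (Fin n)) : ENNReal :=
  (nodalNhd u (2 * r)).indicator (fun _ => ENNReal.ofReal L) x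
    + ∑ i ∈ Finset.Icc 1 I,
      (nodalNhd u (2 ^ i * r)).indicator (fun _ => ENNReal.ofReal (16 * (n + 2) / (2 ^ i * r))) x
    + (ball 0 1).indicator (fun _ => ENNReal.ofReal (8 * (n + 2) / (2 ^ I * r))) x

lemma measurable_oscRate (u : 𝔼 → ℝ) (r L : ℝ) (I : ℕ) : Measurable (oscRate u r L I) := by
  unfold oscRate
  refine ((measurable_const.indicator (measurableSet_nodalNhd _ _)).add
    (Finset.measurable_sum _ fun i _ => measurable_const.indicator
      (measurableSet_nodalNhd _ _))).add (measurable_const.indicator measurableSet_ball)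

lemma lintegral_oscRate_le {u : 𝔼 → ℝ} {r L M : ℝ} {I : ℕ} (hr : 0 < r) (hL : 0 ≤ L) (hM : 0 ≤ M)
    (hvol : ∀ s, 0 < s → volume (nodalNhd u s) ≤ ENNReal.ofReal (M * s)) :
    ∫⁻ x, oscRate u r L I x ≤ ENNReal.ofReal (2 * L * M * r + 16 * (n + 2) * M * I
      + 8 * (n + 2) / (2 ^ I * r) * (volume (ball (0 : 𝔼) 1)).toReal) := by
  unfold oscRate
  rw [lintegral_add_right _ (measurable_const.indicator measurableSet_ball),
    lintegral_add_left (measurable_const.indicator (measurableSet_nodalNhd _ _)),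
    lintegral_finsetSum _ fun i _ => measurable_const.indicator (measurableSet_nodalNhd _ _),
    lintegral_indicator_const (measurableSet_nodalNhd _ _),
    lintegral_indicator_const measurableSet_ball]
  simp only [lintegral_indicator_const (measurableSet_nodalNhd u _)]
  rw [ENNReal.ofReal_add (by positivity) (by positivity),
    ENNReal.ofReal_add (by positivity) (by positivity)]
  refine add_le_add (add_le_add ?_ ?_) ?_
  · calc ENNReal.ofReal L * volume (nodalNhd u (2 * r))
        ≤ ENNReal.ofReal L * ENNReal.ofReal (M * (2 * r)) := by
          gcongr; exact hvol _ (by linarith)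
      _ = _ := by rw [← ENNReal.ofReal_mul hL]; congr 1; ring
  · calc ∑ i ∈ Finset.Icc 1 I, ENNReal.ofReal (16 * (n + 2) / (2 ^ i * r))
          * volume (nodalNhd u (2 ^ i * r))
        ≤ ∑ i ∈ Finset.Icc 1 I, ENNReal.ofReal (16 * (n + 2) * M) := by
          refine Finset.sum_le_sum fun i _ => ?_
          calc _ ≤ ENNReal.ofReal (16 * (n + 2) / (2 ^ i * r))
                * ENNReal.ofReal (M * (2 ^ i * r)) := by
                gcongr; exact hvol _ (by positivity)
            _ = _ := by
                rw [← ENNReal.ofReal_mul (by positivity)]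
                congr 1; field_simp
      _ = _ := by
          rw [Finset.sum_const, Nat.card_Icc, Nat.add_sub_cancel, nsmul_eq_mul,
            ENNReal.ofReal_mul (by positivity : (0 : ℝ) ≤ 16 * (n + 2) * M),
            ENNReal.ofReal_natCast, mul_comm]
  · rw [ENNReal.ofReal_mul (by positivity), ENNReal.ofReal_toReal measure_ball_lt_top.ne]

/-- One small step: the increase of `logMass` at scale `r` is controlled by `oscRate`. -/
lemma HarmonicIn.logMass_step_le {u : 𝔼 → ℝ} (hu : HarmonicIn u 0 1) {x y : 𝔼}
    {r h b A : ℝ} {I : ℕ} (hI : 1 ≤ I) (hr : 0 < r) (hb : 0 < b) (hA0 : 0 ≤ A) (h0 : 0 ≤ h)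
    (hhr : 2 * h ≤ r) (hxy : dist x y ≤ h) (hx : ‖x‖ + 2 * (2 ^ I * r) < 1)
    (hA : logMass u x b (Real.log (2 ^ I * r)) ≤ Real.log b + A) :
    ENNReal.ofReal (logMass u y b (Real.log r) - logMass u x b (Real.log r))
      ≤ ENNReal.ofReal h * oscRate u r (2 * A / (I * r)) I x := by
  have hball : ∀ d, d ≤ 2 ^ I * r → ball x d ⊆ ball 0 1 := fun d hd => ball_subset_ball' (by
    rw [dist_zero_right]; have : 0 < 2 ^ I * r := by positivity
    linarith)
  have h2I : (2 : ℝ) ≤ 2 ^ I := by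
    simpa using pow_le_pow_right₀ (one_le_two : (1 : ℝ) ≤ 2) hI
  -- away from the nodal set at distance `2 ^ i * r`
  have hfar : ∀ i, 1 ≤ i → i ≤ I → x ∉ nodalNhd u (2 ^ i * r) →
      logMass u y b (Real.log r) - logMass u x b (Real.log r)
        ≤ h * (8 * (n + 2) / (2 ^ i * r)) := by
    intro i hi1 hiI hxi
    have hle : (2 : ℝ) ^ i * r ≤ 2 ^ I * r :=
      mul_le_mul_of_nonneg_right (pow_le_pow_right₀ one_le_two hiI) hr.le
    have h2i : (2 : ℝ) ≤ 2 ^ i := by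
      simpa using pow_le_pow_right₀ (one_le_two : (1 : ℝ) ≤ 2) hi1
    have h1 := (hu.mono (hball _ hle)).sqMass_shift_le (y := y) (h := h) hr (by nlinarith)
      (fun z hz hz0 => hxi ⟨by linarith, z, hz0, by rwa [mem_ball, dist_comm] at hz⟩) h0
      (by nlinarith) hxy
    have h2 := logMass_le_of_le (u := u) (x := y) (y := x) (b := b) (s := Real.log r)
      (t := Real.log r) (A := 8 * (n + 2) * h / (2 ^ i * r)) hb (by positivity)
      (by rw [Real.exp_log hr]; exact h1)
    have e : 8 * (n + 2) * h / (2 ^ i * r) = h * (8 * (n + 2) / (2 ^ i * r)) := by ring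
    rw [e] at h2
    linarith
  by_cases h1 : x ∈ nodalNhd u (2 * r)
  · refine le_trans ?_ (mul_le_mul_right (le_self_add.trans le_self_add) _)
    rw [Set.indicator_of_mem h1, ← ENNReal.ofReal_mul h0]
    refine ENNReal.ofReal_le_ofReal ?_
    have h2 := (hu.mono (hball _ le_rfl)).logMass_shift_le (y := y) hr (by nlinarith) hb h0
      (by nlinarith) hxy hA
    rw [mul_div_cancel_right₀ _ hr.ne', Real.log_pow] at h2
    have h3 : h / r / (I * Real.log 2) * A ≤ h * (2 * A / (I * r)) := by
      have hI0 : (0 : ℝ) < I := by exact_mod_cast hI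
      have hl : (1 / 2 : ℝ) ≤ Real.log 2 := by linarith [Real.log_two_gt_d9]
      have : h / r / (I * Real.log 2) ≤ h / r / (I * (1 / 2)) := by gcongr
      refine (mul_le_mul_of_nonneg_right this hA0).trans (le_of_eq ?_)
      field_simp
    linarith
  by_cases h2 : x ∈ nodalNhd u (2 ^ I * r)
  · have hex : ∃ i, 1 ≤ i ∧ x ∈ nodalNhd u (2 ^ i * r) := ⟨I, hI, h2⟩
    classical
    set i := Nat.find hex with hi
    have hspec := Nat.find_spec hex
    have hiI : i ≤ I := Nat.find_min' hex ⟨hI, h2⟩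
    have hi2 : 2 ≤ i := by
      by_contra hcon
      have h3 : i = 1 := by have := hspec.1; omega
      rw [← hi, h3, pow_one] at hspec
      exact h1 hspec.2
    obtain ⟨k, hk⟩ : ∃ k, i = k + 1 := ⟨i - 1, by omega⟩
    have hk0 : x ∉ nodalNhd u (2 ^ k * r) := fun hc =>
      Nat.find_min hex (show k < Nat.find hex by omega) ⟨by omega, hc⟩
    have h3 := hfar k (by omega) (by omega) hk0
    refine le_trans ?_ (mul_le_mul_right (le_add_self.trans le_self_add) _)
    refine le_trans ?_ (mul_le_mul_right (Finset.single_le_sum (fun _ _ => zero_le)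
      (Finset.mem_Icc.2 ⟨hspec.1, hiI⟩)) _)
    rw [Set.indicator_of_mem hspec.2, ← ENNReal.ofReal_mul h0]
    refine ENNReal.ofReal_le_ofReal (h3.trans (le_of_eq ?_))
    rw [← hi, hk, pow_succ]
    field_simp
    ring
  · refine le_trans ?_ (mul_le_mul_right le_add_self _)
    rw [Set.indicator_of_mem (hball _ le_rfl (mem_ball_self (by positivity))),
      ← ENNReal.ofReal_mul h0]
    exact ENNReal.ofReal_le_ofReal (hfar I hI le_rfl h2)

/-- Integrated bound for the variation of `logMass` between a set and its translate. -/
lemma HarmonicIn.mul_volume_le_lintegral_oscRate {u : 𝔼 → ℝ} (hu : HarmonicIn u 0 1) {v : 𝔼}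
    {r b A P : ℝ} {I : ℕ} {E : Set 𝔼} (hE : MeasurableSet E) (hv : ‖v‖ ≤ 1) (hI : 1 ≤ I)
    (hr : 0 < r) (hb : 0 < b) (hA0 : 0 ≤ A)
    (hx : ∀ y ∈ E, ∀ t ∈ Set.Icc (0 : ℝ) 1, ‖y - t • v‖ + 2 * (2 ^ I * r) < 1)
    (hA : ∀ y ∈ E, ∀ t ∈ Set.Icc (0 : ℝ) 1,
      logMass u (y - t • v) b (Real.log (2 ^ I * r)) ≤ Real.log b + A)
    (hP : ∀ y ∈ E, P ≤ logMass u y b (Real.log r) - logMass u (y - v) b (Real.log r)) :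
    ENNReal.ofReal P * volume E ≤ ∫⁻ x, oscRate u r (2 * A / (I * r)) I x := by
  obtain ⟨m, hm⟩ := exists_nat_gt (2 / r)
  have hm0 : (0 : ℝ) < m := lt_trans (by positivity) hm
  have hmr : 2 * (m : ℝ)⁻¹ ≤ r := by
    rw [div_lt_iff₀ hr] at hm
    rw [← div_eq_mul_inv, div_le_iff₀ hm0]; linarith
  set w : ℕ → 𝔼 := fun k => ((k : ℝ) / m) • v with hw
  have hmem : ∀ k, k ≤ m → (k : ℝ) / m ∈ Set.Icc (0 : ℝ) 1 := fun k hk =>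
    ⟨by positivity, (div_le_one hm0).2 (by exact_mod_cast hk)⟩
  have hstep : ∀ k, dist (w (k + 1)) (w k) ≤ (m : ℝ)⁻¹ := by
    intro k
    rw [dist_eq_norm, hw]
    simp only
    rw [← sub_smul, norm_smul]
    have : ((k + 1 : ℕ) : ℝ) / m - k / m = (m : ℝ)⁻¹ := by push_cast; field_simp; ring
    rw [this, Real.norm_of_nonneg (by positivity)]
    exact mul_le_of_le_one_right (by positivity) hv
  have hpt : ∀ y ∈ E, ENNReal.ofReal P ≤ ∑ k ∈ Finset.range m,
      ENNReal.ofReal (m : ℝ)⁻¹ * oscRate u r (2 * A / (I * r)) I (y - w (k + 1)) := by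
    intro y hy
    have htel := Finset.sum_range_sub' (fun k => logMass u (y - w k) b (Real.log r)) m
    have hw0 : y - w 0 = y := by simp [hw]
    have hwm : y - w m = y - v := by simp [hw, div_self hm0.ne']
    rw [hw0, hwm] at htel
    calc ENNReal.ofReal P ≤ ENNReal.ofReal (∑ k ∈ Finset.range m,
          (logMass u (y - w k) b (Real.log r) - logMass u (y - w (k + 1)) b (Real.log r))) :=
          ENNReal.ofReal_le_ofReal (by rw [htel]; exact hP y hy)
      _ ≤ ∑ k ∈ Finset.range m, ENNReal.ofReal
          (logMass u (y - w k) b (Real.log r) - logMass u (y - w (k + 1)) b (Real.log r)) :=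
          Finset.le_sum_of_subadditive _ ENNReal.ofReal_zero.le
            (fun _ _ => ENNReal.ofReal_add_le) _ _
      _ ≤ _ := by
          refine Finset.sum_le_sum fun k hk => ?_
          have hk' := Finset.mem_range.1 hk
          refine hu.logMass_step_le hI hr hb hA0 (by positivity) hmr ?_
            (hx y hy _ (hmem _ hk')) (hA y hy _ (hmem _ hk'))
          rw [dist_sub_left]
          exact hstep k
  have hmeas : ∀ k, Measurable fun y => oscRate u r (2 * A / (I * r)) I (y - w (k + 1)) :=
    fun k => (measurable_oscRate u r (2 * A / (I * r)) I).comp (measurable_id.sub_const _)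
  calc ENNReal.ofReal P * volume E = ∫⁻ _ in E, ENNReal.ofReal P := by rw [setLIntegral_const]
    _ ≤ ∫⁻ y in E, ∑ k ∈ Finset.range m,
        ENNReal.ofReal (m : ℝ)⁻¹ * oscRate u r (2 * A / (I * r)) I (y - w (k + 1)) :=
        setLIntegral_mono' hE hpt
    _ ≤ ∫⁻ y, ∑ k ∈ Finset.range m,
        ENNReal.ofReal (m : ℝ)⁻¹ * oscRate u r (2 * A / (I * r)) I (y - w (k + 1)) :=
        setLIntegral_le_lintegral _ _
    _ = ∑ k ∈ Finset.range m, ENNReal.ofReal (m : ℝ)⁻¹ *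
        ∫⁻ x, oscRate u r (2 * A / (I * r)) I x := by
        rw [lintegral_finsetSum _ fun k _ => (hmeas k).const_mul _]
        refine Finset.sum_congr rfl fun k _ => ?_
        rw [lintegral_const_mul _ (hmeas k)]
        congr 1
        exact lintegral_sub_right_eq_self (oscRate u r (2 * A / (I * r)) I) _
    _ = _ := by
        rw [Finset.sum_const, Finset.card_range, nsmul_eq_mul, ← mul_assoc,
          ENNReal.ofReal_inv_of_pos hm0, ENNReal.ofReal_natCast,
          ENNReal.mul_inv_cancel (by exact_mod_cast hm0.ne') (ENNReal.natCast_ne_top m), one_mul]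

end LocalOscillation

section ScaleGrowth

open Filter Topology
open scoped ContDiff

variable {n : ℕ}

local notation "𝔼" => EuclideanSpace ℝ (Fin n)

lemma exp_neg_le_one_sub_half {x : ℝ} (h0 : 0 ≤ x) (h1 : x ≤ 1) :
    Real.exp (-x) ≤ 1 - x / 2 := by
  rw [Real.exp_neg]
  refine (inv_anti₀ (by linarith) (Real.add_one_le_exp x)).trans ?_
  rw [inv_le_iff_one_le_mul₀ (by linarith)]
  nlinarith

lemma inv_pow_le_exp {x : ℝ} (hx : 0 < x) (p : ℕ) : (x ^ p)⁻¹ ≤ Real.exp (p / x) := by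
  rw [← inv_pow, div_eq_mul_inv, Real.exp_nat_mul]
  exact pow_le_pow_left₀ (inv_nonneg.2 hx.le) ((Real.add_one_le_exp _).trans' (by linarith)) _

/-- A maximum point of `|u|` on the closed ball of radius `exp (-w / 2)` controls `u` on a
neighbourhood of size comparable to `w`. -/
lemma HarmonicIn.exists_max_point {u : 𝔼 → ℝ} (hu : HarmonicIn u 0 1) {w b P D ρ : ℝ}
    (hw : 0 < w) (hw1 : w ≤ 1) (hb : 0 < b) (hP : 0 ≤ P)
    (h1 : sqMass u 0 (Real.exp (-(w / 2))) = Real.exp P * b)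
    (h2 : sqMass u 0 (Real.exp (-(w / 4))) ≤ Real.exp ((D + 1) * P) * b)
    (hρ : 0 < ρ) (hρw : 16 * ρ ≤ w) :
    ∃ x₀ : 𝔼, ‖x₀‖ ≤ Real.exp (-(w / 2)) ∧ Real.exp P * b ≤ u x₀ ^ 2 * weightMass n ∧
      ∀ y ∈ closedBall x₀ ρ,
        u y ^ 2 ≤ u x₀ ^ 2 * (Real.exp (16 * ρ / w * (D * P)) * (ρ ^ (n + 2))⁻¹) := by
  set R := Real.exp (-(w / 2)) with hR
  have hR0 : 0 < R := Real.exp_pos _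
  have hR1 : R ≤ 1 - w / 4 := by
    have := exp_neg_le_one_sub_half (x := w / 2) (by linarith) (by linarith)
    linarith
  have hR2 : 3 / 5 < R := exp_neg_half_gt.trans_le (Real.exp_le_exp.2 (by linarith))
  have hW := weightMass_pos (n := n)
  obtain ⟨x₀, hx₀, hmax⟩ := (isCompact_closedBall (0 : 𝔼) R).exists_isMaxOn
    ⟨0, mem_closedBall_self hR0.le⟩ hu.continuous.abs.continuousOn
  have hx₀' : ‖x₀‖ ≤ R := by simpa using hx₀
  have hlarge : Real.exp P * b ≤ u x₀ ^ 2 * weightMass n := by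
    have h3 := sqMass_le hu.continuous (x := 0) hR0 (S := |u x₀|)
      fun z hz => hmax (ball_subset_closedBall hz)
    rw [h1, sq_abs] at h3
    refine h3.trans (mul_le_mul_of_nonneg_left ?_ (sq_nonneg _))
    exact mul_le_of_le_one_right hW.le (pow_le_one₀ hR0.le (by linarith))
  refine ⟨x₀, hx₀', hlarge, fun y hy => ?_⟩
  have hy' : dist y x₀ ≤ ρ := hy
  have hy0 : ‖y‖ ≤ R + ρ := by
    have := norm_le_norm_add_norm_sub' y x₀
    rw [← dist_eq_norm] at this
    linarith
  have hball : ball y ρ ⊆ ball 0 1 := ball_subset_ball' (by rw [dist_zero_right]; linarith)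
  have h3 := (hu.mono hball).sq_le_sqMass hρ
  set τ := -(w / 2) + 4 * ρ with hτ
  have h4 : R + 2 * ρ ≤ Real.exp τ := by
    rw [hτ, Real.exp_add]
    have := Real.add_one_le_exp (4 * ρ)
    nlinarith
  have h5 : sqMass u y ρ ≤ sqMass u 0 (Real.exp τ) :=
    sqMass_mono hu.continuous hρ.le (by rw [dist_zero_left]; linarith)
  have hconv := hu.convexOn_logMass hb one_pos
  rw [Real.log_one] at hconv
  have h6 := convexOn_Iic_le_chord hconv (s := -(w / 2)) (t := τ) (τ := -(w / 4))
    (by linarith) (by linarith) (by linarith) (by linarith)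
  have hbP : b ≤ Real.exp P * b := le_mul_of_one_le_left hb.le (Real.one_le_exp hP)
  have e1 : logMass u 0 b (-(w / 2)) = P + Real.log b := by
    unfold logMass
    rw [← hR, h1, max_eq_left hbP, Real.log_mul (Real.exp_pos _).ne' hb.ne', Real.log_exp]
  have e2 : logMass u 0 b (-(w / 4)) ≤ P + Real.log b + D * P := by
    have hmono := logMass_mono hu.continuous 0 hb (show -(w / 2) ≤ -(w / 4) by linarith)
    rw [e1] at hmono
    rcases max_choice (sqMass u 0 (Real.exp (-(w / 4)))) b with hm | hm
    · have := Real.log_le_log (lt_of_lt_of_le hb (max_eq_left_iff.1 hm)) h2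
      rw [Real.log_mul (Real.exp_pos _).ne' hb.ne', Real.log_exp] at this
      unfold logMass
      rw [hm]; linarith
    · unfold logMass at hmono ⊢
      rw [hm] at hmono ⊢
      have hP0 : P = 0 := by linarith
      rw [hP0]; simp
  have e3 : (τ - -(w / 2)) / (-(w / 4) - -(w / 2)) = 16 * ρ / w := by
    rw [hτ]; field_simp; ring
  have hθ : 0 ≤ 16 * ρ / w := by positivity
  rw [e3] at h6
  have h7 : logMass u 0 b τ ≤ P + Real.log b + 16 * ρ / w * (D * P) := by
    rw [e1] at h6
    have := mul_le_mul_of_nonneg_left (show logMass u 0 b (-(w / 4)) - (P + Real.log b) ≤ D * P by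
      linarith) hθ
    linarith
  have h8 : sqMass u 0 (Real.exp τ) ≤ Real.exp P * b * Real.exp (16 * ρ / w * (D * P)) := by
    refine (le_max_left _ b).trans ?_
    rw [← Real.exp_log (show 0 < max (sqMass u 0 (Real.exp τ)) b from lt_max_of_lt_right hb)]
    refine (Real.exp_le_exp.2 h7).trans (le_of_eq ?_)
    rw [Real.exp_add, Real.exp_add, Real.exp_log hb]
  have h9 := h3.trans (h5.trans (h8.trans (mul_le_mul_of_nonneg_right hlarge (Real.exp_pos _).le)))
  have hρp : 0 < ρ ^ (n + 2) := by positivity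
  rw [← mul_assoc, ← div_eq_mul_inv, le_div_iff₀ hρp]
  refine le_of_mul_le_mul_right ?_ hW
  linarith

/-- At a scale of large but controlled growth, `u` is large on a set of definite proportion. -/
lemma HarmonicIn.exists_large_set {u : 𝔼 → ℝ} (hu : HarmonicIn u 0 1) {w b P D ρ : ℝ}
    (hw : 0 < w) (hw1 : w ≤ 1) (hb : 0 < b) (hP : 96 ≤ P) (hD : 1 ≤ D)
    (h1 : sqMass u 0 (Real.exp (-(w / 2))) = Real.exp P * b)
    (h2 : sqMass u 0 (Real.exp (-(w / 4))) ≤ Real.exp ((D + 1) * P) * b)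
    (hρ : 0 < ρ) (hρw : 3072 * D * ρ ≤ w) (hρP : (ρ ^ (n + 2))⁻¹ ≤ Real.exp (P / 192)) :
    ∃ x₀ : 𝔼, ‖x₀‖ ≤ Real.exp (-(w / 2)) ∧ ∃ E : Set 𝔼, MeasurableSet E ∧
      E ⊆ ball x₀ (remezRatio n * ρ) ∧
      volume (ball x₀ (remezRatio n * ρ)) ≤ 2 ^ (n + 1) * volume E ∧
      ∀ y ∈ E, Real.exp (3 / 4 * P) * b ≤ u y ^ 2 * weightMass n := by
  have hρw' : 16 * ρ ≤ w := by nlinarith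
  obtain ⟨x₀, hx₀, hlarge, hloc⟩ := hu.exists_max_point hw hw1 hb (by linarith) h1 h2 hρ hρw'
  have hW := weightMass_pos (n := n)
  have hux : u x₀ ≠ 0 := by
    intro h0
    rw [h0] at hlarge
    have : 0 < Real.exp P * b := by positivity
    norm_num at hlarge
    linarith
  set m := ⌊P / 96⌋₊ with hm
  have hm1 : P / 96 < m + 1 := Nat.lt_floor_add_one _
  have hm2 : (m : ℝ) ≤ P / 96 := Nat.floor_le (by linarith)
  have hS : ∀ y ∈ closedBall x₀ ρ, |u y| ≤ 3 ^ (m + 1) * |u x₀| := by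
    intro y hy
    refine le_of_sq_le_sq ?_ (by positivity)
    rw [sq_abs, mul_pow, sq_abs, mul_comm]
    refine (hloc y hy).trans (mul_le_mul_of_nonneg_left ?_ (sq_nonneg _))
    have h3 : 16 * ρ / w * (D * P) ≤ P / 192 := by
      have : 16 * ρ / w * D ≤ 1 / 192 := by
        rw [div_mul_eq_mul_div, div_le_iff₀ hw]; linarith
      nlinarith
    calc Real.exp (16 * ρ / w * (D * P)) * (ρ ^ (n + 2))⁻¹
        ≤ Real.exp (P / 192) * Real.exp (P / 192) :=
          mul_le_mul (Real.exp_le_exp.2 h3) hρP (by positivity) (Real.exp_pos _).le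
      _ ≤ Real.exp ((m + 1 : ℕ) * 1) := by
          rw [← Real.exp_add]; refine Real.exp_le_exp.2 ?_; push_cast; linarith
      _ ≤ (3 ^ (m + 1)) ^ 2 := by
          rw [Real.exp_nat_mul, ← pow_mul, mul_comm, pow_mul]
          refine pow_le_pow_left₀ (Real.exp_pos _).le ?_ _
          linarith [Real.exp_one_lt_d9]
  have hball : ball x₀ ρ ⊆ ball 0 1 := ball_subset_ball' (by
    rw [dist_zero_right]
    have := exp_neg_le_one_sub_half (x := w / 2) (by linarith) (by linarith)
    linarith)
  refine ⟨x₀, hx₀, _, ?_, Set.sep_subset _ _, (hu.mono hball).volume_ball_le hρ hux hS, ?_⟩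
  · exact measurableSet_ball.inter (measurableSet_le measurable_const hu.continuous.abs.measurable)
  · rintro y ⟨-, hy⟩
    have h3 := pow_le_pow_left₀ (by positivity) hy 2
    rw [sq_abs, mul_pow, sq_abs] at h3
    have h4 : Real.exp (-(P / 4)) ≤ ((200 ^ (m + 1))⁻¹ : ℝ) ^ 2 := by
      rw [Real.exp_neg, inv_pow]
      refine inv_anti₀ (by positivity) ?_
      calc ((200 : ℝ) ^ (m + 1)) ^ 2 = (200 ^ 2) ^ (m + 1) := by
            rw [← pow_mul, ← pow_mul, mul_comm]
        _ ≤ (Real.exp 12) ^ (m + 1) := by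
            refine pow_le_pow_left₀ (by norm_num) ?_ _
            have h5 : Real.exp 12 = Real.exp 1 ^ 12 := by
              rw [← Real.exp_nat_mul]; norm_num
            rw [h5]
            refine le_trans (by norm_num) (pow_le_pow_left₀ (by norm_num)
              (show (2.7 : ℝ) ≤ Real.exp 1 by linarith [Real.exp_one_gt_d9]) _)
        _ ≤ Real.exp (P / 4) := by
            rw [← Real.exp_nat_mul]
            refine Real.exp_le_exp.2 ?_
            push_cast; linarith
    have h5 : Real.exp (3 / 4 * P) = Real.exp (-(P / 4)) * Real.exp P := by
      rw [← Real.exp_add]; congr 1; ring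
    calc Real.exp (3 / 4 * P) * b = Real.exp (-(P / 4)) * (Real.exp P * b) := by rw [h5]; ring
      _ ≤ ((200 ^ (m + 1))⁻¹ : ℝ) ^ 2 * (u x₀ ^ 2 * weightMass n) :=
          mul_le_mul h4 hlarge (by positivity) (by positivity)
      _ ≤ _ := by rw [← mul_assoc]; exact mul_le_mul_of_nonneg_right h3 hW.le

set_option maxHeartbeats 1000000 in
/-- If the neighbourhoods of the nodal set have small volume then the growth at scale `w` is
bounded, provided that it does not increase too fast at the next scale. -/
lemma exists_scale_growth_bound (n : ℕ) {M D : ℝ} (hM : 0 ≤ M) (hD : 1 ≤ D) :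
    ∃ Q : ℝ, 0 < Q ∧ ∀ u : EuclideanSpace ℝ (Fin n) → ℝ, HarmonicIn u 0 1 →
      (∀ s, 0 < s → volume (nodalNhd u s) ≤ ENNReal.ofReal (M * s)) →
      ∀ w b P : ℝ, 0 < w → w ≤ 1 → 0 < b →
        sqMass u 0 (Real.exp (-w)) ≤ b →
        sqMass u 0 (Real.exp (-(w / 2))) = Real.exp P * b →
        sqMass u 0 (Real.exp (-(w / 4))) ≤ Real.exp ((D + 1) * P) * b →
        P * w ^ (2 * n + 2) ≤ Q := by
  set p : ℝ := n + 2 with hp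
  have hp2 : 2 ≤ p := by rw [hp]; linarith [Nat.cast_nonneg (α := ℝ) n]
  set κ : ℝ := (3072 * D)⁻¹ with hκ
  have hκ0 : 0 < κ := by rw [hκ]; positivity
  have hκ1 : κ ≤ 1 / 3072 := by
    rw [hκ, one_div]; exact inv_anti₀ (by norm_num) (by linarith)
  set V := (volume (ball (0 : EuclideanSpace ℝ (Fin n)) 1)).toReal with hV
  have hV0 : 0 < V := ENNReal.toReal_pos (measure_ball_pos _ _ one_pos).ne'
    measure_ball_lt_top.ne
  set rr := remezRatio n with hrr
  have hrr0 : 0 < rr := remezRatio_pos n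
  have hrr1 : rr ≤ 1 / 2 := remezRatio_le n
  set c := (rr * κ) ^ n * V / 2 ^ (n + 2) with hc
  have hc0 : 0 < c := by positivity
  set C1 := 4 * (D + 1) * M + 32 * p * M with hC1
  have hC10 : 0 ≤ C1 := by positivity
  set C2 := 128 * p * V with hC2
  have hC20 : 0 ≤ C2 := by positivity
  set Q0 : ℝ := 96 + 192 * p / κ + 256 * p + 256 * p ^ 2 with hQ0
  have hκp : 0 < 192 * p / κ := by positivity
  have hp20 : 0 < p ^ 2 := by positivity
  refine ⟨Q0 + ((C1 + C2) / c) ^ 2, by positivity, fun u hu hvol w b P hw hw1 hb h0 h1 h2 => ?_⟩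
  rcases le_or_gt (P * w ^ (2 * n + 2)) Q0 with hsmall | hbig
  · exact hsmall.trans (le_add_of_nonneg_right (sq_nonneg _))
  refine le_add_of_nonneg_of_le (by positivity) ?_
  have hwp : w ^ (2 * n + 2) ≤ w := by
    simpa using pow_le_pow_of_le_one hw.le hw1 (show 1 ≤ 2 * n + 2 by omega)
  have hP0 : 0 < P := by
    by_contra hcon
    have := mul_nonpos_of_nonpos_of_nonneg (not_lt.1 hcon) (pow_nonneg hw.le (2 * n + 2))
    linarith
  have hPw : Q0 < P * w := hbig.trans_le (mul_le_mul_of_nonneg_left hwp hP0.le)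
  have hPQ : Q0 < P := hPw.trans_le (mul_le_of_le_one_right hP0.le hw1)
  set σ := √P with hσ
  have hσ2 : σ ^ 2 = P := Real.sq_sqrt hP0.le
  have hσp : 16 * p ≤ σ := Real.le_sqrt_of_sq_le (by nlinarith)
  have hσ0 : 0 < σ := by linarith
  set ρ := κ * w with hρ
  have hρ0 : 0 < ρ := mul_pos hκ0 hw
  have hρw : 3072 * D * ρ = w := by rw [hρ, hκ]; field_simp
  have hρP : (ρ ^ (n + 2))⁻¹ ≤ Real.exp (P / 192) := by
    refine (inv_pow_le_exp hρ0 _).trans (Real.exp_le_exp.2 ?_)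
    push_cast
    rw [← hp, div_le_div_iff₀ hρ0 (by norm_num), hρ]
    have h3 : 192 * p / κ ≤ P * w := by
      linarith
    rw [div_le_iff₀ hκ0] at h3
    linarith
  obtain ⟨x₀, hx₀, E, hEm, hEb, hEv, hEl⟩ := hu.exists_large_set hw hw1 hb (by linarith) hD h1 h2
    hρ0 hρw.le hρP
  set I := ⌈σ⌉₊ with hI
  have hI1 : 1 ≤ I := Nat.one_le_ceil_iff.2 hσ0
  have hIσ : σ ≤ I := Nat.le_ceil _
  have hIσ' : (I : ℝ) < σ + 1 := Nat.ceil_lt_add_one hσ0.le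
  set s := w / 16 with hs
  have hs0 : 0 < s := by positivity
  set r := s / 2 ^ I with hr
  have hr0 : 0 < r := by positivity
  have hrs : 2 ^ I * r = s := by rw [hr]; field_simp
  have hrs' : r ≤ s := div_le_self hs0.le (one_le_pow₀ one_le_two)
  set R' := Real.exp (-(w / 2)) with hR'
  have hR1 : R' ≤ 1 - w / 4 := by
    have := exp_neg_le_one_sub_half (x := w / 2) (by linarith) (by linarith)
    linarith
  have hR2 : 3 / 5 < R' := exp_neg_half_gt.trans_le (Real.exp_le_exp.2 (by linarith))
  have hR3 : R' + 3 / 20 * w ≤ Real.exp (-(w / 4)) := by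
    have e : Real.exp (-(w / 4)) = R' * Real.exp (w / 4) := by
      rw [hR', ← Real.exp_add]; congr 1; ring
    have h3 := mul_le_mul_of_nonneg_left (Real.add_one_le_exp (w / 4))
      (show (0 : ℝ) ≤ R' by linarith)
    have h4 := mul_le_mul_of_nonneg_right hR2.le hw.le
    rw [e]
    refine le_trans ?_ h3
    linarith
  have hrρ : rr * ρ ≤ w / 32 := by
    have h3 : ρ ≤ 1 / 3072 * w := mul_le_mul_of_nonneg_right hκ1 hw.le
    exact (mul_le_mul hrr1 h3 hρ0.le (by norm_num)).trans (by linarith)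
  have hpath : ∀ y ∈ E, ∀ t ∈ Set.Icc (0 : ℝ) 1, ‖y - t • x₀‖ ≤ R' + w / 32 := by
    intro y hy t ht
    have h3 : dist y x₀ < rr * ρ := hEb hy
    rw [dist_eq_norm] at h3
    have e : y - t • x₀ = (y - x₀) + (1 - t) • x₀ := by rw [sub_smul, one_smul]; abel
    rw [e]
    refine (norm_add_le _ _).trans ?_
    rw [norm_smul, Real.norm_of_nonneg (by linarith [ht.2])]
    have : (1 - t) * ‖x₀‖ ≤ R' := by
      exact (mul_le_of_le_one_left (norm_nonneg _) (by linarith [ht.1])).trans hx₀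
    linarith
  have hA0 : 0 ≤ (D + 1) * P := by positivity
  have hmain := hu.mul_volume_le_lintegral_oscRate (v := x₀) (r := r) (b := b) (A := (D + 1) * P)
    (P := P / 2) (I := I) hEm (by linarith) hI1 hr0 hb hA0
    (fun y hy t ht => by have := hpath y hy t ht; rw [hrs]; linarith)
    (fun y hy t ht => by
      have h3 := hpath y hy t ht
      rw [hrs]
      have h4 : b ≤ Real.exp ((D + 1) * P) * b :=
        le_mul_of_one_le_left hb.le (Real.one_le_exp hA0)
      refine (logMass_le_log hb h4 ?_).trans (le_of_eq ?_)
      · rw [Real.exp_log hs0]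
        refine (sqMass_mono hu.continuous hs0.le ?_).trans h2
        rw [dist_zero_left]; linarith
      · rw [Real.log_mul (Real.exp_pos _).ne' hb.ne', Real.log_exp]; ring)
    (fun y hy => by
      have h3 : dist y x₀ < rr * ρ := hEb hy
      have hy0 := hpath y hy 0 (by simp)
      rw [zero_smul, sub_zero] at hy0
      have hball : ball y r ⊆ ball 0 1 := ball_subset_ball' (by rw [dist_zero_right]; linarith)
      have h4 : logMass u (y - x₀) b (Real.log r) ≤ Real.log b := by
        refine logMass_le_log hb le_rfl ?_
        rw [Real.exp_log hr0]
        refine (sqMass_mono hu.continuous hr0.le ?_).trans h0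
        rw [dist_zero_left, ← dist_eq_norm]
        have := Real.add_one_le_exp (-w)
        have h6 : Real.exp (-1) ≤ Real.exp (-w) := Real.exp_le_exp.2 (by linarith)
        have h7 : 1 / 3 ≤ Real.exp (-1) := by
          rw [Real.exp_neg, one_div]
          exact inv_anti₀ (Real.exp_pos _) (by linarith [Real.exp_one_lt_d9])
        linarith
      have h5 : Real.exp (-(P / 4)) ≤ r ^ (n + 2) := by
        have h6 : (r ^ (n + 2))⁻¹ ≤ Real.exp (P / 4) := by
          have e : (r ^ (n + 2))⁻¹ = (s ^ (n + 2))⁻¹ * 2 ^ (I * (n + 2)) := by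
            rw [hr, div_pow, inv_div, pow_mul]; field_simp
          have h7 : (2 : ℝ) ^ (I * (n + 2)) ≤ Real.exp (I * p) := by
            have : (2 : ℝ) ≤ Real.exp 1 := by linarith [Real.exp_one_gt_d9]
            refine (pow_le_pow_left₀ (by norm_num) this _).trans (le_of_eq ?_)
            rw [← Real.exp_nat_mul]; congr 1; push_cast; rw [hp]; ring
          rw [e]
          refine (mul_le_mul (inv_pow_le_exp hs0 _) h7 (by positivity)
            (Real.exp_pos _).le).trans ?_
          rw [← Real.exp_add]
          refine Real.exp_le_exp.2 ?_
          push_cast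
          rw [← hp]
          have h8 : p / s ≤ P / 16 := by
            rw [div_le_div_iff₀ hs0 (by norm_num), hs]
            linarith
          have h9 : I * p ≤ P / 16 + P / 16 := by
            have : I * p ≤ (σ + 1) * p := mul_le_mul_of_nonneg_right hIσ'.le (by linarith)
            nlinarith
          linarith
        rw [Real.exp_neg]
        exact inv_le_of_inv_le₀ (by positivity) h6
      have h6 : Real.exp (P / 2) * b ≤ sqMass u y r := by
        refine le_trans ?_ ((hu.mono hball).sq_le_sqMass hr0)
        have e : Real.exp (P / 2) = Real.exp (3 / 4 * P) * Real.exp (-(P / 4)) := by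
          rw [← Real.exp_add]; congr 1; ring
        calc Real.exp (P / 2) * b = Real.exp (3 / 4 * P) * b * Real.exp (-(P / 4)) := by
              rw [e]; ring
          _ ≤ u y ^ 2 * weightMass n * r ^ (n + 2) :=
              mul_le_mul (hEl y hy) h5 (Real.exp_pos _).le
                (mul_nonneg (sq_nonneg _) weightMass_pos.le)
          _ = _ := by ring
      have h7 : P / 2 + Real.log b ≤ logMass u y b (Real.log r) := by
        unfold logMass
        rw [Real.exp_log hr0]
        have := Real.log_le_log (by positivity) (h6.trans (le_max_left _ b))
        rwa [Real.log_mul (Real.exp_pos _).ne' hb.ne', Real.log_exp] at this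
      linarith)
  have hint := hmain.trans (lintegral_oscRate_le (M := M) hr0 (by positivity) hM hvol)
  have hEfin : volume E ≠ ⊤ := ((measure_mono hEb).trans_lt measure_ball_lt_top).ne
  have hreal := ENNReal.toReal_mono ENNReal.ofReal_ne_top hint
  rw [ENNReal.toReal_mul, ENNReal.toReal_ofReal (by positivity),
    ENNReal.toReal_ofReal (by positivity), hrs, ← hV, ← hp] at hreal
  have hvolE : (rr * ρ) ^ n * V ≤ 2 ^ (n + 1) * (volume E).toReal := by
    have h3 := ENNReal.toReal_mono (by finiteness) hEv
    rw [ENNReal.toReal_mul, Measure.addHaar_ball_of_pos _ _ (by positivity), ENNReal.toReal_mul,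
      ENNReal.toReal_ofReal (by positivity), finrank_euclideanSpace_fin, ENNReal.toReal_pow,
      ENNReal.toReal_ofNat] at h3
    exact h3
  have h3 : P * c * w ^ n ≤ P / 2 * (volume E).toReal := by
    have e : P * c * w ^ n = P / 2 * ((rr * ρ) ^ n * V / 2 ^ (n + 1)) := by
      rw [hc, hρ, ← mul_assoc, mul_pow (rr * κ) w, pow_succ 2 (n + 1)]; field_simp
    rw [e]
    refine mul_le_mul_of_nonneg_left ?_ (by positivity)
    rw [div_le_iff₀ (by positivity)]
    linarith
  have h4 : 2 * (2 * ((D + 1) * P) / (I * r)) * M * r ≤ 4 * (D + 1) * M * σ := by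
    have e : 2 * (2 * ((D + 1) * P) / (I * r)) * M * r = 4 * (D + 1) * M * (P / I) := by
      have : (I : ℝ) ≠ 0 := by positivity
      field_simp; ring
    rw [e]
    refine mul_le_mul_of_nonneg_left ?_ (by positivity)
    rw [div_le_iff₀ (by positivity), ← hσ2, pow_two]
    exact mul_le_mul_of_nonneg_left hIσ hσ0.le
  have h5 : 16 * p * M * I ≤ 32 * p * M * σ := by
    have : (I : ℝ) ≤ 2 * σ := by linarith
    have hpM : 0 ≤ 16 * p * M := by positivity
    linarith [mul_le_mul_of_nonneg_left this hpM]
  have h6 : 8 * p / s * V = C2 / w := by rw [hs, hC2]; field_simp; ring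
  have h7 : P * c * w ^ n ≤ C1 * σ + C2 / w := by
    rw [h6] at hreal
    rw [hC1]; linarith
  have h8 : P * c * w ^ (n + 1) ≤ (C1 + C2) * σ := by
    calc P * c * w ^ (n + 1) = P * c * w ^ n * w := by ring
      _ ≤ (C1 * σ + C2 / w) * w := mul_le_mul_of_nonneg_right h7 hw.le
      _ = C1 * σ * w + C2 := by field_simp
      _ ≤ C1 * σ * 1 + C2 * σ := add_le_add (mul_le_mul_of_nonneg_left hw1 (by positivity))
          (le_mul_of_one_le_right hC20 (by linarith))
      _ = _ := by ring
  have h9 : σ * w ^ (n + 1) ≤ (C1 + C2) / c := by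
    rw [le_div_iff₀ hc0]
    refine le_of_mul_le_mul_right ?_ hσ0
    rw [← hσ2] at h8
    linarith
  calc P * w ^ (2 * n + 2) = (σ * w ^ (n + 1)) ^ 2 := by rw [mul_pow, hσ2]; ring
    _ ≤ _ := pow_le_pow_left₀ (by positivity) h9 2

end ScaleGrowth

section GrowthBound

open Filter Topology
open scoped ContDiff

variable {n : ℕ}

local notation "𝔼" => EuclideanSpace ℝ (Fin n)

lemma exists_slow_step {N : ℕ → ℝ} {B D : ℝ} (hB : ∀ j, N j ≤ B) (h0 : 0 < N 0) (hD : 1 < D) :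
    ∃ j, D ^ j * N 0 ≤ N j ∧ N (j + 1) ≤ D * N j := by
  by_contra! h
  have h1 : ∀ j, D ^ j * N 0 ≤ N j := by
    intro j
    induction j with
    | zero => simp
    | succ j ih =>
      refine le_trans ?_ (h j ih).le
      rw [pow_succ', mul_assoc]
      exact mul_le_mul_of_nonneg_left ih (by linarith)
  obtain ⟨j, hj⟩ := pow_unbounded_of_one_lt (B / N 0) hD
  rw [div_lt_iff₀ h0] at hj
  linarith [h1 j, hB j]

lemma exp_logMass (u : 𝔼 → ℝ) (x : 𝔼) {c : ℝ} (hc : 0 < c) (t : ℝ) :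
    Real.exp (logMass u x c t) = max (sqMass u x (Real.exp t)) c :=
  Real.exp_log (lt_max_of_lt_right hc)

lemma exists_growth_bound (n : ℕ) {M : ℝ} (hM : 0 ≤ M) :
    ∃ A : ℝ, 0 ≤ A ∧ ∀ u : EuclideanSpace ℝ (Fin n) → ℝ, HarmonicIn u 0 1 →
      (∀ s, 0 < s → volume (nodalNhd u s) ≤ ENNReal.ofReal (M * s)) →
      sqMass u 0 (Real.exp (-(1 / 2))) ≤ Real.exp A * sqMass u 0 (Real.exp (-1)) := by
  have hD : (1 : ℝ) < 2 ^ (2 * n + 2) := one_lt_pow₀ one_lt_two (by omega)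
  obtain ⟨Q, hQ, H⟩ := exists_scale_growth_bound n hM hD.le
  refine ⟨Q + 1, by linarith, fun u hu hvol => ?_⟩
  by_contra! hlt
  set A := Q + 1 with hA
  set c := Real.exp (-A) * sqMass u 0 (Real.exp (-(1 / 2))) with hc
  have hS : sqMass u 0 (Real.exp (-(1 / 2))) = Real.exp A * c := by
    rw [hc, ← mul_assoc, ← Real.exp_add]; simp
  have hc0 : 0 < c := by
    have := mul_nonneg (Real.exp_pos A).le (sqMass_nonneg u 0 (Real.exp (-1)))
    exact mul_pos (Real.exp_pos _) (by linarith)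
  have hS1 : sqMass u 0 (Real.exp (-1)) ≤ c := by
    rw [hS] at hlt
    exact (lt_of_mul_lt_mul_left hlt (Real.exp_pos _).le).le
  set g := logMass u 0 c with hg
  have hmono : Monotone g := logMass_mono hu.continuous 0 hc0
  set N : ℕ → ℝ := fun j => g (-((1 / 2) ^ j / 2)) - g (-(1 / 2) ^ j) with hN
  have hN0 : N 0 = A := by
    have h1 : g (-(1 / 2)) = A + Real.log c := by
      rw [hg]
      unfold logMass
      rw [hS, max_eq_left (le_mul_of_one_le_left hc0.le (Real.one_le_exp (by linarith))),
        Real.log_mul (Real.exp_pos _).ne' hc0.ne', Real.log_exp]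
    have h2 : g (-1) = Real.log c := by
      rw [hg]
      unfold logMass
      rw [max_eq_right hS1]
    simp only [hN, pow_zero, h1, h2]
    ring
  have hbd : ∀ j, N j ≤ g 0 - Real.log c := fun j =>
    sub_le_sub (hmono (by have : (0 : ℝ) < (1 / 2) ^ j := by positivity
                          linarith)) (le_logMass u 0 hc0 _)
  obtain ⟨j, hj1, hj2⟩ := exists_slow_step hbd (by rw [hN0]; linarith) hD
  set w : ℝ := (1 / 2) ^ j with hw
  have hw0 : 0 < w := by positivity
  have hNj : N j = g (-(w / 2)) - g (-w) := rfl
  have hNj1 : N (j + 1) = g (-(w / 4)) - g (-(w / 2)) := by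
    simp only [hN, pow_succ, ← hw]
    congr 2 <;> ring
  have hP : 0 < N j := lt_of_lt_of_le (by rw [hN0]; have : 0 < A := by linarith
                                          positivity) hj1
  have hb : Real.exp (g (-(w / 2))) = Real.exp (N j) * Real.exp (g (-w)) := by
    rw [← Real.exp_add, hNj]; congr 1; ring
  have hcb : c ≤ Real.exp (g (-w)) := by
    rw [hg, exp_logMass u 0 hc0]; exact le_max_right _ _
  have key := H u hu hvol w (Real.exp (g (-w))) (N j) hw0
    (pow_le_one₀ (by norm_num) (by norm_num)) (Real.exp_pos _)
    (by rw [hg, exp_logMass u 0 hc0]; exact le_max_left _ _)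
    (by
      rw [← hb]
      have h1 := exp_logMass u 0 hc0 (-(w / 2))
      rcases max_choice (sqMass u 0 (Real.exp (-(w / 2)))) c with h | h
      · rw [hg, h1, h]
      · rw [h, ← hg, hb] at h1
        have := mul_lt_mul_of_pos_right (Real.one_lt_exp_iff.2 hP) (Real.exp_pos (g (-w)))
        linarith)
    (by
      refine (le_max_left _ c).trans ?_
      rw [← exp_logMass u 0 hc0, ← hg, ← Real.exp_add]
      exact Real.exp_le_exp.2 (by linarith))
  have hDw : (2 ^ (2 * n + 2)) ^ j * w ^ (2 * n + 2) = (1 : ℝ) := by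
    rw [hw, ← pow_mul, ← pow_mul, mul_comm j, ← mul_pow]; norm_num
  have : A ≤ N j * w ^ (2 * n + 2) := by
    calc A = (2 ^ (2 * n + 2)) ^ j * N 0 * w ^ (2 * n + 2) := by
          rw [hN0, mul_right_comm, hDw, one_mul]
      _ ≤ _ := mul_le_mul_of_nonneg_right hj1 (by positivity)
  linarith

end GrowthBound

section NodalLowerBound

open Filter Topology Pointwise
open scoped ContDiff

variable {n : ℕ}

local notation "𝔼" => EuclideanSpace ℝ (Fin n)

lemma hausdorffMeasure_nodal_scale (hn : 1 ≤ n) (u : 𝔼 → ℝ) (x : 𝔼) {ρ : ℝ} (hρ : 0 < ρ) :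
    μH[(n : ℝ) - 1] ({y | u y = 0} ∩ ball x ρ) = ENNReal.ofReal (ρ ^ (n - 1))
      * μH[(n : ℝ) - 1] ({y | u (x + ρ • y) = 0} ∩ ball 0 1) := by
  have hd : (0 : ℝ) ≤ (n : ℝ) - 1 := by
    have : (1 : ℝ) ≤ n := by exact_mod_cast hn
    linarith
  have himg : {y | u y = 0} ∩ ball x ρ
      = IsometryEquiv.addLeft x '' (ρ • ({y | u (x + ρ • y) = 0} ∩ ball 0 1)) := by
    ext y
    simp only [Set.mem_inter_iff, Set.mem_ofPred_eq, mem_ball, Set.mem_image, Set.mem_smul_set,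
      IsometryEquiv.addLeft_apply, dist_eq_norm, sub_zero]
    constructor
    · rintro ⟨h1, h2⟩
      refine ⟨y - x, ⟨ρ⁻¹ • (y - x), ⟨?_, ?_⟩, ?_⟩, by abel⟩
      · rw [smul_inv_smul₀ hρ.ne']; simpa using h1
      · rw [norm_smul, norm_inv, Real.norm_of_nonneg hρ.le, inv_mul_lt_iff₀ hρ, mul_one]
        exact h2
      · rw [smul_inv_smul₀ hρ.ne']
    · rintro ⟨_, ⟨z, ⟨h1, h2⟩, rfl⟩, rfl⟩
      refine ⟨h1, ?_⟩
      rw [add_sub_cancel_left, norm_smul, Real.norm_of_nonneg hρ.le]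
      exact (mul_lt_iff_lt_one_right hρ).2 h2
  rw [himg, IsometryEquiv.hausdorffMeasure_image, Measure.hausdorffMeasure_smul₀ hd hρ.ne',
    ENNReal.smul_def, smul_eq_mul]
  congr 1
  rw [ENNReal.ofReal]
  congr 1
  rw [← NNReal.coe_inj, NNReal.coe_rpow, coe_nnnorm, Real.norm_of_nonneg hρ.le,
    Real.coe_toNNReal _ (by positivity), ← Real.rpow_natCast, Nat.cast_sub hn, Nat.cast_one]

lemma volume_nodalNhd_le (hn : 1 ≤ n) {u : 𝔼 → ℝ} (hu : Continuous u) {m T : ℝ} (hm : 0 < m)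
    (hT : μH[(n : ℝ) - 1] ({x | u x = 0} ∩ ball (0 : 𝔼) 1) ≤ ENNReal.ofReal T)
    (hlow : ∀ y : 𝔼, u y = 0 → ∀ s, 0 < s → ‖y‖ + s < 1 →
      ENNReal.ofReal (m * s ^ (n - 1)) ≤ μH[(n : ℝ) - 1] ({x | u x = 0} ∩ ball y s))
    {s : ℝ} (hs : 0 < s) :
    volume (nodalNhd u s)
      ≤ ENNReal.ofReal (2 ^ n * (volume (ball (0 : 𝔼) 1)).toReal * T / m * s) := by
  set Z : Set 𝔼 := {x | u x = 0} ∩ ball 0 1 with hZ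
  have hZm : MeasurableSet Z :=
    (isClosed_singleton.preimage hu).measurableSet.inter measurableSet_ball
  set ν : Measure 𝔼 := μH[(n : ℝ) - 1].restrict Z with hν
  have hνu : ν Set.univ = μH[(n : ℝ) - 1] Z := by rw [hν, Measure.restrict_apply_univ]
  have : IsFiniteMeasure ν := ⟨by rw [hνu]; exact hT.trans_lt ENNReal.ofReal_lt_top⟩
  set G : Set (𝔼 × 𝔼) := {p | dist p.1 p.2 < 2 * s} with hG
  have hGm : MeasurableSet G := (isOpen_lt (by fun_prop) continuous_const).measurableSet
  have hfub := (Measure.prod_apply (μ := (volume : Measure 𝔼)) (ν := ν) hGm).symm.trans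
    (Measure.prod_apply_symm hGm)
  have hl : ENNReal.ofReal (m * s ^ (n - 1)) * volume (nodalNhd u s)
      ≤ ∫⁻ x, ν (Prod.mk x ⁻¹' G) := by
    rw [← setLIntegral_const]
    refine (setLIntegral_mono' (measurableSet_nodalNhd u s) ?_).trans
      (setLIntegral_le_lintegral _ _)
    rintro x ⟨hx, y, hy, hxy⟩
    have hyx : ‖y‖ < ‖x‖ + s := by
      have h1 := norm_le_norm_add_norm_sub' y x
      rw [← dist_eq_norm, dist_comm] at h1
      linarith
    refine (hlow y hy s hs (by linarith)).trans ?_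
    rw [hν, Measure.restrict_apply (hGm.preimage measurable_prodMk_left)]
    refine measure_mono ?_
    rintro z ⟨hz0, hz⟩
    rw [mem_ball] at hz
    refine ⟨?_, hz0, ?_⟩
    · change dist x z < 2 * s
      have := dist_triangle x y z
      rw [dist_comm y z] at this
      linarith
    · rw [mem_ball, dist_zero_right]
      have h1 := norm_le_norm_add_norm_sub' z y
      rw [← dist_eq_norm] at h1
      linarith
  have hr : ∫⁻ y, volume ((fun x => (x, y)) ⁻¹' G) ∂ν
      ≤ ENNReal.ofReal ((2 * s) ^ n * (volume (ball (0 : 𝔼) 1)).toReal * T) := by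
    have h1 : ∀ y : 𝔼, volume ((fun x => (x, y)) ⁻¹' G)
        = ENNReal.ofReal ((2 * s) ^ n * (volume (ball (0 : 𝔼) 1)).toReal) := by
      intro y
      have : (fun x => (x, y)) ⁻¹' G = ball y (2 * s) := by ext x; simp [hG]
      rw [this, Measure.addHaar_ball_of_pos _ _ (by positivity), finrank_euclideanSpace_fin,
        ENNReal.ofReal_mul (by positivity), ENNReal.ofReal_toReal measure_ball_lt_top.ne]
    simp_rw [h1]
    rw [lintegral_const, hνu, ENNReal.ofReal_mul
      (show 0 ≤ (2 * s) ^ n * (volume (ball (0 : 𝔼) 1)).toReal by positivity)]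
    exact mul_le_mul_right hT _
  have hms : 0 < m * s ^ (n - 1) := by positivity
  have hkey := (hl.trans hfub.le).trans hr
  rw [mul_comm, ← ENNReal.le_div_iff_mul_le (Or.inl (by simpa using hms))
    (Or.inl ENNReal.ofReal_ne_top), ← ENNReal.ofReal_div_of_pos hms] at hkey
  refine hkey.trans (ENNReal.ofReal_le_ofReal (le_of_eq ?_))
  obtain ⟨k, rfl⟩ : ∃ k, n = k + 1 := ⟨n - 1, by omega⟩
  rw [Nat.add_sub_cancel]
  field_simp
  ring

lemma sqMass_comp_affine (u : 𝔼 → ℝ) (x : 𝔼) {ρ r : ℝ} (hρ : 0 < ρ) (hr : 0 < r) :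
    sqMass u x (ρ * r) = ρ ^ (n + 2) * sqMass (fun y => u (x + ρ • y)) 0 r := by
  rw [sqMass_eq u x (mul_pos hρ hr), sqMass_eq _ _ hr, mul_pow, mul_assoc]
  simp only [zero_add, smul_smul]

/-- Growth bounds propagate to smaller scales, by log-convexity. -/
lemma HarmonicIn.sqMass_le_of_growth {u : 𝔼 → ℝ} {x : 𝔼} {R a b p q A : ℝ}
    (hu : HarmonicIn u x R) (hab : a < b) (hbp : b ≤ p) (hpq : p < q) (hq : Real.exp q ≤ R)
    (hA : 0 ≤ A) (h : sqMass u x (Real.exp q) ≤ Real.exp A * sqMass u x (Real.exp p)) :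
    sqMass u x (Real.exp b) ≤ Real.exp ((b - a) / (q - p) * A) * sqMass u x (Real.exp a) := by
  have hR : 0 < R := (Real.exp_pos q).trans_le hq
  have hqR : q ≤ Real.log R := (Real.le_log_iff_exp_le hR).2 hq
  have key : ∀ c, 0 < c → sqMass u x (Real.exp b)
      ≤ Real.exp ((b - a) / (q - p) * A) * max (sqMass u x (Real.exp a)) c := by
    intro c hc
    have hcv := hu.convexOn_logMass hc hR
    set f := logMass u x c with hf
    have hslope : (f b - f a) / (b - a) ≤ (f q - f p) / (q - p) := by
      rcases hbp.eq_or_lt with rfl | hbp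
      · exact hcv.slope_mono_adjacent (by simp; linarith) hqR hab hpq
      · exact (hcv.slope_mono_adjacent (by simp; linarith) (by simp; linarith) hab hbp).trans
          (hcv.slope_mono_adjacent (by simp; linarith) hqR hbp hpq)
    have hfq : f q ≤ f p + A := logMass_le_of_le hc hA h
    have hfb : f b ≤ f a + (b - a) / (q - p) * A := by
      have h1 : (f b - f a) / (b - a) ≤ A / (q - p) :=
        hslope.trans (div_le_div_of_nonneg_right (by linarith) (by linarith))
      rw [div_le_iff₀ (by linarith)] at h1
      have : A / (q - p) * (b - a) = (b - a) / (q - p) * A := by ring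
      linarith
    calc sqMass u x (Real.exp b) ≤ Real.exp (f b) := by
          rw [hf, exp_logMass u x hc]; exact le_max_left _ _
      _ ≤ Real.exp (f a + (b - a) / (q - p) * A) := Real.exp_le_exp.2 hfb
      _ = _ := by rw [add_comm, Real.exp_add, hf, exp_logMass u x hc]
  rcases (sqMass_nonneg u x (Real.exp a)).eq_or_lt with h0 | h0
  · rw [← h0, mul_zero]
    refine le_of_forall_pos_le_add fun ε hε => ?_
    have hE := Real.exp_pos ((b - a) / (q - p) * A)
    have := key (ε / Real.exp ((b - a) / (q - p) * A)) (by positivity)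
    rw [← h0, max_eq_right (by positivity), mul_div_cancel₀ _ hE.ne'] at this
    linarith
  · simpa using key _ h0

lemma HarmonicIn.exists_uniform_growth {u : 𝔼 → ℝ} (hu : HarmonicIn u 0 1) :
    ∃ A : ℝ, 0 ≤ A ∧ ∀ (x : 𝔼) (ρ : ℝ), 0 < ρ → ‖x‖ + ρ ≤ 1 / 4 →
      sqMass (fun y => u (x + ρ • y)) 0 (Real.exp (-(1 / 2)))
        ≤ Real.exp A * sqMass (fun y => u (x + ρ • y)) 0 (Real.exp (-1)) := by
  suffices H : ∃ A : ℝ, 0 ≤ A ∧ ∀ (x : 𝔼) (ρ : ℝ), 0 < ρ → ‖x‖ + ρ ≤ 1 / 4 →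
      sqMass u x (ρ * Real.exp (-(1 / 2))) ≤ Real.exp A * sqMass u x (ρ * Real.exp (-1)) by
    obtain ⟨A, hA, H⟩ := H
    refine ⟨A, hA, fun x ρ hρ hx => ?_⟩
    have := H x ρ hρ hx
    rw [sqMass_comp_affine u x hρ (Real.exp_pos _), sqMass_comp_affine u x hρ (Real.exp_pos _),
      mul_left_comm] at this
    exact le_of_mul_le_mul_left this (by positivity)
  have hle1 : ∀ (x : 𝔼) (ρ : ℝ), 0 < ρ → ‖x‖ + ρ ≤ 1 / 4 →
      sqMass u x (ρ * Real.exp (-(1 / 2))) ≤ sqMass u 0 (1 / 4) := by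
    intro x ρ hρ hx
    refine sqMass_mono hu.continuous (by positivity) ?_
    rw [dist_zero_left]
    have := (mul_le_iff_le_one_right hρ).2 exp_neg_half_lt.le
    linarith
  rcases (sqMass_nonneg u 0 (1 / 4)).eq_or_lt with h0 | h0
  · refine ⟨0, le_rfl, fun x ρ hρ hx => ?_⟩
    rw [Real.exp_zero, one_mul]
    exact ((hle1 x ρ hρ hx).trans h0.symm.le).trans (sqMass_nonneg _ _ _)
  · have h01 : sqMass u 0 (1 / 4) ≤ sqMass u 0 1 :=
      sqMass_mono hu.continuous (by norm_num) (by norm_num)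
    set A := Real.log (sqMass u 0 1 / sqMass u 0 (1 / 4)) with hA
    have hA0 : 0 ≤ A := Real.log_nonneg ((one_le_div h0).2 h01)
    have hpq : Real.log (1 / 2) < Real.log (3 / 4) := Real.log_lt_log (by norm_num) (by norm_num)
    refine ⟨(1 / 2) / (Real.log (3 / 4) - Real.log (1 / 2)) * A,
      mul_nonneg (div_nonneg (by norm_num) (by linarith)) hA0, fun x ρ hρ hx => ?_⟩
    have hxn := norm_nonneg x
    have hux : HarmonicIn u x (3 / 4) :=
      hu.mono (ball_subset_ball' (by rw [dist_zero_right]; linarith))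
    have := hux.sqMass_le_of_growth (a := Real.log ρ + -1) (b := Real.log ρ + -(1 / 2))
      (p := Real.log (1 / 2)) (q := Real.log (3 / 4)) (A := A) (by linarith)
      (by
        have : Real.log ρ ≤ Real.log (1 / 2) := Real.log_le_log hρ (by linarith)
        linarith) hpq (by rw [Real.exp_log (by norm_num)]) hA0
      (by
        rw [hA, Real.exp_log (div_pos (h0.trans_le h01) h0),
          Real.exp_log (show (0 : ℝ) < 3 / 4 by norm_num),
          Real.exp_log (show (0 : ℝ) < 1 / 2 by norm_num)]
        calc sqMass u x (3 / 4) ≤ sqMass u 0 1 :=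
              sqMass_mono hu.continuous (by norm_num) (by rw [dist_zero_left]; linarith)
          _ = sqMass u 0 1 / sqMass u 0 (1 / 4) * sqMass u 0 (1 / 4) :=
              (div_mul_cancel₀ _ h0.ne').symm
          _ ≤ _ := mul_le_mul_of_nonneg_left
              (sqMass_mono hu.continuous (by norm_num) (by rw [dist_zero_right]; linarith))
              (div_nonneg (sqMass_nonneg _ _ _) h0.le))
    rw [Real.exp_add, Real.exp_add, Real.exp_log hρ] at this
    convert this using 4
    ring

/-- The nodal set of a harmonic function vanishing at the center of the unit ball has measure
bounded below. -/
lemma exists_nodal_lower_bound (hn : 1 ≤ n) : ∃ c : ℝ, 0 < c ∧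
    ∀ u : 𝔼 → ℝ, HarmonicIn u 0 1 → u 0 = 0 →
      ENNReal.ofReal c ≤ μH[(n : ℝ) - 1] ({x | u x = 0} ∩ ball 0 1) := by
  set β := (volume (ball (0 : 𝔼) 1)).toReal with hβ
  obtain ⟨A, hA, hgrowth⟩ := exists_growth_bound n (M := 2 ^ n * β * 2) (by positivity)
  obtain ⟨c, hc, hlow⟩ := exists_nodal_lower_bound_of_growth (n := n) hn hA
  refine ⟨(1 / 4) ^ (n - 1) * (c / 2), by positivity, fun u hu hu0 => ?_⟩
  set S : Set (𝔼 × ℝ) := {p | 0 < p.2 ∧ ‖p.1‖ + p.2 ≤ 1 / 4 ∧ u p.1 = 0} with hS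
  set v : 𝔼 × ℝ → 𝔼 → ℝ := fun p y => u (p.1 + p.2 • y) with hv
  set F : 𝔼 × ℝ → ENNReal := fun p => μH[(n : ℝ) - 1] ({y | v p y = 0} ∩ ball 0 1) with hF
  have hvh : ∀ p ∈ S, HarmonicIn (v p) 0 1 := by
    rintro ⟨x, ρ⟩ ⟨hρ, hx, -⟩
    refine hu.comp_affine fun y hy => ?_
    rw [mem_ball, dist_zero_right] at hy ⊢
    have h1 := norm_add_le x (ρ • y)
    rw [norm_smul, Real.norm_of_nonneg hρ.le] at h1
    have h2 := (mul_le_iff_le_one_right hρ).2 hy.le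
    simp only at hx
    linarith
  have hv0 : ∀ p ∈ S, v p 0 = 0 := fun p hp => by simpa [hv] using hp.2.2
  have h0S : ((0 : 𝔼), (1 / 4 : ℝ)) ∈ S := ⟨by norm_num, by simp, hu0⟩
  set f := ⨅ p ∈ S, F p with hf
  have hfF : ∀ p ∈ S, f ≤ F p := fun p hp => iInf₂_le p hp
  have hfpos : f ≠ 0 := by
    obtain ⟨A', hA', hgr⟩ := hu.exists_uniform_growth
    obtain ⟨c', hc', hlow'⟩ := exists_nodal_lower_bound_of_growth (n := n) hn hA'
    have : ENNReal.ofReal c' ≤ f := le_iInf₂ fun p hp =>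
      hlow' (v p) (hvh p hp) (hv0 p hp) (hgr p.1 p.2 hp.1 hp.2.1)
    exact ((ENNReal.ofReal_pos.2 hc').trans_le this).ne'
  have hmain : ENNReal.ofReal (c / 2) ≤ F ((0 : 𝔼), (1 / 4 : ℝ)) := by
    refine le_trans ?_ (hfF _ h0S)
    rcases eq_or_ne f ⊤ with hft | hft
    · rw [hft]; exact le_top
    have hlt : f < 2 * f := by
      rw [two_mul]; exact ENNReal.lt_add_right hft hfpos
    obtain ⟨p, hp⟩ := iInf_lt_iff.1 (hf.symm.trans_lt hlt)
    obtain ⟨hpS, hp⟩ := iInf_lt_iff.1 hp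
    set m := f.toReal with hm
    have hm0 : 0 < m := ENNReal.toReal_pos hfpos hft
    have hfm : f = ENNReal.ofReal m := (ENNReal.ofReal_toReal hft).symm
    have hp' : F p ≤ ENNReal.ofReal (2 * m) := by
      rw [ENNReal.ofReal_mul (by norm_num), ← hfm]
      simpa using hp.le
    have hvol : ∀ s, 0 < s → volume (nodalNhd (v p) s) ≤ ENNReal.ofReal (2 ^ n * β * 2 * s) := by
      intro s hs
      refine (volume_nodalNhd_le hn (hvh p hpS).continuous hm0 hp' ?_ hs).trans
        (ENNReal.ofReal_le_ofReal (le_of_eq ?_))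
      · intro y hy t ht hyt
        rw [hausdorffMeasure_nodal_scale hn _ _ ht, mul_comm m,
          ENNReal.ofReal_mul (by positivity), ← hfm]
        refine mul_le_mul_right ?_ _
        have hq : (p.1 + p.2 • y, p.2 * t) ∈ S := by
          refine ⟨mul_pos hpS.1 ht, ?_, hy⟩
          have h1 := norm_add_le p.1 (p.2 • y)
          rw [norm_smul, Real.norm_of_nonneg hpS.1.le] at h1
          have h2 := mul_lt_mul_of_pos_left hyt hpS.1
          have h3 := hpS.2.1
          simp only
          linarith
        refine (hfF _ hq).trans (le_of_eq ?_)
        simp only [hF, hv, smul_add, smul_smul, add_assoc]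
      · rw [← hβ]; field_simp
    have h1 := hlow (v p) (hvh p hpS) (hv0 p hpS) (hgrowth (v p) (hvh p hpS) hvol)
    have h2 : ENNReal.ofReal c ≤ ENNReal.ofReal (2 * m) := h1.trans hp'
    rw [ENNReal.ofReal_le_ofReal_iff (by positivity)] at h2
    rw [hfm]
    exact ENNReal.ofReal_le_ofReal (by linarith)
  have hsub : ball (0 : 𝔼) (1 / 4) ⊆ ball 0 1 := ball_subset_ball (by norm_num)
  refine le_trans ?_ (measure_mono (Set.inter_subset_inter_right _ hsub))
  rw [hausdorffMeasure_nodal_scale hn u 0 (by norm_num : (0 : ℝ) < 1 / 4),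
    ENNReal.ofReal_mul (by positivity)]
  exact mul_le_mul_right hmain _

end NodalLowerBound

section Taylor

open Filter Topology
open scoped ContDiff

variable {n : ℕ}

local notation "𝔼" => EuclideanSpace ℝ (Fin n)

lemma pd_congr {u v : 𝔼 → ℝ} {x : 𝔼} (h : u =ᶠ[𝓝 x] v) (i : Fin n) :
    pd i u =ᶠ[𝓝 x] pd i v := by
  filter_upwards [h.fderiv (𝕜 := ℝ)] with y hy
  simp only [pd, hy]

lemma mderiv_congr {u v : 𝔼 → ℝ} {x : 𝔼} (h : u =ᶠ[𝓝 x] v) (α : Fin n → ℕ) :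
    mderiv α u x = mderiv α v x := by
  suffices H : ∀ l : List (Fin n), l.foldr (fun i w => (pd i)^[α i] w) u
      =ᶠ[𝓝 x] l.foldr (fun i w => (pd i)^[α i] w) v from (H _).eq_of_nhds
  intro l
  induction l with
  | nil => exact h
  | cons i l ih =>
    simp only [List.foldr_cons]
    generalize α i = k
    induction k with
    | zero => exact ih
    | succ k ihk =>
      rw [Function.iterate_succ_apply', Function.iterate_succ_apply']
      exact pd_congr ihk i

lemma contDiff_pd_iterate {u : 𝔼 → ℝ} (hu : ContDiff ℝ ∞ u) (i : Fin n) (k : ℕ) :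
    ContDiff ℝ ∞ ((pd i)^[k] u) := by
  induction k with
  | zero => exact hu
  | succ k ih => rw [Function.iterate_succ_apply']; exact contDiff_pd ih i

lemma pd_pd_iterate {u : 𝔼 → ℝ} (hu : ContDiff ℝ ∞ u) (i j : Fin n) (k : ℕ) :
    pd i ((pd j)^[k] u) = (pd j)^[k] (pd i u) := by
  induction k with
  | zero => rfl
  | succ k ih =>
    rw [Function.iterate_succ_apply', Function.iterate_succ_apply', ← ih]
    exact dirDeriv_comm (contDiff_pd_iterate hu j k) _ _

lemma contDiff_foldr_pd {u : 𝔼 → ℝ} (hu : ContDiff ℝ ∞ u) (α : Fin n → ℕ) (l : List (Fin n)) :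
    ContDiff ℝ ∞ (l.foldr (fun i w => (pd i)^[α i] w) u) := by
  induction l with
  | nil => exact hu
  | cons i l ih => exact contDiff_pd_iterate ih i _

lemma foldr_pd_congr {u : 𝔼 → ℝ} {α β : Fin n → ℕ} {l : List (Fin n)}
    (h : ∀ i ∈ l, α i = β i) :
    l.foldr (fun i w => (pd i)^[α i] w) u = l.foldr (fun i w => (pd i)^[β i] w) u := by
  induction l with
  | nil => rfl
  | cons i l ih =>
    simp only [List.foldr_cons]
    rw [ih fun j hj => h j (List.mem_cons_of_mem _ hj), h i List.mem_cons_self]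

lemma pd_mderiv {u : 𝔼 → ℝ} (hu : ContDiff ℝ ∞ u) (i : Fin n) (α : Fin n → ℕ) :
    pd i (mderiv α u) = mderiv (α + Pi.single i 1) u := by
  suffices H : ∀ l : List (Fin n), l.Nodup → i ∈ l →
      pd i (l.foldr (fun j w => (pd j)^[α j] w) u)
        = l.foldr (fun j w => (pd j)^[(α + Pi.single i 1 : Fin n → ℕ) j] w) u from
    H _ (List.nodup_finRange n) (List.mem_finRange i)
  intro l
  induction l with
  | nil => simp
  | cons j l ih =>
    intro hnd hi
    rw [List.nodup_cons] at hnd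
    simp only [List.foldr_cons]
    by_cases hij : i = j
    · subst hij
      rw [← Function.iterate_succ_apply' (pd i)]
      have h1 : ∀ k ∈ l, α k = (α + Pi.single i 1 : Fin n → ℕ) k := by
        intro k hk
        have : k ≠ i := fun h => hnd.1 (h ▸ hk)
        simp [this]
      rw [foldr_pd_congr h1]
      simp
    · rw [pd_pd_iterate (contDiff_foldr_pd hu α l),
        ih hnd.2 ((List.mem_cons.1 hi).resolve_left hij)]
      have h1 : (α + Pi.single i 1 : Fin n → ℕ) j = α j := by simp [Ne.symm hij]
      rw [h1]

lemma mderiv_zero (u : 𝔼 → ℝ) : mderiv (0 : Fin n → ℕ) u = u := by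
  simp [mderiv]

/-- The coordinate directions named by a word. -/
def wordDir (l : List (Fin n)) : List (EuclideanSpace ℝ (Fin n)) :=
  l.map fun i => EuclideanSpace.single i 1

lemma exists_iterDir_eq_mderiv {u : 𝔼 → ℝ} (hu : ContDiff ℝ ∞ u) (l : List (Fin n)) :
    ∃ α : Fin n → ℕ, ∑ i, α i = l.length ∧ iterDir (wordDir l) u = mderiv α u := by
  induction l with
  | nil => exact ⟨0, by simp, (mderiv_zero u).symm⟩
  | cons i l ih =>
    obtain ⟨α, h1, h2⟩ := ih
    refine ⟨α + Pi.single i 1, ?_, ?_⟩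
    · simp [Finset.sum_add_distrib, h1]
    · rw [← pd_mderiv hu, ← h2]
      rfl

lemma abs_mderiv_le_derivSum {u : 𝔼 → ℝ} {N : ℕ} {α : Fin n → ℕ} (hα : ∑ i, α i ≤ N) (x : 𝔼) :
    |mderiv α u x| ≤ derivSum N u x := by
  have hle : ∀ i, α i < N + 1 := fun i =>
    Nat.lt_succ_of_le ((Finset.single_le_sum (fun j _ => Nat.zero_le (α j))
      (Finset.mem_univ i)).trans hα)
  have hmem : (fun i => (⟨α i, hle i⟩ : Fin (N + 1)))
      ∈ Finset.univ.filter (fun β : Fin n → Fin (N + 1) => ∑ i, (β i : ℕ) ≤ N) :=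
    Finset.mem_filter.2 ⟨Finset.mem_univ _, hα⟩
  exact Finset.single_le_sum (f := fun β : Fin n → Fin (N + 1) => |mderiv (fun i => (β i : ℕ)) u x|)
    (fun _ _ => abs_nonneg _) hmem

lemma abs_iterDir_le_derivSum {u : 𝔼 → ℝ} (hu : ContDiff ℝ ∞ u) {N : ℕ} {l : List (Fin n)}
    (hl : l.length ≤ N) (x : 𝔼) : |iterDir (wordDir l) u x| ≤ derivSum N u x := by
  obtain ⟨α, h1, h2⟩ := exists_iterDir_eq_mderiv hu l
  rw [h2]
  exact abs_mderiv_le_derivSum (h1.trans_le hl) x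

lemma abs_le_of_abs_pd_le {u : 𝔼 → ℝ} (hu : ContDiff ℝ ∞ u) {ρ B : ℝ} (hB : 0 ≤ B)
    (h : ∀ i, ∀ x ∈ closedBall (0 : 𝔼) ρ, |pd i u x| ≤ B) {x : 𝔼} (hx : x ∈ closedBall (0 : 𝔼) ρ) :
    |u x| ≤ |u 0| + n * ρ * B := by
  have hxρ : ‖x‖ ≤ ρ := by simpa using hx
  have hfd : ∀ y ∈ closedBall (0 : 𝔼) ρ, ‖fderiv ℝ u y‖ ≤ n * B := by
    intro y hy
    refine ContinuousLinearMap.opNorm_le_bound _ (by positivity) fun z => ?_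
    have e : fderiv ℝ u y z = ∑ i, z i * pd i u y := dirDeriv_eq_sum u z y
    rw [e, Real.norm_eq_abs]
    refine (Finset.abs_sum_le_sum_abs _ _).trans ?_
    calc ∑ i, |z i * pd i u y| ≤ ∑ _i : Fin n, ‖z‖ * B := by
          refine Finset.sum_le_sum fun i _ => ?_
          rw [abs_mul]
          exact mul_le_mul (PiLp.norm_apply_le z i) (h i y hy) (abs_nonneg _) (norm_nonneg _)
      _ = n * B * ‖z‖ := by
          rw [Finset.sum_const, Finset.card_univ, Fintype.card_fin, nsmul_eq_mul]; ring
  have h1 := (convex_closedBall (0 : 𝔼) ρ).norm_image_sub_le_of_norm_fderiv_le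
    (fun y _ => (hu.differentiable (by simp)).differentiableAt) hfd
    (mem_closedBall_self ((norm_nonneg x).trans hxρ)) hx
  rw [sub_zero, Real.norm_eq_abs] at h1
  have h2 : n * B * ‖x‖ ≤ n * B * ρ := mul_le_mul_of_nonneg_left hxρ (by positivity)
  have h3 := abs_sub_abs_le_abs_sub (u x) (u 0)
  linarith

lemma abs_le_of_abs_iterDir_le {ρ D S : ℝ} (hρ : 0 ≤ ρ) (hnρ : n * ρ ≤ 1) (hD : 0 ≤ D) (hS : 0 ≤ S)
    (M : ℕ) {u : 𝔼 → ℝ} (hu : ContDiff ℝ ∞ u)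
    (h0 : ∀ l : List (Fin n), l.length < M → |iterDir (wordDir l) u 0| ≤ D)
    (hM : ∀ l : List (Fin n), l.length = M → ∀ x ∈ closedBall (0 : 𝔼) ρ,
      |iterDir (wordDir l) u x| ≤ S) {x : 𝔼} (hx : x ∈ closedBall (0 : 𝔼) ρ) :
    |u x| ≤ M * D + (n * ρ) ^ M * S := by
  induction M generalizing u x with
  | zero => simpa [wordDir, iterDir] using hM [] rfl x hx
  | succ M ih =>
    have happ : ∀ (l : List (Fin n)) (i : Fin n),
        iterDir (wordDir l) (pd i u) = iterDir (wordDir (l ++ [i])) u := by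
      intro l i
      simp [wordDir, iterDir, pd_eq_dirDeriv]
    have hpd : ∀ i, ∀ y ∈ closedBall (0 : 𝔼) ρ, |pd i u y| ≤ M * D + (n * ρ) ^ M * S := by
      intro i y hy
      refine ih (contDiff_pd hu i) (fun l hl => ?_) (fun l hl z hz => ?_) hy
      · rw [happ]; exact h0 _ (by simp; omega)
      · rw [happ]; exact hM _ (by simp; omega) z hz
    have h1 := abs_le_of_abs_pd_le hu (by positivity) hpd hx
    have h2 : |u 0| ≤ D := h0 [] (Nat.succ_pos M)
    have h3 : n * ρ * (M * D) ≤ M * D := mul_le_of_le_one_left (by positivity) hnρ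
    rw [pow_succ]
    push_cast
    linarith

end Taylor

section Cutoff

open Filter Topology
open scoped ContDiff

variable {n : ℕ}

local notation "𝔼" => EuclideanSpace ℝ (Fin n)

lemma exists_growth_bound_of_nodal_le (hn : 1 ≤ n) {T : ℝ} (hT : 0 ≤ T) :
    ∃ A : ℝ, 0 ≤ A ∧ ∀ u : 𝔼 → ℝ, HarmonicIn u 0 1 →
      μH[(n : ℝ) - 1] ({x | u x = 0} ∩ ball (0 : 𝔼) 1) ≤ ENNReal.ofReal T →
      sqMass u 0 (Real.exp (-(1 / 2))) ≤ Real.exp A * sqMass u 0 (Real.exp (-1)) := by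
  obtain ⟨c, hc, hlow⟩ := exists_nodal_lower_bound (n := n) hn
  obtain ⟨A, hA, hgr⟩ := exists_growth_bound n
    (M := 2 ^ n * (volume (ball (0 : 𝔼) 1)).toReal * T / c) (by positivity)
  refine ⟨A, hA, fun u hu huT => hgr u hu fun s hs =>
    volume_nodalNhd_le hn hu.continuous hc huT (fun y hy t ht hyt => ?_) hs⟩
  rw [hausdorffMeasure_nodal_scale hn _ _ ht, mul_comm c, ENNReal.ofReal_mul (by positivity)]
  refine mul_le_mul_right (hlow _ (hu.comp_affine fun z hz => ?_) (by simpa using hy)) _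
  rw [mem_ball, dist_zero_right] at hz ⊢
  have h1 := norm_add_le y (t • z)
  rw [norm_smul, Real.norm_of_nonneg ht.le] at h1
  have h2 := (mul_le_iff_le_one_right ht).2 hz.le
  linarith

lemma exists_smooth_extension {u : 𝔼 → ℝ} (hu : ContDiffOn ℝ ∞ u (closedBall (0 : 𝔼) 1)) :
    ∃ v : 𝔼 → ℝ, ContDiff ℝ ∞ v ∧ Set.EqOn v u (closedBall (0 : 𝔼) (99 / 100)) := by
  let χ : ContDiffBump (0 : 𝔼) := ⟨99 / 100, 199 / 200, by norm_num, by norm_num⟩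
  refine ⟨fun x => χ x * u x, contDiff_iff_contDiffAt.2 fun x => ?_, fun x hx => ?_⟩
  · rcases lt_or_ge ‖x‖ 1 with h | h
    · refine χ.contDiffAt.mul (hu.contDiffAt ?_)
      exact closedBall_mem_nhds_of_mem (by simpa using h)
    · refine (contDiffAt_const (c := (0 : ℝ))).congr_of_eventuallyEq ?_
      have : {y : 𝔼 | 199 / 200 < ‖y‖} ∈ 𝓝 x :=
        (isOpen_lt continuous_const continuous_norm).mem_nhds
          (show (199 / 200 : ℝ) < ‖x‖ by linarith)
      filter_upwards [this] with y hy
      rw [χ.zero_of_le_dist (by rw [dist_zero_right]; exact le_of_lt hy), zero_mul]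
  · change χ x * u x = u x
    rw [χ.one_of_mem_closedBall hx, one_mul]

lemma exists_harmonic_extension {u : 𝔼 → ℝ} (hu : ContDiffOn ℝ ∞ u (closedBall (0 : 𝔼) 1))
    (hlap : ∀ x ∈ closedBall (0 : 𝔼) 1, ∑ i, pd i (pd i u) x = 0) :
    ∃ v : 𝔼 → ℝ, HarmonicIn v 0 (99 / 100) ∧ Set.EqOn v u (ball (0 : 𝔼) (99 / 100)) := by
  obtain ⟨v, hv, heq⟩ := exists_smooth_extension hu
  refine ⟨v, ⟨hv, fun x hx => ?_⟩, heq.mono ball_subset_closedBall⟩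
  have h1 : v =ᶠ[𝓝 x] u := by
    filter_upwards [isOpen_ball.mem_nhds hx] with y hy using heq (ball_subset_closedBall hy)
  rw [← hlap x (closedBall_subset_closedBall (by norm_num) (ball_subset_closedBall hx))]
  exact Finset.sum_congr rfl fun i _ => (pd_congr (pd_congr h1 i) i).eq_of_nhds

/-- A growth bound controls the values near the center by those in a small ball. -/
lemma HarmonicIn.sq_le_of_growth {u : 𝔼 → ℝ} {A s X : ℝ} (hu : HarmonicIn u 0 (99 / 100))
    (hA : 0 ≤ A) (hs : 4 ≤ s)
    (hgr : sqMass u 0 (99 / 100 * Real.exp (-(1 / 2)))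
      ≤ Real.exp A * sqMass u 0 (99 / 100 * Real.exp (-1)))
    (hX : ∀ x ∈ closedBall (0 : 𝔼) (Real.exp (-s)), |u x| ≤ X) {x : 𝔼}
    (hx : x ∈ closedBall (0 : 𝔼) (1 / 2)) :
    u x ^ 2 ≤ 20 ^ (n + 2) * Real.exp (A + 2 * s * A) * X ^ 2 := by
  have hθ : (0 : ℝ) < 99 / 100 := by norm_num
  set l := Real.log (99 / 100) with hl
  have hl0 : l ≤ 0 := Real.log_nonpos hθ.le (by norm_num)
  have hl1 : -1 ≤ l := by
    rw [hl, Real.le_log_iff_exp_le hθ]; linarith [exp_neg_one_lt]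
  have he : ∀ t, 99 / 100 * Real.exp t = Real.exp (l + t) := fun t => by
    rw [Real.exp_add, hl, Real.exp_log hθ]
  rw [he, he] at hgr
  have h1 := hu.sqMass_le_of_growth (a := -s) (b := l + -1) (p := l + -1) (q := l + -(1 / 2))
    (A := A) (by linarith) le_rfl (by linarith)
    (by rw [← he]; linarith [exp_neg_half_lt]) hA hgr
  have h2 : Real.exp ((l + -1 - -s) / (l + -(1 / 2) - (l + -1)) * A) ≤ Real.exp (2 * s * A) := by
    refine Real.exp_le_exp.2 (mul_le_mul_of_nonneg_right ?_ hA)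
    rw [show l + -(1 / 2) - (l + -1) = 1 / 2 by ring]
    linarith
  have hW := weightMass_pos (n := n)
  have h3 : sqMass u 0 (Real.exp (-s)) ≤ X ^ 2 * weightMass n := by
    refine (sqMass_le hu.continuous (Real.exp_pos _)
      fun z hz => hX z (ball_subset_closedBall hz)).trans ?_
    refine mul_le_mul_of_nonneg_left (mul_le_of_le_one_right hW.le ?_) (sq_nonneg _)
    exact pow_le_one₀ (Real.exp_pos _).le (Real.exp_le_one_iff.2 (by linarith))
  have hx' : ‖x‖ ≤ 1 / 2 := by simpa using hx
  have h4 : u x ^ 2 * (weightMass n * (1 / 20) ^ (n + 2))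
      ≤ sqMass u 0 (Real.exp (l + -(1 / 2))) := by
    refine ((hu.mono (ball_subset_ball' ?_)).sq_le_sqMass (by norm_num)).trans
      (sqMass_mono hu.continuous (by norm_num) ?_)
    · rw [dist_zero_right]; linarith
    · rw [← he, dist_zero_left]; linarith [exp_neg_half_gt]
  have h5 : u x ^ 2 * (weightMass n * (1 / 20) ^ (n + 2))
      ≤ Real.exp A * (Real.exp (2 * s * A) * (X ^ 2 * weightMass n)) := by
    refine (h4.trans hgr).trans (mul_le_mul_of_nonneg_left (h1.trans ?_) (Real.exp_pos _).le)
    exact mul_le_mul h2 h3 (sqMass_nonneg _ _ _) (Real.exp_pos _).le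
  have h6 : (20 : ℝ) ^ (n + 2) * (1 / 20) ^ (n + 2) = 1 := by rw [← mul_pow]; norm_num
  refine le_of_mul_le_mul_right ?_ hW
  calc u x ^ 2 * weightMass n
      = 20 ^ (n + 2) * (u x ^ 2 * (weightMass n * (1 / 20) ^ (n + 2))) := by
        linear_combination -(u x ^ 2 * weightMass n) * h6
    _ ≤ 20 ^ (n + 2) * (Real.exp A * (Real.exp (2 * s * A) * (X ^ 2 * weightMass n))) :=
        mul_le_mul_of_nonneg_left h5 (by positivity)
    _ = _ := by rw [Real.exp_add]; ring

lemma HarmonicIn.abs_le_derivSum_of_growth {u : 𝔼 → ℝ} {A s H : ℝ} {M : ℕ}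
    (hu : HarmonicIn u 0 (99 / 100)) (hA : 0 ≤ A) (hM : 1 ≤ M) (hAM : A + 1 ≤ M)
    (hs4 : 4 ≤ s) (hsn : n ≤ s)
    (hs : 2 * (20 ^ (n + 2) * Real.exp A * (n * (2 ^ (n + 4) * (4 * M))) ^ M) ≤ s)
    (hgr : sqMass u 0 (99 / 100 * Real.exp (-(1 / 2)))
      ≤ Real.exp A * sqMass u 0 (99 / 100 * Real.exp (-1)))
    (hH : ∀ x ∈ closedBall (0 : 𝔼) (1 / 2), |u x| ≤ H)
    (hH' : ∃ x ∈ closedBall (0 : 𝔼) (1 / 2), |u x| = H) :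
    H ≤ 2 * (20 ^ (n + 2) * Real.exp (A + s * A) * M) * derivSum M u 0 := by
  obtain ⟨a, ha, haH⟩ := hH'
  have hH0 : 0 ≤ H := haH ▸ abs_nonneg _
  have hM0 : (0 : ℝ) < M := by exact_mod_cast hM
  set ρ := Real.exp (-s) with hρ
  have hρ0 : 0 < ρ := Real.exp_pos _
  have hρs : ρ * s ≤ 1 := by
    have h1 : s ≤ Real.exp s := by linarith [Real.add_one_le_exp s]
    calc ρ * s ≤ ρ * Real.exp s := mul_le_mul_of_nonneg_left h1 hρ0.le
      _ = 1 := by rw [hρ, ← Real.exp_add]; simp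
  have hρ4 : ρ ≤ 1 / 4 := by
    have := mul_le_mul_of_nonneg_left hs4 hρ0.le
    linarith
  have hnρ : n * ρ ≤ 1 := by
    have := mul_le_mul_of_nonneg_left hsn hρ0.le
    linarith
  set D := derivSum M u 0 with hD
  have hD0 : 0 ≤ D := Finset.sum_nonneg fun _ _ => abs_nonneg _
  set c := (2 : ℝ) ^ (n + 4) * (4 * M) with hc
  have hc0 : 0 < c := by positivity
  set X := M * D + (n * ρ) ^ M * (c ^ M * H) with hX
  have hXu : ∀ x ∈ closedBall (0 : 𝔼) ρ, |u x| ≤ X := by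
    intro x hx
    refine abs_le_of_abs_iterDir_le hρ0.le hnρ hD0 (by positivity) M hu.smooth
      (fun l hl => abs_iterDir_le_derivSum hu.smooth hl.le 0) (fun l hl y hy => ?_) hx
    have hu' : HarmonicIn u 0 (1 / 2) := hu.mono (ball_subset_ball (by norm_num))
    have hlen : (wordDir l).length = M := by simp [wordDir, hl]
    have hy' : dist y 0 ≤ ρ := hy
    have := hu'.abs_iterDir_le (h := 1 / (4 * M)) (b := 1) (by positivity) hH (wordDir l)
      (by simp [wordDir]) (y := y)
      (by
        rw [hlen]
        have : (M : ℝ) * (1 / (4 * M)) = 1 / 4 := by field_simp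
        linarith)
    rw [hlen] at this
    refine this.trans (le_of_eq ?_)
    rw [hc, mul_one, div_div_eq_mul_div, div_one]
  have hX0 : 0 ≤ X := by positivity
  set B := (20 : ℝ) ^ (n + 2) * Real.exp (A + s * A) with hB
  have hB0 : 0 < B := by positivity
  have hHX : H ≤ B * X := by
    have h1 := hu.sq_le_of_growth hA hs4 hgr hXu ha
    refine (pow_le_pow_iff_left₀ hH0 (by positivity) two_ne_zero).1 ?_
    rw [← haH, sq_abs]
    refine h1.trans ?_
    rw [mul_pow, hB]
    refine mul_le_mul_of_nonneg_right ?_ (sq_nonneg _)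
    rw [mul_pow, ← Real.exp_nat_mul]
    refine mul_le_mul ?_ (Real.exp_le_exp.2 ?_) (Real.exp_pos _).le (by positivity)
    · exact le_self_pow₀ (one_le_pow₀ (by norm_num)) two_ne_zero
    · push_cast
      linarith
  have habs : B * ((n * ρ) ^ M * c ^ M) ≤ 1 / 2 := by
    have h1 : Real.exp (s * A) * ρ ^ M ≤ ρ := by
      rw [hρ, ← Real.exp_nat_mul, ← Real.exp_add]
      refine Real.exp_le_exp.2 ?_
      have := mul_le_mul_of_nonneg_left hAM (show 0 ≤ s by linarith)
      linarith
    have h2 : 0 ≤ 20 ^ (n + 2) * Real.exp A * (n * c) ^ M := by positivity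
    calc B * ((n * ρ) ^ M * c ^ M)
        = 20 ^ (n + 2) * Real.exp A * (n * c) ^ M * (Real.exp (s * A) * ρ ^ M) := by
          rw [hB, Real.exp_add, mul_pow (n : ℝ) ρ, mul_pow (n : ℝ) c]; ring
      _ ≤ 20 ^ (n + 2) * Real.exp A * (n * c) ^ M * ρ := mul_le_mul_of_nonneg_left h1 h2
      _ ≤ s / 2 * ρ := mul_le_mul_of_nonneg_right (by linarith) hρ0.le
      _ ≤ 1 / 2 := by linarith
  have h7 := mul_le_mul_of_nonneg_right habs hH0
  have h8 : B * X = B * M * D + B * ((n * ρ) ^ M * c ^ M) * H := by rw [hX]; ring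
  rw [h8] at hHX
  linarith

/-- Nodal volume bounds control the values near the center by the derivatives there. -/
lemma exists_abs_le_derivSum (hn : 1 ≤ n) {K : ℝ} (hK : 0 ≤ K) : ∃ (C : ℝ) (N : ℕ), 0 < C ∧
    ∀ u : 𝔼 → ℝ, HarmonicIn u 0 (99 / 100) →
      μH[(n : ℝ) - 1] ({x | u x = 0} ∩ ball (0 : 𝔼) (99 / 100)) ≤ ENNReal.ofReal K →
      ∀ x ∈ closedBall (0 : 𝔼) (1 / 2), |u x| ≤ C * derivSum N u 0 := by
  have hθ : (0 : ℝ) < 99 / 100 := by norm_num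
  have hθn : (0 : ℝ) < (99 / 100) ^ (n - 1) := by positivity
  obtain ⟨A, hA, hgr⟩ := exists_growth_bound_of_nodal_le (n := n) hn
    (T := K / (99 / 100) ^ (n - 1)) (by positivity)
  set M := ⌈A⌉₊ + 1 with hM
  have hAM : A + 1 ≤ (M : ℝ) := by
    rw [hM]; push_cast; linarith [Nat.le_ceil A]
  set L := 2 * (20 ^ (n + 2) * Real.exp A * (n * (2 ^ (n + 4) * (4 * M))) ^ M) with hL
  have hL0 : 0 ≤ L := by positivity
  set s := L + n + 4 with hs
  have hn0 : (0 : ℝ) ≤ n := Nat.cast_nonneg n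
  refine ⟨2 * (20 ^ (n + 2) * Real.exp (A + s * A) * M), M, by positivity, fun u hu huK => ?_⟩
  obtain ⟨a, ha, hmax⟩ := (isCompact_closedBall (0 : 𝔼) (1 / 2)).exists_isMaxOn
    ⟨0, mem_closedBall_self (by norm_num)⟩ hu.continuous.abs.continuousOn
  have hgr' : sqMass u 0 (99 / 100 * Real.exp (-(1 / 2)))
      ≤ Real.exp A * sqMass u 0 (99 / 100 * Real.exp (-1)) := by
    rw [sqMass_comp_affine u 0 hθ (Real.exp_pos _), sqMass_comp_affine u 0 hθ (Real.exp_pos _),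
      mul_left_comm]
    refine mul_le_mul_of_nonneg_left (hgr _ (hu.comp_affine fun y hy => ?_) ?_) (by positivity)
    · rw [mem_ball, dist_zero_right] at hy ⊢
      rw [zero_add, norm_smul, Real.norm_of_nonneg hθ.le]
      exact (mul_lt_iff_lt_one_right hθ).2 hy
    · rw [hausdorffMeasure_nodal_scale hn u 0 hθ, mul_comm,
        ← ENNReal.le_div_iff_mul_le (Or.inl (by simp)) (Or.inl ENNReal.ofReal_ne_top),
        ← ENNReal.ofReal_div_of_pos hθn] at huK
      exact huK
  intro x hx
  exact (hmax hx).trans (hu.abs_le_derivSum_of_growth hA (by omega) hAM (by linarith)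
    (by linarith) (by linarith) hgr' (fun y hy => hmax hy) ⟨a, ha, rfl⟩)

end Cutoff

/-- Nadirashvili's conjecture (Conjecture 1.3 of the paper): a harmonic function in the
unit ball with nodal volume at most `K` is controlled on `B(0,1/2)` by finitely many
derivatives at the center. -/
theorem stmt_1 (n : ℕ) (hn : 2 ≤ n) :
    ∀ K : ℝ, 0 < K → ∃ (C : ℝ) (N : ℕ), 0 < C ∧
      ∀ u : EuclideanSpace ℝ (Fin n) → ℝ,
        ContDiffOn ℝ (⊤ : ℕ∞) u (closedBall (0 : EuclideanSpace ℝ (Fin n)) 1) →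
        (∀ x ∈ closedBall (0 : EuclideanSpace ℝ (Fin n)) 1, ∑ i, pd i (pd i u) x = 0) →
        μH[(n : ℝ) - 1] ({x | u x = 0} ∩ closedBall (0 : EuclideanSpace ℝ (Fin n)) 1)
          ≤ ENNReal.ofReal K →
        supBall u 0 (1 / 2) ≤ C * derivSum N u 0 := by
  intro K hK
  obtain ⟨C, N, hC, H⟩ := exists_abs_le_derivSum (n := n) (by omega) hK.le
  refine ⟨C, N, hC, fun u hu hlap huK => ?_⟩
  obtain ⟨v, hv, heq⟩ := exists_harmonic_extension hu hlap
  have hd : derivSum N v 0 = derivSum N u 0 := by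
    refine Finset.sum_congr rfl fun α _ => ?_
    rw [mderiv_congr (Filter.eventuallyEq_of_mem (ball_mem_nhds 0 (by norm_num)) heq)]
  have hZ : {x | v x = 0} ∩ ball 0 (99 / 100) ⊆ {x | u x = 0} ∩ closedBall 0 1 := by
    rintro x ⟨h1, h2⟩
    exact ⟨(heq h2).symm.trans h1, closedBall_subset_closedBall (by norm_num)
      (ball_subset_closedBall h2)⟩
  have : Nonempty (closedBall (0 : EuclideanSpace ℝ (Fin n)) (1 / 2)) :=
    ⟨⟨0, mem_closedBall_self (by norm_num)⟩⟩
  refine ciSup_le fun x => ?_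
  rw [← hd, ← heq (closedBall_subset_ball (by norm_num) x.2)]
  exact H v hv ((measure_mono hZ).trans huK) x x.2
end
end

section
/- Let u be a function of class C¹ on the closed unit ball B(0,1) ⊂ ℝⁿ, and let v be continuous on the closed ball B(0,1), harmonic in its interior, with ∇v square-integrable on B(0,1), and v = u on ∂B(0,1). Then ∫_{B(0,1)} |∇v|² dx ≤ ∫_{B(0,1)} |∇u|² dx. -/
open MeasureTheory Metric

noncomputable section

/-- A `C¹` function on an open set vanishing off a compact subset has directional derivatives
of integral zero. -/
theorem setIntegral_fderiv_apply_eq_zero {E : Type*} [NormedAddCommGroup E] [NormedSpace ℝ E]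
    [FiniteDimensional ℝ E] [MeasurableSpace E] [BorelSpace E] (μ : Measure E)
    [μ.IsAddHaarMeasure] {U K : Set E} {f : E → ℝ} (hU : IsOpen U) (hK : IsCompact K)
    (hKU : K ⊆ U) (hf : ContDiffOn ℝ 1 f U) (hfK : ∀ x ∈ U, x ∉ K → f x = 0) (e : E) :
    IntegrableOn (fun x => fderiv ℝ f x e) U μ ∧ ∫ x in U, fderiv ℝ f x e ∂μ = 0 := by
  set F : E → ℝ := U.indicator f with hF
  have hFK : ∀ x, x ∉ K → F x = 0 := by
    intro x hx
    by_cases hxU : x ∈ U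
    · rw [hF, Set.indicator_of_mem hxU, hfK x hxU hx]
    · exact Set.indicator_of_notMem hxU f
  have hFU : ∀ x ∈ U, F =ᶠ[nhds x] f := fun x hx => by
    filter_upwards [hU.mem_nhds hx] with y hy using Set.indicator_of_mem hy f
  have hF0 : ∀ x, x ∉ K → F =ᶠ[nhds x] fun _ => 0 := fun x hx => by
    filter_upwards [hK.isClosed.isOpen_compl.mem_nhds hx] with y hy using hFK y hy
  have hFc : ContDiff ℝ 1 F := by
    rw [contDiff_iff_contDiffAt]
    intro x
    by_cases hx : x ∈ U
    · exact (hf.contDiffAt (hU.mem_nhds hx)).congr_of_eventuallyEq (hFU x hx)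
    · exact contDiffAt_const.congr_of_eventuallyEq (hF0 x fun h => hx (hKU h))
  have hFs : HasCompactSupport F := HasCompactSupport.intro hK hFK
  have hFi : Integrable F μ := hFc.continuous.integrable_of_hasCompactSupport hFs
  have hc : Continuous fun x => fderiv ℝ F x e :=
    (hFc.continuous_fderiv one_ne_zero).clm_apply continuous_const
  have hF'i : Integrable (fun x => fderiv ℝ F x e) μ :=
    hc.integrable_of_hasCompactSupport (hFs.fderiv_apply (𝕜 := ℝ) e)
  have hzero : ∫ x, fderiv ℝ F x e ∂μ = 0 := by
    have := integral_mul_fderiv_eq_neg_fderiv_mul_of_integrable (μ := μ) (𝕜 := ℝ)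
      (f := fun _ : E => (1 : ℝ)) (g := F) (v := e) (by simp) (by simpa using hF'i)
      (by simpa using hFi) (fun x _ => differentiableAt_const _)
      (fun x _ => hFc.differentiable one_ne_zero x)
    simpa using this
  have hind : U.indicator (fun x => fderiv ℝ f x e) = fun x => fderiv ℝ F x e := by
    ext x
    by_cases hx : x ∈ U
    · rw [Set.indicator_of_mem hx, (hFU x hx).fderiv_eq]
    · rw [Set.indicator_of_notMem hx, (hF0 x fun h => hx (hKU h)).fderiv_eq]
      simp
  refine ⟨?_, ?_⟩
  · rw [← integrable_indicator_iff hU.measurableSet, hind]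
    exact hF'i
  · rw [← integral_indicator hU.measurableSet, hind, hzero]

/-- The derivative of a function vanishes almost everywhere on any measurable set where the
function vanishes. -/
theorem ae_restrict_fderiv_eq_zero {E : Type*} [NormedAddCommGroup E] [NormedSpace ℝ E]
    [FiniteDimensional ℝ E] [MeasurableSpace E] [BorelSpace E] (μ : Measure E)
    [μ.IsAddHaarMeasure] {s : Set E} {w : E → ℝ} (hs : MeasurableSet s)
    (hw : ∀ x ∈ s, DifferentiableAt ℝ w x) (h0 : ∀ x ∈ s, w x = 0) :
    ∀ᵐ x ∂μ.restrict s, fderiv ℝ w x = 0 := by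
  rcases subsingleton_or_nontrivial E with hE | hE
  · exact Filter.Eventually.of_forall fun x => Subsingleton.elim _ _
  obtain ⟨e, he⟩ := exists_ne (0 : E)
  have happ : ApproximatesLinearOn (fun x => w x • e) (0 : E →L[ℝ] E) s 0 := by
    intro x hx y hy
    simp [h0 x hx, h0 y hy]
  have := happ.norm_fderiv_sub_le μ hs (fun x => (fderiv ℝ w x).smulRight e)
    (fun x hx => ((hw x hx).hasFDerivAt.smul_const e).hasFDerivWithinAt)
  filter_upwards [this] with x hx
  simpa [he] using hx

/-- The derivative of `softTrunc k`: a continuous function with values in `[0, 1]`, vanishing where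
`k |t| ≤ 1` and equal to `1` where `k |t| ≥ 2`. -/
def softCutoff (k : ℕ) (t : ℝ) : ℝ := min 1 (max 0 (k * |t| - 1))

/-- A `C¹` approximation of the identity of `ℝ` vanishing near `0`. -/
def softTrunc (k : ℕ) (t : ℝ) : ℝ := ∫ s in (0 : ℝ)..t, softCutoff k s

theorem continuous_softCutoff (k : ℕ) : Continuous (softCutoff k) := by
  unfold softCutoff
  fun_prop

theorem softCutoff_nonneg (k : ℕ) (t : ℝ) : 0 ≤ softCutoff k t :=
  le_min zero_le_one (le_max_left _ _)

theorem softCutoff_le_one (k : ℕ) (t : ℝ) : softCutoff k t ≤ 1 := min_le_left _ _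

theorem tendsto_softCutoff {t : ℝ} (ht : t ≠ 0) :
    Filter.Tendsto (fun k => softCutoff k t) Filter.atTop (nhds 1) := by
  refine tendsto_const_nhds.congr' ?_
  obtain ⟨N, hN⟩ := exists_nat_ge (2 / |t|)
  filter_upwards [Filter.eventually_ge_atTop N] with k hk
  have htp : 0 < |t| := abs_pos.mpr ht
  have h2 : 2 ≤ k * |t| := by
    rw [← div_le_iff₀ htp]
    exact hN.trans (by exact_mod_cast hk)
  exact (min_eq_left (le_max_of_le_right (by linarith))).symm

theorem softTrunc_eq_zero {k : ℕ} {t : ℝ} (ht : k * |t| ≤ 1) : softTrunc k t = 0 := by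
  refine intervalIntegral.integral_zero_ae (Filter.Eventually.of_forall fun s hs => ?_)
  have hst : |s| ≤ |t| := by
    have := Set.abs_sub_left_of_mem_uIcc (Set.uIoc_subset_uIcc hs)
    simpa using this
  have : k * |s| ≤ k * |t| := by gcongr
  rw [softCutoff, max_eq_left (by linarith), min_eq_right zero_le_one]

theorem hasDerivAt_softTrunc (k : ℕ) (t : ℝ) : HasDerivAt (softTrunc k) (softCutoff k t) t :=
  (continuous_softCutoff k).integral_hasStrictDerivAt 0 t |>.hasDerivAt

theorem contDiff_softTrunc (k : ℕ) : ContDiff ℝ 1 (softTrunc k) := by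
  rw [contDiff_one_iff_deriv]
  refine ⟨fun t => (hasDerivAt_softTrunc k t).differentiableAt, ?_⟩
  rw [funext fun t => (hasDerivAt_softTrunc k t).deriv]
  exact continuous_softCutoff k

theorem contDiffOn_pd {n : ℕ} {U : Set (EuclideanSpace ℝ (Fin n))} (hU : IsOpen U)
    {m k : WithTop ℕ∞} {f : EuclideanSpace ℝ (Fin n) → ℝ} (hf : ContDiffOn ℝ k f U)
    (hmk : m + 1 ≤ k) (i : Fin n) : ContDiffOn ℝ m (pd i f) U :=
  (hf.fderiv_of_isOpen hU hmk).clm_apply contDiffOn_const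

/-- A harmonic function on a bounded open set is orthogonal in the Dirichlet inner product to
soft truncations of functions vanishing on the boundary. -/
theorem setIntegral_softCutoff_mul_sum_pd_eq_zero {n : ℕ}
    {U : Set (EuclideanSpace ℝ (Fin n))} (hU : IsOpen U) (hUb : Bornology.IsBounded U)
    {v w : EuclideanSpace ℝ (Fin n) → ℝ} (hv : ContDiffOn ℝ 2 v U)
    (hharm : ∀ x ∈ U, ∑ i, pd i (pd i v) x = 0) (hw : ContDiffOn ℝ 1 w U)
    (hwc : ContinuousOn w (closure U)) (hw0 : ∀ x ∈ frontier U, w x = 0) (k : ℕ) :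
    ∫ x in U, softCutoff k (w x) * ∑ i, pd i v x * pd i w x = 0 := by
  set K : Set (EuclideanSpace ℝ (Fin n)) := closure U ∩ {x | 1 ≤ k * |w x|} with hKdef
  have hKc : IsCompact K := by
    refine hUb.isCompact_closure.of_isClosed_subset ?_ Set.inter_subset_left
    exact (continuousOn_const.mul hwc.abs).preimage_isClosed_of_isClosed isClosed_closure
      (isClosed_Ici (a := (1 : ℝ)))
  have hKU : K ⊆ U := by
    rintro x ⟨hx, hx1⟩
    by_contra hxU
    have : w x = 0 := hw0 x (by rw [hU.frontier_eq]; exact ⟨hx, hxU⟩)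
    simp only [Set.mem_ofPred_eq, this] at hx1
    norm_num at hx1
  have hpd := fun i => contDiffOn_pd hU hv (m := 1) (by norm_num) i
  have key := fun i : Fin n => setIntegral_fderiv_apply_eq_zero volume hU hKc hKU
    (f := fun x => pd i v x * softTrunc k (w x))
    ((hpd i).mul ((contDiff_softTrunc k).comp_contDiffOn hw))
    (fun x hx hxK => by
      have : k * |w x| ≤ 1 := by
        by_contra! h
        exact hxK ⟨subset_closure hx, h.le⟩
      simp [softTrunc_eq_zero this])
    (EuclideanSpace.single i 1)
  have hsum := integral_finsetSum (Finset.univ : Finset (Fin n)) fun i _ => (key i).1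
  rw [Finset.sum_eq_zero fun i _ => (key i).2] at hsum
  rw [← hsum]
  refine setIntegral_congr_fun hU.measurableSet fun x hx => ?_
  have hd : ∀ i : Fin n, fderiv ℝ (fun x => pd i v x * softTrunc k (w x)) x
      (EuclideanSpace.single i 1) =
      softTrunc k (w x) * pd i (pd i v) x + softCutoff k (w x) * (pd i v x * pd i w x) := by
    intro i
    have h1 := (((hpd i).contDiffAt (hU.mem_nhds hx)).differentiableAt one_ne_zero).hasFDerivAt
    have h2 := ((hw.contDiffAt (hU.mem_nhds hx)).differentiableAt one_ne_zero).hasFDerivAt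
    have h3 := (hasDerivAt_softTrunc k (w x)).comp_hasFDerivAt x h2
    have h4 := (h1.mul h3).fderiv
    simp only [Function.comp_apply] at h4
    change fderiv ℝ (pd i v * softTrunc k ∘ w) x _ = _
    rw [h4]
    simp only [pd, add_apply, smul_apply, smul_eq_mul]
    ring
  simp only [hd, Finset.sum_add_distrib, ← Finset.mul_sum, hharm x hx, mul_zero, zero_add]

/-- A harmonic function on a bounded open set is orthogonal in the Dirichlet inner product to
functions vanishing on the boundary. -/
theorem setIntegral_sum_pd_mul_pd_eq_zero {n : ℕ}
    {U : Set (EuclideanSpace ℝ (Fin n))} (hU : IsOpen U) (hUb : Bornology.IsBounded U)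
    {v w : EuclideanSpace ℝ (Fin n) → ℝ} (hv : ContDiffOn ℝ 2 v U)
    (hharm : ∀ x ∈ U, ∑ i, pd i (pd i v) x = 0) (hw : ContDiffOn ℝ 1 w U)
    (hwc : ContinuousOn w (closure U)) (hw0 : ∀ x ∈ frontier U, w x = 0)
    (hint : IntegrableOn (fun x => ∑ i, pd i v x * pd i w x) U) :
    ∫ x in U, ∑ i, pd i v x * pd i w x = 0 := by
  have hZ : MeasurableSet (U ∩ {x | w x = 0}) := by
    have hc := hwc.preimage_isClosed_of_isClosed isClosed_closure (isClosed_singleton (x := (0 : ℝ)))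
    have : U ∩ {x | w x = 0} = U ∩ (closure U ∩ w ⁻¹' {0}) := by
      ext x
      simp only [Set.mem_inter_iff, Set.mem_ofPred_eq, Set.mem_preimage, Set.mem_singleton_iff]
      exact ⟨fun h => ⟨h.1, subset_closure h.1, h.2⟩, fun h => ⟨h.1, h.2.2⟩⟩
    rw [this]
    exact hU.measurableSet.inter hc.measurableSet
  have hae := ae_restrict_fderiv_eq_zero volume hZ
    (fun x hx => (hw.contDiffAt (hU.mem_nhds hx.1)).differentiableAt one_ne_zero)
    (fun x hx => hx.2)
  rw [ae_restrict_iff' hZ] at hae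
  have hwm : AEStronglyMeasurable w (volume.restrict U) :=
    (hwc.mono subset_closure).aestronglyMeasurable hU.measurableSet
  have hlim := tendsto_integral_of_dominated_convergence (μ := volume.restrict U)
    (F := fun (k : ℕ) x => softCutoff k (w x) * ∑ i, pd i v x * pd i w x)
    (f := fun x => ∑ i, pd i v x * pd i w x)
    (fun x => ‖∑ i, pd i v x * pd i w x‖)
    (fun k => ((continuous_softCutoff k).comp_aestronglyMeasurable hwm).mul
      hint.aestronglyMeasurable)
    hint.norm
    (fun k => Filter.Eventually.of_forall fun x => by
      rw [norm_mul, Real.norm_of_nonneg (softCutoff_nonneg k _)]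
      exact mul_le_of_le_one_left (norm_nonneg _) (softCutoff_le_one k _))
    (by
      filter_upwards [ae_restrict_of_ae hae, ae_restrict_mem hU.measurableSet] with x hx hxU
      by_cases h0 : w x = 0
      · simp [pd, hx ⟨hxU, h0⟩]
      · simpa using (tendsto_softCutoff h0).mul_const (∑ i, pd i v x * pd i w x))
  refine tendsto_nhds_unique hlim ?_
  simp only [setIntegral_softCutoff_mul_sum_pd_eq_zero hU hUb hv hharm hw hwc hw0]
  exact tendsto_const_nhds

/-- Dirichlet's principle, as used in the proof of Theorem 1.10: the harmonic extension
minimizes the Dirichlet energy among functions with the same boundary values. -/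
theorem stmt_5 (n : ℕ) (u v : EuclideanSpace ℝ (Fin n) → ℝ)
    (hu : ContDiffOn ℝ 1 u (closedBall (0 : EuclideanSpace ℝ (Fin n)) 1))
    (hv : ContinuousOn v (closedBall (0 : EuclideanSpace ℝ (Fin n)) 1))
    (hv2 : ContDiffOn ℝ 2 v (ball (0 : EuclideanSpace ℝ (Fin n)) 1))
    (hharm : ∀ x ∈ ball (0 : EuclideanSpace ℝ (Fin n)) 1, ∑ i, pd i (pd i v) x = 0)
    (hint : IntegrableOn (fun x => ∑ i, (pd i v x) ^ 2)
      (closedBall (0 : EuclideanSpace ℝ (Fin n)) 1))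
    (hbd : ∀ x ∈ sphere (0 : EuclideanSpace ℝ (Fin n)) 1, v x = u x) :
    (∫ x in closedBall (0 : EuclideanSpace ℝ (Fin n)) 1, ∑ i, (pd i v x) ^ 2)
      ≤ ∫ x in closedBall (0 : EuclideanSpace ℝ (Fin n)) 1, ∑ i, (pd i u x) ^ 2 := by
  have hUo : IsOpen (ball (0 : EuclideanSpace ℝ (Fin n)) 1) := isOpen_ball
  have hball : (closedBall (0 : EuclideanSpace ℝ (Fin n)) 1 : Set _) =ᵐ[volume] ball 0 1 :=
    (ae_eq_of_subset_of_measure_ge ball_subset_closedBall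
      (Measure.addHaar_closedBall volume _ zero_le_one |>.trans (by simp)).le
      measurableSet_ball.nullMeasurableSet measure_closedBall_lt_top.ne).symm
  rw [setIntegral_congr_set hball, setIntegral_congr_set hball]
  rw [integrableOn_congr_set_ae hball] at hint
  set μ := volume.restrict (ball (0 : EuclideanSpace ℝ (Fin n)) 1)
  have : IsFiniteMeasure μ := isFiniteMeasure_restrict.mpr measure_ball_lt_top.ne
  have hub := hu.mono ball_subset_closedBall
  have hw := hub.sub (hv2.of_le one_le_two)
  have hpdu : ∀ i, MemLp (pd i u) 2 μ := by
    intro i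
    have huniq : UniqueDiffOn ℝ (closedBall (0 : EuclideanSpace ℝ (Fin n)) 1) :=
      uniqueDiffOn_convex (convex_closedBall _ _)
        ⟨0, mem_interior_iff_mem_nhds.mpr (closedBall_mem_nhds _ one_pos)⟩
    have hc : ContinuousOn (fun x => fderivWithin ℝ u (closedBall 0 1) x
        (EuclideanSpace.single i 1)) (closedBall 0 1) :=
      (hu.continuousOn_fderivWithin huniq le_rfl).clm_apply continuousOn_const
    obtain ⟨C, hC⟩ := (isCompact_closedBall _ _).exists_bound_of_continuousOn hc
    refine MemLp.of_bound ((contDiffOn_pd hUo hub (m := 0) (by simp) i).continuousOn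
      |>.aestronglyMeasurable measurableSet_ball) C ?_
    filter_upwards [ae_restrict_mem measurableSet_ball] with x hx
    have := hC x (ball_subset_closedBall hx)
    rwa [fderivWithin_of_mem_nhds (Filter.mem_of_superset (isOpen_ball.mem_nhds hx)
      ball_subset_closedBall)] at this
  have hpdv : ∀ i, MemLp (pd i v) 2 μ := by
    intro i
    have hm := (contDiffOn_pd hUo hv2 (m := 1) (by norm_num) i).continuousOn
      |>.aestronglyMeasurable (μ := volume) measurableSet_ball
    rw [memLp_two_iff_integrable_sq hm]
    refine hint.mono' (hm.pow 2) (Filter.Eventually.of_forall fun x => ?_)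
    rw [Real.norm_of_nonneg (sq_nonneg _)]
    exact Finset.single_le_sum (f := fun i => pd i v x ^ 2) (fun i _ => sq_nonneg _)
      (Finset.mem_univ i)
  have hpdw : ∀ i, ∀ x ∈ ball (0 : EuclideanSpace ℝ (Fin n)) 1,
      pd i (u - v) x = pd i u x - pd i v x := by
    intro i x hx
    have h1 := (hub.contDiffAt (hUo.mem_nhds hx)).differentiableAt one_ne_zero
    have h2 := (hv2.contDiffAt (hUo.mem_nhds hx)).differentiableAt two_ne_zero
    simp [pd, fderiv_sub h1 h2]
  have hcross : Integrable (fun x => ∑ i, pd i v x * pd i (u - v) x) μ := by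
    refine Integrable.congr (integrable_finsetSum Finset.univ fun i _ =>
      (hpdv i).integrable_mul ((hpdu i).sub (hpdv i))) ?_
    filter_upwards [ae_restrict_mem measurableSet_ball] with x hx
    simp [hpdw _ x hx]
  have horth : ∫ x, ∑ i, pd i v x * pd i (u - v) x ∂μ = 0 := by
    refine setIntegral_sum_pd_mul_pd_eq_zero hUo isBounded_ball hv2 hharm hw ?_ ?_ hcross
    · rw [closure_ball _ one_ne_zero]
      exact hu.continuousOn.sub hv
    · rw [frontier_ball _ one_ne_zero]
      intro x hx
      simp [hbd x hx]
  have hui : Integrable (fun x => ∑ i, pd i u x ^ 2) μ :=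
    integrable_finsetSum _ fun i _ => (hpdu i).integrable_sq
  have hle : ∫ x, (∑ i, pd i v x ^ 2 + 2 * ∑ i, pd i v x * pd i (u - v) x) ∂μ
      ≤ ∫ x, ∑ i, pd i u x ^ 2 ∂μ := by
    refine integral_mono_ae (hint.add (hcross.const_mul 2)) hui ?_
    filter_upwards [ae_restrict_mem measurableSet_ball] with x hx
    simp only [hpdw _ x hx, Finset.mul_sum, ← Finset.sum_add_distrib]
    exact Finset.sum_le_sum fun i _ => by nlinarith [sq_nonneg (pd i u x - pd i v x)]
  rw [integral_add hint (hcross.const_mul 2), integral_const_mul, horth] at hle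
  simpa using hle
end
end
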